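/- arXiv:math/0304184 — 4 statements merged into one kernel-verified Lean document; each statement's English description precedes it below -/
import Mathlib

section
/- Let H be a complex Hilbert space, let F : H → H be a bounded linear operator with bounded inverse, let A : H → H be an orthogonal projection (a bounded self-adjoint operator with A² = A), and let t > 0. Assume that Im⟨Fv, v⟩ ≥ t‖v‖² for every v ∈ H (the inner product being linear in its first argument), and that ‖A F^{-1} A‖ ≤ 1. Then ‖F^{-1} A f‖ ≤ t^{-1/2} ‖A f‖ for every f ∈ H; in particular ‖F^{-1} A‖ ≤ t^{-1/2}. -/
open scoped ComplexInnerProductSpace in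
/-- A self-adjoint idempotent does not increase norms. -/
lemma IsSelfAdjoint.norm_apply_le_of_comp_self
    {H : Type*} [NormedAddCommGroup H] [InnerProductSpace ℂ H] [CompleteSpace H]
    {A : H →L[ℂ] H} (hA : IsSelfAdjoint A) (hA2 : A ∘L A = A) (f : H) : ‖A f‖ ≤ ‖f‖ := by
  have hAA : A (A f) = A f := congrArg (fun T : H →L[ℂ] H => T f) hA2
  have h : (⟪A f, A f⟫ : ℂ) = ⟪f, A f⟫ := by
    have hsymm : (⟪A f, A f⟫ : ℂ) = ⟪f, A (A f)⟫ := hA.isSymmetric f (A f)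
    rw [hsymm, hAA]
  have h1 : ‖A f‖ * ‖A f‖ ≤ ‖f‖ * ‖A f‖ := by
    calc ‖A f‖ * ‖A f‖ = ‖(⟪A f, A f⟫ : ℂ)‖ := by
          rw [inner_self_eq_norm_sq_to_K, norm_pow, RCLike.norm_ofReal, abs_norm, sq]
      _ ≤ ‖f‖ * ‖A f‖ := h ▸ norm_inner_le_norm _ _
  rcases (norm_nonneg (A f)).eq_or_lt with h0 | h0
  · rw [← h0]
    exact norm_nonneg f
  · exact le_of_mul_le_mul_right h1 h0

open scoped ComplexInnerProductSpace in
/-- If the quadratic form of `F` has imaginary part bounded below by `t` and the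
compression `A F⁻¹ A` of the inverse by an orthogonal projection `A` is a contraction,
then `F⁻¹` gains a factor `t^{-1/2}` on the range of `A`.
(Inner products are written in the paper's convention, linear in the first argument,
i.e. `⟨Fv, v⟩ = ⟪v, F v⟫` in Mathlib's convention.) -/
theorem inverse_gain_on_projection_range
    {H : Type*} [NormedAddCommGroup H] [InnerProductSpace ℂ H] [CompleteSpace H]
    (F : H ≃L[ℂ] H) (A : H →L[ℂ] H)
    (hAsa : IsSelfAdjoint A) (hAproj : A ∘L A = A)
    (t : ℝ) (ht : 0 < t)
    (hcoer : ∀ v : H, t * ‖v‖ ^ 2 ≤ (⟪v, (F : H →L[ℂ] H) v⟫ : ℂ).im)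
    (hAFA : ‖A ∘L (F.symm : H →L[ℂ] H) ∘L A‖ ≤ 1) :
    (∀ f : H, ‖F.symm (A f)‖ ≤ (Real.sqrt t)⁻¹ * ‖A f‖) ∧
      ‖(F.symm : H →L[ℂ] H) ∘L A‖ ≤ (Real.sqrt t)⁻¹ := by
  have key (f : H) : ‖F.symm (A f)‖ ≤ (Real.sqrt t)⁻¹ * ‖A f‖ := by
    have hAA : A (A f) = A f := congrArg (fun T : H →L[ℂ] H => T f) hAproj
    have hcontr : ‖A (F.symm (A f))‖ ≤ ‖A f‖ := by
      have h := (A ∘L (F.symm : H →L[ℂ] H) ∘L A).le_of_opNorm_le hAFA (A f)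
      simpa [hAA] using h
    have hinner : (⟪F.symm (A f), A f⟫ : ℂ) = ⟪A (F.symm (A f)), A f⟫ := by
      have hsymm : (⟪A (F.symm (A f)), A f⟫ : ℂ) = ⟪F.symm (A f), A (A f)⟫ :=
        hAsa.isSymmetric _ _
      rw [hsymm, hAA]
    have hsq : t * ‖F.symm (A f)‖ ^ 2 ≤ ‖A f‖ ^ 2 := by
      calc t * ‖F.symm (A f)‖ ^ 2 ≤ (⟪F.symm (A f), A f⟫ : ℂ).im := by
            simpa using hcoer (F.symm (A f))
        _ ≤ ‖(⟪A (F.symm (A f)), A f⟫ : ℂ)‖ :=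
            hinner ▸ (le_abs_self _).trans (Complex.abs_im_le_norm _)
        _ ≤ ‖A (F.symm (A f))‖ * ‖A f‖ := norm_inner_le_norm _ _
        _ ≤ ‖A f‖ * ‖A f‖ := by gcongr
        _ = ‖A f‖ ^ 2 := (sq _).symm
    rw [le_inv_mul_iff₀ (Real.sqrt_pos.2 ht)]
    refine le_of_pow_le_pow_left₀ two_ne_zero (norm_nonneg _) ?_
    rwa [mul_pow, Real.sq_sqrt ht.le]
  refine ⟨key, ContinuousLinearMap.opNorm_le_bound _ (by positivity) fun f => ?_⟩
  calc ‖F.symm (A f)‖ ≤ (Real.sqrt t)⁻¹ * ‖A f‖ := key f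
    _ ≤ (Real.sqrt t)⁻¹ * ‖f‖ := by
        gcongr
        exact hAsa.norm_apply_le_of_comp_self hAproj f
end

section
/- Let 0 ≤ α < β ≤ 1. There exists a constant C > 0 such that for every μ ∈ ℝ and every twice continuously differentiable function u : [0,1] → ℂ with u(0) = u(1) = 0, setting f = u'' − μu, one has ∫₀¹ |u(x)|² dx ≤ C (‖f‖²_{H^{-1}(0,1)} + ∫_α^β |u(x)|² dx). -/
open MeasureTheory

/-- The `H^{-1}(0,1)` norm of a function `f : [0,1] → ℂ`, defined by duality against
smooth test functions compactly supported in `(0,1)` with `H¹`-norm at most one. -/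
noncomputable def Hm1Norm (f : ℝ → ℂ) : ℝ :=
  sSup {r : ℝ | ∃ g : ℝ → ℂ, ContDiff ℝ (⊤ : ℕ∞) g ∧ HasCompactSupport g ∧
    tsupport g ⊆ Set.Ioo 0 1 ∧
    (∫ x in (0:ℝ)..1, (‖g x‖ ^ 2 + ‖deriv g x‖ ^ 2)) ≤ 1 ∧
    r = ‖∫ x in (0:ℝ)..1, f x * (starRingEnd ℂ) (g x)‖}

open Set Filter Topology

theorem sq_integral_le_integral_sq {φ : ℝ → ℝ} {a b : ℝ} (hab : a ≤ b) (hba : b - a ≤ 1)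
    (hφ : ContinuousOn φ (Icc a b)) : (∫ x in a..b, φ x) ^ 2 ≤ ∫ x in a..b, φ x ^ 2 := by
  rw [← uIcc_of_le hab] at hφ
  set m := ∫ x in a..b, φ x with hm
  have h0 : 0 ≤ ∫ x in a..b, (φ x - m) ^ 2 :=
    intervalIntegral.integral_nonneg hab fun x _ => sq_nonneg _
  have h1 : ∫ x in a..b, (φ x - m) ^ 2 =
      (∫ x in a..b, φ x ^ 2) - 2 * m * m + (b - a) * m ^ 2 := by
    have e : ∀ x, (φ x - m) ^ 2 = φ x ^ 2 - 2 * m * φ x + m ^ 2 := fun x => by ring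
    simp_rw [e]
    rw [intervalIntegral.integral_add, intervalIntegral.integral_sub,
      intervalIntegral.integral_const_mul, intervalIntegral.integral_const, ← hm, smul_eq_mul]
    all_goals exact ContinuousOn.intervalIntegrable (by fun_prop)
  nlinarith [sq_nonneg m]

theorem norm_sq_integral_le {φ : ℝ → ℂ} {a b : ℝ} (hab : a ≤ b) (hba : b - a ≤ 1)
    (hφ : ContinuousOn φ (Icc a b)) : ‖∫ x in a..b, φ x‖ ^ 2 ≤ ∫ x in a..b, ‖φ x‖ ^ 2 := by
  refine le_trans ?_ (sq_integral_le_integral_sq hab hba hφ.norm)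
  gcongr
  exact intervalIntegral.norm_integral_le_integral_norm hab

theorem integral_norm_add_sq_le {φ ψ : ℝ → ℂ} {a b : ℝ} (hab : a ≤ b)
    (hφ : ContinuousOn φ (Icc a b)) (hψ : ContinuousOn ψ (Icc a b)) :
    ∫ x in a..b, ‖φ x + ψ x‖ ^ 2 ≤
      2 * (∫ x in a..b, ‖φ x‖ ^ 2) + 2 * ∫ x in a..b, ‖ψ x‖ ^ 2 := by
  rw [← uIcc_of_le hab] at hφ hψ
  rw [← intervalIntegral.integral_const_mul, ← intervalIntegral.integral_const_mul,
    ← intervalIntegral.integral_add]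
  · refine intervalIntegral.integral_mono_on hab ?_ ?_ fun x _ => ?_
    · exact ContinuousOn.intervalIntegrable (by fun_prop)
    · exact ContinuousOn.intervalIntegrable (by fun_prop)
    · have := norm_add_le (φ x) (ψ x)
      nlinarith [sq_nonneg (‖φ x‖ - ‖ψ x‖), norm_nonneg (φ x + ψ x)]
  all_goals exact ContinuousOn.intervalIntegrable (by fun_prop)

/-- Poincaré's inequality on the unit interval, for functions vanishing at the left endpoint. -/
theorem norm_sq_le_integral_norm_deriv_sq {g g' : ℝ → ℂ} (hg : ContinuousOn g (Icc 0 1))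
    (hd : ∀ x ∈ Ioo (0 : ℝ) 1, HasDerivAt g (g' x) x) (hg' : ContinuousOn g' (Icc 0 1))
    (h0 : g 0 = 0) {x : ℝ} (hx : x ∈ Icc (0 : ℝ) 1) :
    ‖g x‖ ^ 2 ≤ ∫ t in (0 : ℝ)..1, ‖g' t‖ ^ 2 := by
  have hs : Icc 0 x ⊆ Icc (0 : ℝ) 1 := Icc_subset_Icc_right hx.2
  have h : ∫ t in (0 : ℝ)..x, g' t = g x := by
    rw [intervalIntegral.integral_eq_sub_of_hasDerivAt_of_le hx.1 (hg.mono hs)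
      (fun t ht => hd t ⟨ht.1, ht.2.trans_le hx.2⟩), h0, sub_zero]
    exact (hg'.mono hs).intervalIntegrable_of_Icc hx.1
  rw [← h]
  refine (norm_sq_integral_le hx.1 (by linarith [hx.2]) (hg'.mono hs)).trans ?_
  refine intervalIntegral.integral_mono_interval le_rfl hx.1 hx.2 ?_ ?_
  · exact Eventually.of_forall fun t => by positivity
  · exact ContinuousOn.intervalIntegrable_of_Icc zero_le_one (by fun_prop)

theorem tendsto_integral_norm_sub_cutoff_sq {φ : ℝ → ℂ} (hφ : Continuous φ) :
    Tendsto (fun n : ℕ => ∫ x in (0 : ℝ)..1,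
      ‖φ x - (max 0 (min 1 (n * min x (1 - x) - 1)) : ℝ) * φ x‖ ^ 2) atTop (𝓝 0) := by
  have h := intervalIntegral.tendsto_integral_filter_of_dominated_convergence
    (μ := volume) (a := 0) (b := 1) (l := (atTop : Filter ℕ))
    (F := fun n x => ‖φ x - (max 0 (min 1 (n * min x (1 - x) - 1)) : ℝ) * φ x‖ ^ 2)
    (f := fun _ => (0 : ℝ)) (fun x => ‖φ x‖ ^ 2) ?_ ?_ ?_ ?_
  · simpa using h
  · exact Eventually.of_forall fun n => by
      refine Continuous.aestronglyMeasurable ?_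
      fun_prop
  · refine Eventually.of_forall fun n => Eventually.of_forall fun x _ => ?_
    set k := max 0 (min 1 (n * min x (1 - x) - 1))
    have hk0 : 0 ≤ k := le_max_left _ _
    have hk1 : k ≤ 1 := max_le zero_le_one (min_le_left _ _)
    have e : φ x - (k : ℂ) * φ x = ((1 - k : ℝ) : ℂ) * φ x := by push_cast; ring
    rw [Real.norm_of_nonneg (sq_nonneg _), e, norm_mul, Complex.norm_real,
      Real.norm_of_nonneg (sub_nonneg.2 hk1)]
    gcongr
    exact mul_le_of_le_one_left (norm_nonneg _) (by linarith)
  · exact Continuous.intervalIntegrable (by fun_prop) _ _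
  · have hne : ∀ᵐ x : ℝ, x ≠ 1 := by simp [ae_iff]
    filter_upwards [hne] with x hx1 hx
    rw [uIoc_of_le zero_le_one] at hx
    have hx2 : 0 < min x (1 - x) :=
      lt_min hx.1 (sub_pos.2 (lt_of_le_of_ne hx.2 hx1))
    refine tendsto_const_nhds.congr' ?_
    filter_upwards [(tendsto_natCast_atTop_atTop.atTop_mul_const hx2).eventually_ge_atTop 2]
      with n hn
    rw [min_eq_left (by linarith), max_eq_right zero_le_one]
    simp

/-- A continuous function on `[0, 1]` is approximated in `L²` by smooth functions supported in
`[δ, 1 - δ]` for some small `δ`. -/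
theorem exists_contDiff_integral_norm_sub_sq_le {φ : ℝ → ℂ} (hφ : Continuous φ) {ε : ℝ}
    (hε : 0 < ε) : ∃ (p : ℝ → ℂ) (δ : ℝ), 0 < δ ∧ δ ≤ 1 / 4 ∧ ContDiff ℝ (⊤ : ℕ∞) p ∧
      (∀ x, x ≤ δ ∨ 1 - δ ≤ x → p x = 0) ∧ ∫ x in (0 : ℝ)..1, ‖φ x - p x‖ ^ 2 ≤ ε := by
  obtain ⟨n, hn, hn4⟩ := (((tendsto_integral_norm_sub_cutoff_sq hφ).eventually_lt_const
    (show (0 : ℝ) < ε / 4 by positivity)).and (eventually_ge_atTop 4)).exists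
  have hn4' : (4 : ℝ) ≤ n := by exact_mod_cast hn4
  have hn0 : (0 : ℝ) < n := by linarith
  set κ : ℝ → ℂ := fun x => (max 0 (min 1 (n * min x (1 - x) - 1)) : ℝ) * φ x with hκ
  have hκc : Continuous κ := by fun_prop
  obtain ⟨p, hp, hpκ, hsupp⟩ := hκc.exists_contDiff_approx (⊤ : ℕ∞)
    (ε := fun _ => √(ε / 4)) continuous_const (fun _ => by positivity)
  refine ⟨p, 1 / n, by positivity, ?_, hp, fun x hx => ?_, ?_⟩
  · exact one_div_le_one_div_of_le (by norm_num) hn4'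
  · by_contra h
    refine hsupp (show x ∈ Function.support p from h) ?_
    have hm : min x (1 - x) ≤ 1 / n := by
      rcases hx with hx | hx
      · exact (min_le_left _ _).trans hx
      · exact (min_le_right _ _).trans (by linarith)
    have hm' : n * min x (1 - x) ≤ 1 := by
      rw [le_div_iff₀ hn0] at hm
      linarith
    simp only [hκ]
    rw [max_eq_left ((min_le_right _ _).trans (by linarith))]
    simp
  · have hpc := hp.continuous
    have h1 := integral_norm_add_sq_le (φ := fun x => φ x - κ x) (ψ := fun x => κ x - p x)
      zero_le_one (by fun_prop) (by fun_prop)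
    simp only [sub_add_sub_cancel] at h1
    have h2 : ∫ x in (0 : ℝ)..1, ‖κ x - p x‖ ^ 2 ≤ ε / 4 := by
      have h3 : ∫ x in (0 : ℝ)..1, ‖κ x - p x‖ ^ 2 ≤ ∫ x in (0 : ℝ)..1, ε / 4 := by
        refine intervalIntegral.integral_mono_on zero_le_one
          (Continuous.intervalIntegrable (by fun_prop) _ _) (by simp) fun x _ => ?_
        have := hpκ x
        rw [dist_comm, dist_eq_norm] at this
        calc ‖κ x - p x‖ ^ 2 ≤ √(ε / 4) ^ 2 := by gcongr
          _ = ε / 4 := Real.sq_sqrt (by positivity)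
      simpa using h3
    linarith

/-- A smooth transition from `0` to `1` between `a` and `b`. -/
theorem exists_smooth_transition {a b : ℝ} (hab : a < b) :
    ∃ θ : ℝ → ℝ, ContDiff ℝ (⊤ : ℕ∞) θ ∧ (∀ x, 0 ≤ θ x) ∧ (∀ x, θ x ≤ 1) ∧
      (∀ x ≤ a, θ x = 0) ∧ ∀ x, b ≤ x → θ x = 1 := by
  have hba := sub_pos.2 hab
  refine ⟨fun x => Real.smoothTransition ((x - a) / (b - a)),
    Real.smoothTransition.contDiff.comp (by fun_prop), fun x => Real.smoothTransition.nonneg _,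
    fun x => Real.smoothTransition.le_one _, fun x hx => ?_, fun x hx => ?_⟩
  · exact Real.smoothTransition.zero_of_nonpos
      (div_nonpos_of_nonpos_of_nonneg (by linarith) hba.le)
  · exact Real.smoothTransition.one_of_one_le ((one_le_div hba).2 (by linarith))

theorem contDiff_integral {p : ℝ → ℂ} (hp : ContDiff ℝ (⊤ : ℕ∞) p) :
    ContDiff ℝ (⊤ : ℕ∞) fun x => ∫ t in (0 : ℝ)..x, p t := by
  have hd : ∀ x, HasDerivAt (fun x => ∫ t in (0 : ℝ)..x, p t) (p x) x := fun x =>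
    hp.continuous.integral_hasStrictDerivAt 0 x |>.hasDerivAt
  rw [contDiff_infty_iff_deriv]
  refine ⟨fun x => (hd x).differentiableAt, ?_⟩
  rwa [funext fun x => (hd x).deriv]

/-- Mean-zero continuous functions are approximated in `L²(0, 1)` by derivatives of test
functions. -/
theorem exists_testFunction_deriv_approx {φ : ℝ → ℂ} (hφ : Continuous φ)
    (hφ0 : ∫ x in (0 : ℝ)..1, φ x = 0) {ε : ℝ} (hε : 0 < ε) :
    ∃ G : ℝ → ℂ, ContDiff ℝ (⊤ : ℕ∞) G ∧ HasCompactSupport G ∧ tsupport G ⊆ Ioo 0 1 ∧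
      ∫ x in (0 : ℝ)..1, ‖φ x - deriv G x‖ ^ 2 ≤ ε := by
  obtain ⟨θ, hθ, -, -, hθ0, hθ1⟩ := exists_smooth_transition (show (1 / 4 : ℝ) < 3 / 4 by norm_num)
  have hθc : Continuous (deriv θ) := hθ.continuous_deriv (by simp)
  set R := ∫ x in (0 : ℝ)..1, ‖((deriv θ x : ℝ) : ℂ)‖ ^ 2 with hR
  have hR0 : 0 ≤ R := intervalIntegral.integral_nonneg zero_le_one fun x _ => by positivity
  obtain ⟨p, δ, hδ, hδ4, hp, hp0, hpφ⟩ := exists_contDiff_integral_norm_sub_sq_le hφ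
    (show 0 < ε / (2 + 2 * R) by positivity)
  have hpc := hp.continuous
  set m := ∫ x in (0 : ℝ)..1, p x with hm
  have hmle : ‖m‖ ^ 2 ≤ ε / (2 + 2 * R) := by
    have h := norm_sq_integral_le (φ := fun x => φ x - p x) zero_le_one (by norm_num)
      (by fun_prop)
    rw [intervalIntegral.integral_sub (hφ.intervalIntegrable _ _) (hpc.intervalIntegrable _ _),
      hφ0, zero_sub, norm_neg] at h
    exact h.trans hpφ
  have hθd : ∀ x, HasDerivAt (fun x => (θ x : ℂ)) ((deriv θ x : ℝ) : ℂ) x := fun x =>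
    ((hθ.differentiable (by simp) x).hasDerivAt).ofReal_comp
  set G : ℝ → ℂ := fun x => (∫ t in (0 : ℝ)..x, p t) - m * θ x with hG
  have hGd : ∀ x, HasDerivAt G (p x - m * (deriv θ x : ℝ)) x := fun x =>
    (hpc.integral_hasStrictDerivAt 0 x).hasDerivAt.sub ((hθd x).const_mul m)
  have hGc : ContDiff ℝ (⊤ : ℕ∞) G := by
    refine (contDiff_integral hp).sub (contDiff_const.mul ?_)
    exact Complex.ofRealCLM.contDiff.comp hθ
  have hG0 : ∀ x, x ∉ Icc δ (1 - δ) → G x = 0 := by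
    intro x hx
    rcases lt_or_ge x δ with h | h
    · have h1 : ∫ t in (0 : ℝ)..x, p t = 0 := by
        refine intervalIntegral.integral_zero_ae (Eventually.of_forall fun t ht => hp0 t (.inl ?_))
        exact (mem_uIcc.1 (uIoc_subset_uIcc ht)).elim (fun h' => by linarith [h'.2])
          fun h' => by linarith [h'.2]
      simp [hG, h1, hθ0 x (by linarith)]
    · have h2 : 1 - δ < x := by
        by_contra h3
        exact hx ⟨h, not_lt.1 h3⟩
      have h1 : ∫ t in x..1, p t = 0 := by
        refine intervalIntegral.integral_zero_ae (Eventually.of_forall fun t ht => hp0 t (.inr ?_))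
        exact (mem_uIcc.1 (uIoc_subset_uIcc ht)).elim (fun h' => by linarith [h'.1])
          fun h' => by linarith [h'.1]
      have h3 := intervalIntegral.integral_add_adjacent_intervals
        (hpc.intervalIntegrable (μ := volume) 0 x) (hpc.intervalIntegrable x 1)
      rw [h1, add_zero] at h3
      simp [hG, h3, hθ1 x (by linarith), hm]
  have hts : tsupport G ⊆ Icc δ (1 - δ) :=
    closure_minimal (fun x hx => by_contra fun h => hx (hG0 x h)) isClosed_Icc
  refine ⟨G, hGc, HasCompactSupport.intro isCompact_Icc hG0,
    hts.trans (Icc_subset_Ioo hδ (by linarith)), ?_⟩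
  have h1 := integral_norm_add_sq_le (φ := fun x => φ x - p x)
    (ψ := fun x => m * (deriv θ x : ℝ)) zero_le_one (by fun_prop) (by fun_prop)
  have h2 : ∫ x in (0 : ℝ)..1, ‖m * (deriv θ x : ℝ)‖ ^ 2 = ‖m‖ ^ 2 * R := by
    rw [hR, ← intervalIntegral.integral_const_mul]
    simp_rw [norm_mul, mul_pow]
  have e : ∀ x, φ x - deriv G x = φ x - p x + m * (deriv θ x : ℝ) := fun x => by
    rw [(hGd x).deriv]; ring
  simp_rw [e]
  refine h1.trans ?_
  rw [h2]
  calc _ ≤ 2 * (ε / (2 + 2 * R)) + 2 * (ε / (2 + 2 * R) * R) := by gcongr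
    _ = ε := by field_simp

theorem integral_norm_mul_le {f g : ℝ → ℂ} {F : ℝ} (hF : ∀ x ∈ Icc (0 : ℝ) 1, ‖f x‖ ≤ F)
    (hF0 : 0 ≤ F) {ε : ℝ} (hg : ∀ x ∈ Icc (0 : ℝ) 1, ‖g x‖ ≤ ε) :
    ‖∫ x in (0 : ℝ)..1, f x * g x‖ ≤ F * ε := by
  have h := intervalIntegral.norm_integral_le_of_norm_le_const (a := 0) (b := 1) (C := F * ε)
    (f := fun x => f x * g x) fun x hx => by
      rw [uIoc_of_le zero_le_one] at hx
      rw [norm_mul]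
      exact mul_le_mul (hF x ⟨hx.1.le, hx.2⟩) (hg x ⟨hx.1.le, hx.2⟩) (norm_nonneg _) hF0
  simpa using h

theorem norm_integral_mul_conj_le_Hm1Norm {f : ℝ → ℂ} (hf : ContinuousOn f (Icc 0 1))
    {g : ℝ → ℂ} (hg : ContDiff ℝ (⊤ : ℕ∞) g) (hgc : HasCompactSupport g)
    (hgs : tsupport g ⊆ Ioo 0 1)
    (hg1 : ∫ x in (0 : ℝ)..1, (‖g x‖ ^ 2 + ‖deriv g x‖ ^ 2) ≤ 1) :
    ‖∫ x in (0 : ℝ)..1, f x * (starRingEnd ℂ) (g x)‖ ≤ Hm1Norm f := by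
  refine le_csSup ?_ ⟨g, hg, hgc, hgs, hg1, rfl⟩
  obtain ⟨F, hF⟩ := isCompact_Icc.exists_bound_of_continuousOn hf
  refine ⟨F * 1, ?_⟩
  rintro r ⟨g, hg, -, hgs, hg1, rfl⟩
  have hF0 : 0 ≤ F := (norm_nonneg _).trans (hF 0 (by simp))
  have hd : Continuous (deriv g) := hg.continuous_deriv (by simp)
  have hc := hg.continuous
  refine integral_norm_mul_le hF hF0 fun x hx => ?_
  have h0 : g 0 = 0 := by
    by_contra h
    exact lt_irrefl _ (hgs (subset_tsupport g h)).1
  have h1 := norm_sq_le_integral_norm_deriv_sq hc.continuousOn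
    (fun x _ => (hg.differentiable (by simp) x).hasDerivAt) hd.continuousOn h0 hx
  have h2 : ∫ x in (0 : ℝ)..1, ‖deriv g x‖ ^ 2 ≤
      ∫ x in (0 : ℝ)..1, (‖g x‖ ^ 2 + ‖deriv g x‖ ^ 2) :=
    intervalIntegral.integral_mono_on zero_le_one
      (Continuous.intervalIntegrable (by fun_prop) _ _)
      (Continuous.intervalIntegrable (by fun_prop) _ _)
      fun x _ => le_add_of_nonneg_left (by positivity)
  rw [RCLike.norm_conj]
  exact (sq_le_one_iff₀ (norm_nonneg _)).1 (by linarith)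

theorem norm_integral_mul_testFunction_le {f : ℝ → ℂ} (hf : ContinuousOn f (Icc 0 1))
    {g : ℝ → ℂ} (hg : ContDiff ℝ (⊤ : ℕ∞) g) (hgc : HasCompactSupport g)
    (hgs : tsupport g ⊆ Ioo 0 1) {c : ℝ} (hc : 0 < c)
    (hgE : ∫ x in (0 : ℝ)..1, (‖g x‖ ^ 2 + ‖deriv g x‖ ^ 2) ≤ c ^ 2) :
    ‖∫ x in (0 : ℝ)..1, f x * g x‖ ≤ c * Hm1Norm f := by
  set G : ℝ → ℂ := fun x => (c⁻¹ : ℝ) * (starRingEnd ℂ) (g x) with hG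
  have hGd : ∀ x, HasDerivAt G ((c⁻¹ : ℝ) * (starRingEnd ℂ) (deriv g x)) x := fun x =>
    ((Complex.conjCLE.toContinuousLinearMap.hasFDerivAt.comp_hasDerivAt x
      (hg.differentiable (by simp) x).hasDerivAt)).const_mul _
  have hsub : Function.support G ⊆ Function.support g := fun x hx h => hx (by simp [hG, h])
  have hcn : ‖((c⁻¹ : ℝ) : ℂ)‖ = c⁻¹ := by
    rw [Complex.norm_real, Real.norm_of_nonneg (by positivity)]
  have h := norm_integral_mul_conj_le_Hm1Norm hf (g := G)
    (contDiff_const.mul (Complex.conjCLE.contDiff.comp hg)) (hgc.mono hsub)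
    ((closure_mono hsub).trans hgs) ?_
  · have e : ∀ x, f x * (starRingEnd ℂ) (G x) = (c⁻¹ : ℝ) * (f x * g x) := fun x => by
      simp only [hG, map_mul, Complex.conj_ofReal, Complex.conj_conj]; ring
    simp_rw [e] at h
    rw [intervalIntegral.integral_const_mul, norm_mul, hcn] at h
    rwa [inv_mul_le_iff₀ hc] at h
  · have e : ∀ x, ‖G x‖ ^ 2 + ‖deriv G x‖ ^ 2 = c⁻¹ ^ 2 * (‖g x‖ ^ 2 + ‖deriv g x‖ ^ 2) :=
      fun x => by
        rw [(hGd x).deriv, hG]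
        simp only [norm_mul, hcn, RCLike.norm_conj]
        ring
    simp_rw [e]
    rw [intervalIntegral.integral_const_mul]
    calc _ ≤ c⁻¹ ^ 2 * c ^ 2 := by gcongr
      _ = 1 := by field_simp

/-- The duality bound defining the `H⁻¹` norm extends, up to a factor `2`, to `C¹` functions
vanishing at the endpoints. -/
theorem norm_integral_mul_le_Hm1Norm {f : ℝ → ℂ} (hf : ContinuousOn f (Icc 0 1))
    {g g' : ℝ → ℂ} (hg : ContinuousOn g (Icc 0 1))
    (hd : ∀ x ∈ Ioo (0 : ℝ) 1, HasDerivAt g (g' x) x) (hg' : ContinuousOn g' (Icc 0 1))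
    (h0 : g 0 = 0) (h1 : g 1 = 0) {c : ℝ} (hc : 0 < c)
    (hgE : ∫ x in (0 : ℝ)..1, (‖g x‖ ^ 2 + ‖g' x‖ ^ 2) ≤ c ^ 2) :
    ‖∫ x in (0 : ℝ)..1, f x * g x‖ ≤ 2 * c * Hm1Norm f := by
  obtain ⟨F, hF⟩ := isCompact_Icc.exists_bound_of_continuousOn hf
  have hF0 : 0 ≤ F := (norm_nonneg _).trans (hF 0 (by simp))
  set φ : ℝ → ℂ := IccExtend zero_le_one ((Icc 0 1).domRestrict g') with hφ
  have hφc : Continuous φ := (continuousOn_iff_continuous_domRestrict.1 hg').Icc_extend'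
  have hφe : ∀ x ∈ Icc (0 : ℝ) 1, φ x = g' x := fun x hx => by
    rw [hφ, IccExtend_of_mem _ _ hx]; rfl
  have hdφ : ∀ x ∈ Ioo (0 : ℝ) 1, HasDerivAt g (φ x) x := fun x hx => by
    rw [hφe x (Ioo_subset_Icc_self hx)]; exact hd x hx
  have hφ0 : ∫ x in (0 : ℝ)..1, φ x = 0 := by
    rw [intervalIntegral.integral_eq_sub_of_hasDerivAt_of_le zero_le_one hg hdφ
      (hφc.intervalIntegrable _ _), h0, h1, sub_zero]
  have hE : ∫ x in (0 : ℝ)..1, (‖g x‖ ^ 2 + ‖g' x‖ ^ 2) =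
      (∫ x in (0 : ℝ)..1, ‖g x‖ ^ 2) + ∫ x in (0 : ℝ)..1, ‖φ x‖ ^ 2 := by
    rw [intervalIntegral.integral_add]
    · congr 1
      refine intervalIntegral.integral_congr fun x hx => ?_
      rw [uIcc_of_le zero_le_one] at hx
      simp only [hφe x hx]
    all_goals exact ContinuousOn.intervalIntegrable_of_Icc zero_le_one (by fun_prop)
  refine le_of_forall_pos_le_add fun η hη => ?_
  set ε := min (c / 2) (η / (F + 1)) with hε
  have hε0 : 0 < ε := by positivity
  have hεc : ε ≤ c / 2 := min_le_left _ _
  have hFε : F * ε ≤ η := by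
    have h2 : ε * (F + 1) ≤ η := (le_div_iff₀ (by positivity)).1 (min_le_right _ _)
    nlinarith
  obtain ⟨G, hG, hGc, hGs, hGφ⟩ := exists_testFunction_deriv_approx hφc hφ0
    (show 0 < ε ^ 2 by positivity)
  have hGcont := hG.continuous
  have hGd : Continuous (deriv G) := hG.continuous_deriv (by simp)
  have hG0 : G 0 = 0 := by
    by_contra h
    exact lt_irrefl _ (hGs (subset_tsupport G h)).1
  have hsub : ∀ x ∈ Icc (0 : ℝ) 1, ‖g x - G x‖ ^ 2 ≤ ε ^ 2 := fun x hx =>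
    (norm_sq_le_integral_norm_deriv_sq (g := fun x => g x - G x)
      (g' := fun x => φ x - deriv G x) (by fun_prop)
      (fun x hx => (hdφ x hx).sub (hG.differentiable (by simp) x).hasDerivAt) (by fun_prop)
      (by simp [h0, hG0]) hx).trans hGφ
  have hsub' : ∫ x in (0 : ℝ)..1, ‖g x - G x‖ ^ 2 ≤ ε ^ 2 := by
    have h3 : ∫ x in (0 : ℝ)..1, ‖g x - G x‖ ^ 2 ≤ ∫ x in (0 : ℝ)..1, ε ^ 2 :=
      intervalIntegral.integral_mono_on zero_le_one
        (ContinuousOn.intervalIntegrable_of_Icc zero_le_one (by fun_prop)) (by simp) hsub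
    simpa using h3
  have hGE : ∫ x in (0 : ℝ)..1, (‖G x‖ ^ 2 + ‖deriv G x‖ ^ 2) ≤ (2 * c) ^ 2 := by
    have a1 := integral_norm_add_sq_le (φ := g) (ψ := fun x => -(g x - G x)) zero_le_one hg
      (by fun_prop)
    have a2 := integral_norm_add_sq_le (φ := φ) (ψ := fun x => -(φ x - deriv G x)) zero_le_one
      (by fun_prop) (by fun_prop)
    simp only [norm_neg, ← sub_eq_add_neg, sub_sub_cancel] at a1 a2
    rw [intervalIntegral.integral_add]
    · nlinarith
    all_goals exact Continuous.intervalIntegrable (by fun_prop) _ _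
  have hsplit : ∫ x in (0 : ℝ)..1, f x * g x =
      (∫ x in (0 : ℝ)..1, f x * G x) + ∫ x in (0 : ℝ)..1, f x * (g x - G x) := by
    rw [← intervalIntegral.integral_add]
    · simp_rw [mul_sub, add_sub_cancel]
    all_goals exact ContinuousOn.intervalIntegrable_of_Icc zero_le_one (by fun_prop)
  rw [hsplit]
  refine (norm_add_le _ _).trans (add_le_add
    (norm_integral_mul_testFunction_le hf hG hGc hGs (by positivity) hGE) ?_)
  exact (integral_norm_mul_le hF hF0 fun x hx =>
    abs_le_of_sq_le_sq' (hsub x hx) hε0.le |>.2).trans hFε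

/-- Duhamel's formula: a solution of `G'' + λ² G = h` vanishing at `a`, bounded in `C¹` uniformly
in `λ`. -/
theorem exists_oscillator_solution {l : ℝ} (hl : 0 < l) {h : ℝ → ℂ} (hh : Continuous h) {a : ℝ}
    (ha : a ∈ Icc (0 : ℝ) 1) {S : ℝ} (hS : ∫ x in (0 : ℝ)..1, ‖h x‖ ≤ S) :
    ∃ G G' : ℝ → ℂ, (∀ x, HasDerivAt G (G' x) x) ∧
      (∀ x, HasDerivAt G' (h x - l ^ 2 * G x) x) ∧ G a = 0 ∧
      ∀ x ∈ Icc (0 : ℝ) 1, ‖G x‖ ≤ 2 * S ∧ ‖G' x‖ ≤ 2 * S := by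
  set A : ℝ → ℂ := fun x => ∫ t in a..x, (Real.cos (l * t) : ℂ) * h t with hA
  set B : ℝ → ℂ := fun x => ∫ t in a..x, (Real.sin (l * t) : ℂ) * h t with hB
  have hAd : ∀ x, HasDerivAt A ((Real.cos (l * x) : ℂ) * h x) x := fun x =>
    (Continuous.integral_hasStrictDerivAt (by fun_prop) a x).hasDerivAt
  have hBd : ∀ x, HasDerivAt B ((Real.sin (l * x) : ℂ) * h x) x := fun x =>
    (Continuous.integral_hasStrictDerivAt (by fun_prop) a x).hasDerivAt
  have hlin : ∀ x, HasDerivAt (fun x : ℝ => l * x) l x := fun x => by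
    simpa using (hasDerivAt_id x).const_mul l
  have hs : ∀ x, HasDerivAt (fun x => (Real.sin (l * x) : ℂ))
      ((Real.cos (l * x) * l : ℝ) : ℂ) x := fun x => (hlin x).sin.ofReal_comp
  have hc : ∀ x, HasDerivAt (fun x => (Real.cos (l * x) : ℂ))
      ((-Real.sin (l * x) * l : ℝ) : ℂ) x := fun x => (hlin x).cos.ofReal_comp
  have hl' : (l : ℂ) ≠ 0 := by exact_mod_cast hl.ne'
  have hpyth : ∀ x, (Real.sin (l * x) : ℂ) ^ 2 + (Real.cos (l * x) : ℂ) ^ 2 = 1 := fun x => by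
    exact_mod_cast Real.sin_sq_add_cos_sq (l * x)
  have hbound : ∀ (w : ℝ → ℝ), Continuous w → (∀ t, |w t| ≤ 1) → ∀ x ∈ Icc (0 : ℝ) 1,
      ‖∫ t in a..x, (w t : ℂ) * h t‖ ≤ S := by
    intro w hw hw1 x hx
    have h2 : ∀ t, ‖(w t : ℂ) * h t‖ ≤ ‖h t‖ := fun t => by
      rw [norm_mul, Complex.norm_real]
      exact mul_le_of_le_one_left (norm_nonneg _) (hw1 t)
    have hsub : uIoc a x ⊆ Ioc (0 : ℝ) 1 := by
      rw [uIoc]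
      exact Ioc_subset_Ioc (le_min ha.1 hx.1) (max_le ha.2 hx.2)
    have hi : IntegrableOn (fun t => ‖h t‖) (Ioc (0 : ℝ) 1) :=
      (hh.norm.integrableOn_Icc).mono_set Ioc_subset_Icc_self
    calc ‖∫ t in a..x, (w t : ℂ) * h t‖ ≤ ∫ t in uIoc a x, ‖(w t : ℂ) * h t‖ :=
          intervalIntegral.norm_integral_le_integral_norm_uIoc
      _ ≤ ∫ t in uIoc a x, ‖h t‖ := by
          refine setIntegral_mono (Continuous.integrableOn_uIoc (by fun_prop))
            (hi.mono_set hsub) h2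
      _ ≤ ∫ t in Ioc (0 : ℝ) 1, ‖h t‖ :=
          setIntegral_mono_set hi (Eventually.of_forall fun t => norm_nonneg _)
            hsub.eventuallyLE
      _ ≤ S := by rwa [← intervalIntegral.integral_of_le zero_le_one]
  set G : ℝ → ℂ := fun x =>
    ((Real.sin (l * x) : ℂ) * A x - (Real.cos (l * x) : ℂ) * B x) / l with hG
  set G' : ℝ → ℂ := fun x =>
    (Real.cos (l * x) : ℂ) * A x + (Real.sin (l * x) : ℂ) * B x with hG'
  have hGd : ∀ x, HasDerivAt G (G' x) x := fun x => by
    refine ((((hs x).mul (hAd x)).sub ((hc x).mul (hBd x))).div_const (l : ℂ)).congr_deriv ?_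
    simp only [hG']
    push_cast
    field_simp
    ring
  have hG'd : ∀ x, HasDerivAt G' (h x - l ^ 2 * G x) x := fun x => by
    refine (((hc x).mul (hAd x)).add ((hs x).mul (hBd x))).congr_deriv ?_
    simp only [hG]
    have := hpyth x
    push_cast at this ⊢
    field_simp
    linear_combination h x * this
  have hGa : G a = 0 := by simp [hG, hA, hB]
  have hG'b : ∀ x ∈ Icc (0 : ℝ) 1, ‖G' x‖ ≤ 2 * S := fun x hx => by
    have hAx := hbound (fun t => Real.cos (l * t)) (by fun_prop)
      (fun t => Real.abs_cos_le_one _) x hx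
    have hBx := hbound (fun t => Real.sin (l * t)) (by fun_prop)
      (fun t => Real.abs_sin_le_one _) x hx
    have h1 := norm_add_le ((Real.cos (l * x) : ℂ) * A x) ((Real.sin (l * x) : ℂ) * B x)
    rw [norm_mul, norm_mul, Complex.norm_real, Complex.norm_real, Real.norm_eq_abs,
      Real.norm_eq_abs] at h1
    have h2 := mul_le_of_le_one_left (norm_nonneg (A x)) (Real.abs_cos_le_one (l * x))
    have h3 := mul_le_of_le_one_left (norm_nonneg (B x)) (Real.abs_sin_le_one (l * x))
    linarith
  refine ⟨G, G', hGd, hG'd, hGa, fun x hx => ⟨?_, hG'b x hx⟩⟩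
  have hS0 : 0 ≤ 2 * S := (norm_nonneg _).trans (hG'b x hx)
  have h1 := (convex_Icc (0 : ℝ) 1).norm_image_sub_le_of_norm_hasDerivWithin_le
    (fun t _ => (hGd t).hasDerivWithinAt) hG'b ha hx
  rw [hGa, sub_zero] at h1
  refine h1.trans (mul_le_of_le_one_right hS0 ?_)
  rw [Real.norm_eq_abs, abs_le]
  constructor <;> linarith [ha.1, ha.2, hx.1, hx.2]

/-- A smooth transition strictly inside `(a, b)`, with bounds on its first two derivatives. -/
theorem exists_transition_derivs {a b : ℝ} (hab : a < b) :
    ∃ (θ θ' θ'' : ℝ → ℝ) (M : ℝ), (∀ x, HasDerivAt θ (θ' x) x) ∧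
      (∀ x, HasDerivAt θ' (θ'' x) x) ∧ Continuous θ'' ∧ (∀ x, |θ x| ≤ 1) ∧
      (∀ x ≤ a, θ x = 0) ∧ (∀ x, b ≤ x → θ x = 1) ∧
      (∀ x, x ≤ a ∨ b ≤ x → θ' x = 0 ∧ θ'' x = 0) ∧ 0 ≤ M ∧
      ∀ x ∈ Icc (0 : ℝ) 1, |θ' x| ≤ M ∧ |θ'' x| ≤ M := by
  obtain ⟨θ, hθ, hθ0, hθ1, hθa, hθb⟩ := exists_smooth_transition
    (show (2 * a + b) / 3 < (a + 2 * b) / 3 by linarith)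
  have hθ' := (contDiff_infty_iff_deriv.1 hθ).2
  have hθ'' := (contDiff_infty_iff_deriv.1 hθ').2.continuous
  obtain ⟨M₁, hM₁⟩ := (isCompact_Icc (a := (0 : ℝ)) (b := 1)).exists_bound_of_continuousOn
    hθ'.continuous.continuousOn
  obtain ⟨M₂, hM₂⟩ := (isCompact_Icc (a := (0 : ℝ)) (b := 1)).exists_bound_of_continuousOn
    hθ''.continuousOn
  refine ⟨θ, deriv θ, deriv (deriv θ), max M₁ M₂,
    fun x => (hθ.differentiable (by simp) x).hasDerivAt,
    fun x => (hθ'.differentiable (by simp) x).hasDerivAt, hθ'', fun x => ?_,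
    fun x hx => hθa x (by linarith), fun x hx => hθb x (by linarith), fun x hx => ?_, ?_,
    fun x hx => ⟨(hM₁ x hx).trans (le_max_left _ _), (hM₂ x hx).trans (le_max_right _ _)⟩⟩
  · rw [abs_of_nonneg (hθ0 x)]
    exact hθ1 x
  · obtain ⟨c, hc⟩ : ∃ c, θ =ᶠ[𝓝 x] fun _ => c := by
      rcases hx with hx | hx
      · refine ⟨0, ?_⟩
        filter_upwards [Iio_mem_nhds (show x < (2 * a + b) / 3 by linarith)] with y hy
        exact hθa y (le_of_lt hy)
      · refine ⟨1, ?_⟩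
        filter_upwards [Ioi_mem_nhds (show (a + 2 * b) / 3 < x by linarith)] with y hy
        exact hθb y (le_of_lt hy)
    have h1 : deriv θ =ᶠ[𝓝 x] fun _ => 0 := by
      simpa using hc.deriv
    exact ⟨h1.eq_of_nhds, by simpa using h1.deriv_eq⟩
  · exact (norm_nonneg _).trans ((hM₁ 0 (by simp)).trans (le_max_left _ _))

/-- Solving the resolvent equation `G'' + λ² G = h + k` with Dirichlet conditions and a control `k`
supported in `[α, β]`, uniformly in `λ`. -/
theorem exists_controlled_solution {α β : ℝ} (hα : 0 ≤ α) (hαβ : α < β) (hβ : β ≤ 1) :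
    ∃ K > (0 : ℝ), ∀ l > (0 : ℝ), ∀ (h : ℝ → ℂ) (S : ℝ), Continuous h →
      ∫ x in (0 : ℝ)..1, ‖h x‖ ≤ S →
      ∃ G G' k : ℝ → ℂ, (∀ x, HasDerivAt G (G' x) x) ∧
        (∀ x, HasDerivAt G' (h x + k x - l ^ 2 * G x) x) ∧ G 0 = 0 ∧ G 1 = 0 ∧
        Continuous k ∧ (∀ x, x ≤ α ∨ β ≤ x → k x = 0) ∧
        ∀ x ∈ Icc (0 : ℝ) 1, ‖G x‖ ≤ K * S ∧ ‖G' x‖ ≤ K * S ∧ ‖k x‖ ≤ K * S := by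
  obtain ⟨θ, θ', θ'', M, hθ, hθ', hθ''c, hθ1, hθα, hθβ, hθk, hM, hθM⟩ :=
    exists_transition_derivs hαβ
  refine ⟨6 + 12 * M, by positivity, fun l hl h S hh hS => ?_⟩
  obtain ⟨U, U', hU, hU', hU0, hUb⟩ :=
    exists_oscillator_solution hl hh (left_mem_Icc.2 zero_le_one) hS
  obtain ⟨V, V', hV, hV', hV1, hVb⟩ :=
    exists_oscillator_solution hl hh (right_mem_Icc.2 zero_le_one) hS
  have hS0 : 0 ≤ S :=
    (intervalIntegral.integral_nonneg zero_le_one fun x _ => norm_nonneg _).trans hS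
  have hUc : Continuous U := continuous_iff_continuousAt.2 fun x => (hU x).continuousAt
  have hVc : Continuous V := continuous_iff_continuousAt.2 fun x => (hV x).continuousAt
  have hU'c : Continuous U' := continuous_iff_continuousAt.2 fun x => (hU' x).continuousAt
  have hV'c : Continuous V' := continuous_iff_continuousAt.2 fun x => (hV' x).continuousAt
  have hθ'c : Continuous θ' := continuous_iff_continuousAt.2 fun x => (hθ' x).continuousAt
  refine ⟨fun x => U x + θ x * (V x - U x),
    fun x => U' x + (θ' x * (V x - U x) + θ x * (V' x - U' x)),
    fun x => θ'' x * (V x - U x) + 2 * θ' x * (V' x - U' x),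
    fun x => (hU x).add ((hθ x).ofReal_comp.mul ((hV x).sub (hU x))), fun x => ?_, ?_, ?_, ?_,
    fun x hx => ?_, fun x hx => ?_⟩
  · refine ((hU' x).add (((hθ' x).ofReal_comp.mul ((hV x).sub (hU x))).add
      ((hθ x).ofReal_comp.mul ((hV' x).sub (hU' x))))).congr_deriv ?_
    simp only [Pi.sub_apply]
    ring
  · simp [hU0, hθα 0 hα]
  · simp [hV1, hθβ 1 hβ]
  · fun_prop
  · simp [(hθk x hx).1, (hθk x hx).2]
  · obtain ⟨hU1, hU2⟩ := hUb x hx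
    obtain ⟨hV1, hV2⟩ := hVb x hx
    obtain ⟨hM1, hM2⟩ := hθM x hx
    have hW : ‖V x - U x‖ ≤ 4 * S := (norm_sub_le _ _).trans (by linarith)
    have hW' : ‖V' x - U' x‖ ≤ 4 * S := (norm_sub_le _ _).trans (by linarith)
    have key : ∀ (r m : ℝ) (z : ℂ), |r| ≤ m → ‖z‖ ≤ 4 * S → ‖(r : ℂ) * z‖ ≤ m * (4 * S) :=
      fun r m z hr hz => by
        rw [norm_mul, Complex.norm_real]
        exact mul_le_mul hr hz (norm_nonneg _) ((abs_nonneg r).trans hr)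
    have hMS : 0 ≤ M * S := mul_nonneg hM hS0
    have k1 := key _ _ _ (hθ1 x) hW
    have k2 := key _ _ _ (hθ1 x) hW'
    have k3 := key _ _ _ hM1 hW
    have k4 := key _ _ _ hM1 hW'
    have k5 := key _ _ _ hM2 hW
    refine ⟨(norm_add_le _ _).trans (by linarith), ?_, ?_⟩
    · refine (norm_add_le _ _).trans ?_
      have := norm_add_le (θ' x * (V x - U x) : ℂ) (θ x * (V' x - U' x))
      linarith
    · refine (norm_add_le _ _).trans ?_
      rw [mul_assoc, norm_mul (2 : ℂ), Complex.norm_two]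
      linarith

/-- The estimate in the elliptic range `μ ≥ 0`, where no observation is needed. -/
theorem integral_norm_sq_le_of_nonneg {μ : ℝ} (hμ : 0 ≤ μ) {u u' u'' : ℝ → ℂ}
    (hu : ContinuousOn u (Icc 0 1)) (hu' : ContinuousOn u' (Icc 0 1))
    (hu'' : ContinuousOn u'' (Icc 0 1)) (hd : ∀ x ∈ Ioo (0 : ℝ) 1, HasDerivAt u (u' x) x)
    (hd' : ∀ x ∈ Ioo (0 : ℝ) 1, HasDerivAt u' (u'' x) x) (h0 : u 0 = 0) (h1 : u 1 = 0) :
    ∫ x in (0 : ℝ)..1, ‖u x‖ ^ 2 ≤ 8 * Hm1Norm (fun x => u'' x - μ * u x) ^ 2 := by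
  set N := Hm1Norm (fun x => u'' x - μ * u x)
  set E := ∫ x in (0 : ℝ)..1, ‖u' x‖ ^ 2 with hE
  set I := ∫ x in (0 : ℝ)..1, ‖u x‖ ^ 2 with hI
  have hIE : I ≤ E := by
    have h3 : I ≤ ∫ x in (0 : ℝ)..1, E :=
      intervalIntegral.integral_mono_on zero_le_one
        (ContinuousOn.intervalIntegrable_of_Icc zero_le_one (by fun_prop)) (by simp)
        fun x hx => norm_sq_le_integral_norm_deriv_sq hu hd hu' h0 hx
    simpa using h3
  have hI0 : 0 ≤ I := intervalIntegral.integral_nonneg zero_le_one fun x _ => by positivity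
  have hE0 : 0 ≤ E := hI0.trans hIE
  rcases hE0.eq_or_lt with hE0 | hE0
  · nlinarith [sq_nonneg N]
  set v : ℝ → ℂ := fun x => (starRingEnd ℂ) (u x) with hv
  set v' : ℝ → ℂ := fun x => (starRingEnd ℂ) (u' x) with hv'
  have hvc : ContinuousOn v (Icc 0 1) := Complex.continuous_conj.comp_continuousOn hu
  have hv'c : ContinuousOn v' (Icc 0 1) := Complex.continuous_conj.comp_continuousOn hu'
  have hvd : ∀ x ∈ Ioo (0 : ℝ) 1, HasDerivAt v (v' x) x := fun x hx =>
    Complex.conjCLE.toContinuousLinearMap.hasFDerivAt.comp_hasDerivAt x (hd x hx)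
  have hpair := norm_integral_mul_le_Hm1Norm (f := fun x => u'' x - μ * u x) (by fun_prop)
    hvc hvd hv'c (by simp [hv, h0]) (by simp [hv, h1]) (c := √(2 * E)) (by positivity) (by
      rw [Real.sq_sqrt (by positivity)]
      simp only [hv, hv', RCLike.norm_conj]
      rw [intervalIntegral.integral_add]
      · linarith
      all_goals exact ContinuousOn.intervalIntegrable_of_Icc zero_le_one (by fun_prop))
  have hparts := intervalIntegral.integral_mul_deriv_eq_deriv_mul_of_hasDerivAt
    (a := 0) (b := 1) (u := v) (v := u') (u' := v') (v' := u'')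
    (by rwa [uIcc_of_le zero_le_one]) (by rwa [uIcc_of_le zero_le_one])
    (by simpa using hvd) (by simpa using hd')
    (hv'c.intervalIntegrable_of_Icc zero_le_one) (hu''.intervalIntegrable_of_Icc zero_le_one)
  have hval : ∫ x in (0 : ℝ)..1, (u'' x - μ * u x) * v x = ((-(E + μ * I) : ℝ) : ℂ) := by
    have e : ∀ x, (u'' x - μ * u x) * v x = v x * u'' x - μ * ((‖u x‖ ^ 2 : ℝ) : ℂ) := fun x => by
      push_cast
      rw [← Complex.mul_conj']
      ring
    have e' : ∀ x, v' x * u' x = ((‖u' x‖ ^ 2 : ℝ) : ℂ) := fun x => by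
      push_cast
      rw [← Complex.conj_mul']
    simp_rw [e]
    rw [intervalIntegral.integral_sub, hparts, intervalIntegral.integral_const_mul,
      intervalIntegral.integral_ofReal]
    · simp_rw [e']
      rw [intervalIntegral.integral_ofReal]
      simp only [hv, h0, h1]
      push_cast
      simp
      ring
    all_goals exact ContinuousOn.intervalIntegrable_of_Icc zero_le_one (by fun_prop)
  rw [hval, Complex.norm_real, norm_neg, Real.norm_of_nonneg (by positivity)] at hpair
  have hs := Real.sq_sqrt (show 0 ≤ 2 * E by positivity)
  have hs0 : 0 < √(2 * E) := by positivity
  have h2 : √(2 * E) ≤ 4 * N := by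
    refine le_of_mul_le_mul_left ?_ hs0
    nlinarith [mul_nonneg hμ hI0]
  nlinarith

/-- The estimate in the oscillatory range `μ = -λ² < 0`. -/
theorem exists_integral_norm_sq_le_of_neg {α β : ℝ} (hα : 0 ≤ α) (hαβ : α < β) (hβ : β ≤ 1) :
    ∃ C > (0 : ℝ), ∀ l > (0 : ℝ), ∀ u u' u'' : ℝ → ℂ,
      ContinuousOn u (Icc 0 1) → ContinuousOn u' (Icc 0 1) → ContinuousOn u'' (Icc 0 1) →
      (∀ x ∈ Ioo (0 : ℝ) 1, HasDerivAt u (u' x) x) →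
      (∀ x ∈ Ioo (0 : ℝ) 1, HasDerivAt u' (u'' x) x) → u 0 = 0 → u 1 = 0 →
      ∫ x in (0 : ℝ)..1, ‖u x‖ ^ 2 ≤
        C * (Hm1Norm (fun x => u'' x + l ^ 2 * u x) ^ 2 + ∫ x in α..β, ‖u x‖ ^ 2) := by
  obtain ⟨K, hK, hcontrol⟩ := exists_controlled_solution hα hαβ hβ
  refine ⟨32 * K ^ 2, by positivity, fun l hl u u' u'' hu hu' hu'' hd hd' h0 h1 => ?_⟩
  set N := Hm1Norm (fun x => u'' x + l ^ 2 * u x)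
  set I := ∫ x in (0 : ℝ)..1, ‖u x‖ ^ 2 with hI
  set J := ∫ x in α..β, ‖u x‖ ^ 2 with hJ
  have hJ0 : 0 ≤ J := intervalIntegral.integral_nonneg hαβ.le fun x _ => by positivity
  have hI0 : 0 ≤ I := intervalIntegral.integral_nonneg zero_le_one fun x _ => by positivity
  rcases hI0.eq_or_lt with hI0 | hI0
  · rw [← hI0]; positivity
  have hsub : Icc α β ⊆ Icc (0 : ℝ) 1 := Icc_subset_Icc hα hβ
  have hS := Real.sq_sqrt hI0.le
  have hS0 : 0 < √I := Real.sqrt_pos.2 hI0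
  set S := √I
  set h : ℝ → ℂ := IccExtend zero_le_one ((Icc 0 1).domRestrict fun x => (starRingEnd ℂ) (u x))
    with hh
  have hhc : Continuous h :=
    (continuousOn_iff_continuous_domRestrict.1
      (Complex.continuous_conj.comp_continuousOn hu)).Icc_extend'
  have hhe : ∀ x ∈ Icc (0 : ℝ) 1, h x = (starRingEnd ℂ) (u x) := fun x hx => by
    rw [hh, IccExtend_of_mem _ _ hx]; rfl
  have hhS : ∫ x in (0 : ℝ)..1, ‖h x‖ ≤ S := by
    refine Real.le_sqrt_of_sq_le ((sq_integral_le_integral_sq zero_le_one (by norm_num)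
      hhc.norm.continuousOn).trans_eq ?_)
    refine intervalIntegral.integral_congr fun x hx => ?_
    rw [uIcc_of_le zero_le_one] at hx
    simp only [hhe x hx, RCLike.norm_conj]
  obtain ⟨G, G', k, hG, hG', hG0, hG1, hkc, hk0, hb⟩ := hcontrol l hl h S hhc hhS
  have hGc : Continuous G := continuous_iff_continuousAt.2 fun x => (hG x).continuousAt
  have hG'c : Continuous G' := continuous_iff_continuousAt.2 fun x => (hG' x).continuousAt
  have hpair := norm_integral_mul_le_Hm1Norm (f := fun x => u'' x + l ^ 2 * u x) (by fun_prop)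
    hGc.continuousOn (fun x _ => hG x) hG'c.continuousOn hG0 hG1 (c := 2 * K * S)
    (by positivity) (by
      have h3 : ∫ x in (0 : ℝ)..1, (‖G x‖ ^ 2 + ‖G' x‖ ^ 2) ≤
          ∫ x in (0 : ℝ)..1, (2 * K * S) ^ 2 := by
        refine intervalIntegral.integral_mono_on zero_le_one
          (Continuous.intervalIntegrable (by fun_prop) _ _) (by simp) fun x hx => ?_
        obtain ⟨b1, b2, -⟩ := hb x hx
        have b1' := pow_le_pow_left₀ (norm_nonneg _) b1 2
        have b2' := pow_le_pow_left₀ (norm_nonneg _) b2 2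
        nlinarith [sq_nonneg (K * S)]
      simpa using h3)
  have hparts₁ := intervalIntegral.integral_mul_deriv_eq_deriv_mul_of_hasDerivAt
    (a := 0) (b := 1) (u := G) (v := u') (u' := G') (v' := u'')
    hGc.continuousOn (by rwa [uIcc_of_le zero_le_one])
    (fun x _ => hG x) (by simpa using hd')
    (hG'c.intervalIntegrable _ _) (hu''.intervalIntegrable_of_Icc zero_le_one)
  have hparts₂ := intervalIntegral.integral_mul_deriv_eq_deriv_mul_of_hasDerivAt
    (a := 0) (b := 1) (u := G') (v := u) (v' := u')
    hG'c.continuousOn (by rwa [uIcc_of_le zero_le_one])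
    (fun x _ => hG' x) (by simpa using hd)
    (Continuous.intervalIntegrable (by fun_prop) _ _) (hu'.intervalIntegrable_of_Icc zero_le_one)
  simp only [h0, h1, hG0, hG1, mul_zero, zero_mul, sub_zero, zero_sub] at hparts₁ hparts₂
  rw [hparts₂, neg_neg] at hparts₁
  have hval : ∫ x in (0 : ℝ)..1, (u'' x + l ^ 2 * u x) * G x =
      (I : ℂ) + ∫ x in (0 : ℝ)..1, k x * u x := by
    have e : ∀ x, (u'' x + l ^ 2 * u x) * G x = G x * u'' x + l ^ 2 * u x * G x := fun x => by
      ring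
    simp_rw [e]
    rw [intervalIntegral.integral_add, hparts₁, ← intervalIntegral.integral_add, hI,
      ← intervalIntegral.integral_ofReal, ← intervalIntegral.integral_add]
    · refine intervalIntegral.integral_congr fun x hx => ?_
      rw [uIcc_of_le zero_le_one] at hx
      simp only [hhe x hx]
      push_cast
      rw [← Complex.conj_mul']
      ring
    all_goals exact ContinuousOn.intervalIntegrable_of_Icc zero_le_one (by fun_prop)
  have hk : ∫ x in (0 : ℝ)..1, k x * u x = ∫ x in α..β, k x * u x := by
    rw [intervalIntegral.integral_of_le zero_le_one, intervalIntegral.integral_of_le hαβ.le]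
    refine setIntegral_eq_of_subset_of_forall_sdiff_eq_zero measurableSet_Ioc
      (Ioc_subset_Ioc hα hβ) fun x hx => ?_
    rw [hk0 x, zero_mul]
    by_contra hcon
    push Not at hcon
    exact hx.2 ⟨hcon.1, hcon.2.le⟩
  have hkb : ‖∫ x in α..β, k x * u x‖ ≤ K * S * √J := by
    have hle : ∫ x in α..β, ‖u x‖ ≤ √J :=
      Real.le_sqrt_of_sq_le (sq_integral_le_integral_sq hαβ.le (by linarith)
        (hu.mono hsub).norm)
    refine le_trans ?_ (mul_le_mul_of_nonneg_left hle (by positivity))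
    have husub := hu.mono hsub
    rw [← intervalIntegral.integral_const_mul]
    refine (intervalIntegral.norm_integral_le_integral_norm hαβ.le).trans ?_
    refine intervalIntegral.integral_mono_on hαβ.le
      (ContinuousOn.intervalIntegrable_of_Icc hαβ.le (by fun_prop))
      (ContinuousOn.intervalIntegrable_of_Icc hαβ.le (by fun_prop)) fun x hx => ?_
    rw [norm_mul]
    exact mul_le_mul_of_nonneg_right (hb x (hsub hx)).2.2 (norm_nonneg _)
  rw [hval, hk] at hpair
  have hfin : S * S ≤ S * (4 * K * N + K * √J) := by
    have h3 := norm_sub_le ((I : ℂ) + ∫ x in α..β, k x * u x) (∫ x in α..β, k x * u x)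
    rw [add_sub_cancel_right, Complex.norm_real, Real.norm_of_nonneg hI0.le] at h3
    nlinarith
  have hfin' := le_of_mul_le_mul_left hfin hS0
  have hJs := Real.sq_sqrt hJ0
  calc I = S ^ 2 := hS.symm
    _ ≤ (4 * K * N + K * √J) ^ 2 := by gcongr
    _ ≤ 32 * K ^ 2 * (N ^ 2 + √J ^ 2) := by
      nlinarith [sq_nonneg (K * (4 * N - √J)), sq_nonneg (K * √J)]
    _ = 32 * K ^ 2 * (N ^ 2 + J) := by rw [hJs]

/-- **One-dimensional resolvent observability estimate, uniform in the spectral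
parameter** (used in Proposition 6.1 of Burq–Zworski): for `u` of class `C²` on `[0,1]`
with `u(0) = u(1) = 0` and `f = u'' - μ u`, one has
`∫₀¹ |u|² ≤ C (‖f‖²_{H^{-1}} + ∫_α^β |u|²)` with `C` independent of `μ ∈ ℝ`. -/
theorem one_dim_resolvent_observability (α β : ℝ) (hα : 0 ≤ α) (hαβ : α < β) (hβ : β ≤ 1) :
    ∃ C > (0:ℝ), ∀ (μ : ℝ) (u : ℝ → ℂ),
      ContDiffOn ℝ 2 u (Set.Icc 0 1) → u 0 = 0 → u 1 = 0 →
      ∫ x in (0:ℝ)..1, ‖u x‖ ^ 2 ≤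
        C * (Hm1Norm (fun x =>
              derivWithin (derivWithin u (Set.Icc 0 1)) (Set.Icc 0 1) x - (μ : ℂ) * u x) ^ 2
            + ∫ x in α..β, ‖u x‖ ^ 2) := by
  obtain ⟨C, hC, hosc⟩ := exists_integral_norm_sq_le_of_neg hα hαβ hβ
  refine ⟨C + 8, by positivity, fun μ u hu h0 h1 => ?_⟩
  have hU : UniqueDiffOn ℝ (Icc (0 : ℝ) 1) := uniqueDiffOn_Icc zero_lt_one
  set u' := derivWithin u (Icc 0 1) with hu'
  have hu1 : ContDiffOn ℝ 1 u' (Icc 0 1) := hu.derivWithin hU (by norm_num)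
  set u'' := derivWithin u' (Icc 0 1) with hu''
  have hc2 : ContinuousOn u'' (Icc 0 1) :=
    (hu1.derivWithin (m := 0) hU (by norm_num)).continuousOn
  have hd : ∀ x ∈ Ioo (0 : ℝ) 1, HasDerivAt u (u' x) x := fun x hx =>
    ((hu.differentiableOn (by norm_num)) x (Ioo_subset_Icc_self hx)).hasDerivWithinAt.hasDerivAt
      (Icc_mem_nhds hx.1 hx.2)
  have hd' : ∀ x ∈ Ioo (0 : ℝ) 1, HasDerivAt u' (u'' x) x := fun x hx =>
    ((hu1.differentiableOn (by norm_num)) x (Ioo_subset_Icc_self hx)).hasDerivWithinAt.hasDerivAt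
      (Icc_mem_nhds hx.1 hx.2)
  have hJ0 : 0 ≤ ∫ x in α..β, ‖u x‖ ^ 2 :=
    intervalIntegral.integral_nonneg hαβ.le fun x _ => by positivity
  have hN0 := sq_nonneg (Hm1Norm fun x => u'' x - (μ : ℂ) * u x)
  rcases le_or_gt 0 μ with hμ | hμ
  · have h := integral_norm_sq_le_of_nonneg hμ hu.continuousOn hu1.continuousOn hc2 hd hd' h0 h1
    nlinarith [mul_nonneg hC.le hN0, mul_nonneg hC.le hJ0]
  · have h := hosc √(-μ) (Real.sqrt_pos.2 (neg_pos.2 hμ)) u u' u'' hu.continuousOn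
      hu1.continuousOn hc2 hd hd' h0 h1
    have e : ((√(-μ) : ℝ) : ℂ) ^ 2 = -μ := by
      exact_mod_cast Real.sq_sqrt (neg_nonneg.2 hμ.le)
    simp only [e, neg_mul, ← sub_eq_add_neg] at h
    linarith
end

section
/- Let a > 0, let R = (0,1) × (0,a) ⊂ ℝ², and let ω = (α,β) × (0,a) with 0 ≤ α < β ≤ 1. There exists a constant C > 0 such that for every z ∈ ℝ and every function u : ℝ² → ℂ that is twice continuously differentiable on the closed rectangle [0,1] × [0,a] and vanishes on its boundary, setting f = Δu − z u (where Δu = ∂²u/∂x² + ∂²u/∂y²), one has ∫_R |u|² dx dy ≤ C (‖f‖²_{H^{-1}_x L²_y} + ∫_ω |u|² dx dy). -/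
open MeasureTheory

/-- The flat Laplacian `Δv = ∂²v/∂x² + ∂²v/∂y²` of a function on `ℝ²`, expressed through
iterated Fréchet derivatives in the two coordinate directions. -/
noncomputable def lap2 (v : ℝ × ℝ → ℂ) (p : ℝ × ℝ) : ℂ :=
  fderiv ℝ (fun q => fderiv ℝ v q (1, 0)) p (1, 0) +
    fderiv ℝ (fun q => fderiv ℝ v q (0, 1)) p (0, 1)

/-- The `H^{-1}_x L²_y` norm of a function on the rectangle `(0,1) × (0,a)`, defined by
duality against smooth test functions vanishing for `x` outside a compact subset of
`(0,1)`, normalized by `∫ (|g|² + |∂ₓ g|²) ≤ 1`. -/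
noncomputable def Hm1xL2yNorm (a : ℝ) (f : ℝ × ℝ → ℂ) : ℝ :=
  sSup {r : ℝ | ∃ g : ℝ × ℝ → ℂ, ContDiff ℝ (⊤ : ℕ∞) g ∧
    (∃ K : Set ℝ, IsCompact K ∧ K ⊆ Set.Ioo 0 1 ∧ ∀ x ∉ K, ∀ y : ℝ, g (x, y) = 0) ∧
    (∫ p in Set.Ioo (0:ℝ) 1 ×ˢ Set.Ioo 0 a, (‖g p‖ ^ 2 + ‖fderiv ℝ g p (1, 0)‖ ^ 2)) ≤ 1 ∧
    r = ‖∫ p in Set.Ioo (0:ℝ) 1 ×ˢ Set.Ioo 0 a, f p * (starRingEnd ℂ) (g p)‖}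

open Set Filter Topology Interval

theorem integral_mono_of_continuous {a b : ℝ} (hab : a ≤ b) {f g : ℝ → ℝ} (hf : Continuous f)
    (hg : Continuous g) (h : ∀ x ∈ Icc a b, f x ≤ g x) :
    ∫ x in a..b, f x ≤ ∫ x in a..b, g x :=
  intervalIntegral.integral_mono_on hab (hf.intervalIntegrable _ _) (hg.intervalIntegrable _ _) h

/-- Jensen's inequality for the square on the unit interval. -/
theorem sq_integral_le_integral_sq_s6 {g : ℝ → ℝ} (hg : Continuous g) :
    (∫ x in (0:ℝ)..1, g x) ^ 2 ≤ ∫ x in (0:ℝ)..1, g x ^ 2 := by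
  set m := ∫ x in (0:ℝ)..1, g x with hm
  have h : 0 ≤ ∫ x in (0:ℝ)..1, (g x - m) ^ 2 :=
    intervalIntegral.integral_nonneg zero_le_one fun _ _ => sq_nonneg _
  have e : ∫ x in (0:ℝ)..1, (g x - m) ^ 2 = (∫ x in (0:ℝ)..1, g x ^ 2) - m ^ 2 := by
    have : (fun x => (g x - m) ^ 2) = fun x => g x ^ 2 - (2 * m * g x - m ^ 2) := by
      ext x; ring
    rw [this, intervalIntegral.integral_sub, intervalIntegral.integral_sub,
      intervalIntegral.integral_const_mul, ← hm]
    · simp; ring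
    all_goals exact Continuous.intervalIntegrable (by fun_prop) _ _
  linarith

theorem integral_norm_le_integral_norm_unit {F : ℝ → ℂ} (hF : Continuous F) {x : ℝ}
    (hx : x ∈ Icc (0:ℝ) 1) : ∫ t in (0:ℝ)..x, ‖F t‖ ≤ ∫ t in (0:ℝ)..1, ‖F t‖ := by
  apply intervalIntegral.integral_mono_interval le_rfl hx.1 hx.2
  · exact Eventually.of_forall fun _ => norm_nonneg _
  · exact hF.norm.intervalIntegrable _ _

/-- A uniform lower bound for the mass of high-frequency sine waves on an interval. -/
theorem exists_pos_le_integral_sin_sq {α β : ℝ} (hαβ : α < β) :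
    ∃ κ > (0:ℝ), ∀ l : ℝ, 1 / 2 ≤ l → κ ≤ ∫ x in α..β, Real.sin (l * x) ^ 2 := by
  set s := β - α with hs
  have hs0 : 0 < s := sub_pos.2 hαβ
  have formula : ∀ l : ℝ, 0 < l → ∫ x in α..β, Real.sin (l * x) ^ 2 =
      s / 2 - Real.sin (l * s) * Real.cos (l * (α + β)) / (2 * l) := by
    intro l hl
    rw [intervalIntegral.integral_comp_mul_left (fun x => Real.sin x ^ 2) hl.ne', integral_sin_sq]
    have : Real.sin (l * s) * Real.cos (l * (α + β)) =
        Real.sin (l * β) * Real.cos (l * β) - Real.sin (l * α) * Real.cos (l * α) := by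
      rw [hs, mul_sub, mul_add, Real.sin_sub, Real.cos_add]
      have h1 := Real.sin_sq_add_cos_sq (l * α)
      have h2 := Real.sin_sq_add_cos_sq (l * β)
      linear_combination (Real.sin (l * β) * Real.cos (l * β)) * h1 -
        (Real.sin (l * α) * Real.cos (l * α)) * h2
    rw [this, smul_eq_mul]
    field_simp
    ring
  have bound : ∀ l : ℝ, 0 < l →
      s / 2 - |Real.sin (l * s)| / (2 * l) ≤ ∫ x in α..β, Real.sin (l * x) ^ 2 := by
    intro l hl
    rw [formula l hl]
    gcongr
    refine (le_abs_self _).trans ?_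
    rw [abs_mul]
    exact mul_le_of_le_one_right (abs_nonneg _) (Real.abs_cos_le_one _)
  have pos : ∀ l : ℝ, 0 < l → 0 < s / 2 - |Real.sin (l * s)| / (2 * l) := by
    intro l hl
    have : |Real.sin (l * s)| < l * s := by
      have hls : 0 < l * s := by positivity
      simpa only [abs_of_pos hls] using Real.abs_sin_lt_abs hls.ne'
    rw [sub_pos, div_lt_div_iff₀ (by positivity) (by positivity)]
    linarith
  obtain ⟨l₀, hl₀, hmin⟩ := (isCompact_Icc (a := (1/2:ℝ)) (b := 1/2 + 2 / s)).exists_isMinOn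
    ⟨1/2, by simp; positivity⟩
    (f := fun l => s / 2 - |Real.sin (l * s)| / (2 * l)) (by
      apply ContinuousOn.sub continuousOn_const
      apply ContinuousOn.div (by fun_prop) (by fun_prop)
      intro x hx
      have := hx.1
      positivity)
  have hl₀' : 0 < l₀ := lt_of_lt_of_le (by norm_num) hl₀.1
  refine ⟨min (s / 2 - |Real.sin (l₀ * s)| / (2 * l₀)) (s / 4),
    lt_min (pos _ hl₀') (by positivity), fun l hl => ?_⟩
  have hl' : 0 < l := lt_of_lt_of_le (by norm_num) hl
  refine le_trans ?_ (bound l hl')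
  rcases le_total l (1/2 + 2 / s) with h | h
  · exact (min_le_left _ _).trans (hmin ⟨hl, h⟩)
  · refine (min_le_right _ _).trans ?_
    have h1 : |Real.sin (l * s)| / (2 * l) ≤ s / 4 := by
      rw [div_le_div_iff₀ (by positivity) (by norm_num)]
      have h2 : 2 ≤ l * s := by
        have : 2 / s ≤ l := by linarith
        rwa [div_le_iff₀ hs0] at this
      nlinarith [Real.abs_sin_le_one (l * s)]
    linarith

/-- A Poincaré inequality for functions vanishing at `0`. -/
theorem integral_sq_le_integral_deriv_sq {u v : ℝ → ℂ} (hu : Continuous u) (hv : Continuous v)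
    (hu' : ∀ x ∈ Ioo (0:ℝ) 1, HasDerivAt u (v x) x) (h0 : u 0 = 0) :
    ∫ x in (0:ℝ)..1, ‖u x‖ ^ 2 ≤ ∫ x in (0:ℝ)..1, ‖v x‖ ^ 2 := by
  have hp : ∀ x ∈ Icc (0:ℝ) 1, ‖u x‖ ^ 2 ≤ ∫ x in (0:ℝ)..1, ‖v x‖ ^ 2 := by
    intro x hx
    have h := intervalIntegral.integral_eq_sub_of_hasDerivAt_of_le hx.1 (f := u) (f' := v)
      (by fun_prop) (fun y hy => hu' y ⟨hy.1, hy.2.trans_le hx.2⟩) (hv.intervalIntegrable _ _)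
    rw [h0, sub_zero] at h
    have h2 : ‖u x‖ ≤ ∫ t in (0:ℝ)..1, ‖v t‖ := by
      rw [← h]
      exact (intervalIntegral.norm_integral_le_integral_norm hx.1).trans
        (integral_norm_le_integral_norm_unit hv hx)
    calc ‖u x‖ ^ 2 ≤ (∫ t in (0:ℝ)..1, ‖v t‖) ^ 2 := by gcongr
      _ ≤ _ := sq_integral_le_integral_sq_s6 (by fun_prop)
  have := integral_mono_of_continuous zero_le_one (by fun_prop) continuous_const hp
  simpa using this

/-- One-dimensional resolvent estimate in the elliptic range of the spectral parameter. -/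
theorem integral_sq_le_of_elliptic {ζ : ℝ} (hζ : -(1 / 4) ≤ ζ) {u w F : ℝ → ℂ}
    (hu : Continuous u) (hw : Continuous w) (hF : Continuous F)
    (hu' : ∀ x ∈ Ioo (0:ℝ) 1, HasDerivAt u (w x + F x) x)
    (hw' : ∀ x ∈ Ioo (0:ℝ) 1, HasDerivAt w (ζ * u x) x) (h0 : u 0 = 0) (h1 : u 1 = 0) :
    ∫ x in (0:ℝ)..1, ‖u x‖ ^ 2 ≤ 14 * ∫ x in (0:ℝ)..1, ‖F x‖ ^ 2 := by
  have energy : ∫ x in (0:ℝ)..1, (‖w x‖ ^ 2 + (F x * (starRingEnd ℂ) (w x)).re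
      + ζ * ‖u x‖ ^ 2) = 0 := by
    have := intervalIntegral.integral_eq_sub_of_hasDerivAt_of_le zero_le_one
      (f := fun x => (u x * (starRingEnd ℂ) (w x)).re)
      (f' := fun x => ‖w x‖ ^ 2 + (F x * (starRingEnd ℂ) (w x)).re + ζ * ‖u x‖ ^ 2)
      (by fun_prop) (fun x hx => by
        have h := Complex.reCLM.hasFDerivAt.comp_hasDerivAt x
          ((hu' x hx).mul (hw' x hx).star)
        refine h.congr_deriv ?_
        simp only [Complex.reCLM_apply, Complex.sq_norm, Complex.normSq_apply, Complex.star_def]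
        simp
        ring) (Continuous.intervalIntegrable (by fun_prop) _ _)
    rw [this, h0, h1]
    simp
  have poincare : ∫ x in (0:ℝ)..1, ‖u x‖ ^ 2 ≤ ∫ x in (0:ℝ)..1, ‖w x + F x‖ ^ 2 :=
    integral_sq_le_integral_deriv_sq hu (hw.add hF) hu' h0
  have h2 : ∫ x in (0:ℝ)..1, ‖w x + F x‖ ^ 2 ≤
      ∫ x in (0:ℝ)..1, (2 * ‖w x‖ ^ 2 + 2 * ‖F x‖ ^ 2) := by
    refine integral_mono_of_continuous zero_le_one (by fun_prop) (by fun_prop) ?_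
    intro x _
    nlinarith [norm_add_le (w x) (F x), norm_nonneg (w x + F x), sq_nonneg (‖w x‖ - ‖F x‖)]
  have h3 : ∫ x in (0:ℝ)..1, (3 / 4 * ‖w x‖ ^ 2 - ‖F x‖ ^ 2 - 1 / 4 * ‖u x‖ ^ 2) ≤ 0 := by
    refine le_trans ?_ energy.le
    refine integral_mono_of_continuous zero_le_one (by fun_prop) (by fun_prop) ?_
    intro x _
    have e1 : |(F x * (starRingEnd ℂ) (w x)).re| ≤ ‖F x‖ * ‖w x‖ := by
      refine (Complex.abs_re_le_norm _).trans ?_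
      simp
    have e2 := abs_le.1 e1
    nlinarith [sq_nonneg (‖w x‖ / 2 - ‖F x‖), mul_le_mul_of_nonneg_right hζ (sq_nonneg ‖u x‖)]
  rw [intervalIntegral.integral_add (Continuous.intervalIntegrable (by fun_prop) _ _)
    (Continuous.intervalIntegrable (by fun_prop) _ _), intervalIntegral.integral_const_mul,
    intervalIntegral.integral_const_mul] at h2
  rw [intervalIntegral.integral_sub (Continuous.intervalIntegrable (by fun_prop) _ _)
    (Continuous.intervalIntegrable (by fun_prop) _ _),
    intervalIntegral.integral_sub (Continuous.intervalIntegrable (by fun_prop) _ _)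
    (Continuous.intervalIntegrable (by fun_prop) _ _), intervalIntegral.integral_const_mul,
    intervalIntegral.integral_const_mul] at h3
  linarith

/-- In the oscillatory range, a solution vanishing at `0` is a sine wave up to the size of the
right-hand side. -/
theorem norm_sub_sin_le {l : ℝ} (hl : l ≠ 0) {u w F : ℝ → ℂ}
    (hu : Continuous u) (hw : Continuous w) (hF : Continuous F)
    (hu' : ∀ x ∈ Ioo (0:ℝ) 1, HasDerivAt u (w x + F x) x)
    (hw' : ∀ x ∈ Ioo (0:ℝ) 1, HasDerivAt w (((-l ^ 2 : ℝ) : ℂ) * u x) x) (h0 : u 0 = 0)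
    {x : ℝ} (hx : x ∈ Icc (0:ℝ) 1) :
    ‖u x - w 0 / l * (Real.sin (l * x) : ℂ)‖ ≤ ∫ t in (0:ℝ)..1, ‖F t‖ := by
  have hlC : (l : ℂ) ≠ 0 := by exact_mod_cast hl
  have h := intervalIntegral.integral_eq_sub_of_hasDerivAt_of_le hx.1
    (f := fun t => u t * (Real.cos (l * (x - t)) : ℂ) + w t / l * (Real.sin (l * (x - t)) : ℂ))
    (f' := fun t => F t * (Real.cos (l * (x - t)) : ℂ)) (by fun_prop) (fun t ht => by
      have ht' : t ∈ Ioo (0:ℝ) 1 := ⟨ht.1, ht.2.trans_le hx.2⟩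
      have a0 : HasDerivAt (fun t => l * (x - t)) (-l) t := by
        simpa using ((hasDerivAt_id t).const_sub x).const_mul l
      have a1 := a0.cos.ofReal_comp
      have a2 := a0.sin.ofReal_comp
      refine (((hu' t ht').mul a1).add (((hw' t ht').div_const (l : ℂ)).mul a2)).congr_deriv ?_
      push_cast
      field_simp
      ring) (Continuous.intervalIntegrable (by fun_prop) _ _)
  have h2 : u x - w 0 / l * (Real.sin (l * x) : ℂ) =
      ∫ t in (0:ℝ)..x, F t * (Real.cos (l * (x - t)) : ℂ) := by
    rw [h, h0]; simp
  rw [h2]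
  refine (intervalIntegral.norm_integral_le_integral_norm hx.1).trans (le_trans ?_
    (integral_norm_le_integral_norm_unit hF hx))
  refine integral_mono_of_continuous hx.1 (by fun_prop) (by fun_prop) ?_
  intro t _
  rw [norm_mul, Complex.norm_real]
  exact mul_le_of_le_one_right (norm_nonneg _) (Real.abs_cos_le_one _)

/-- One-dimensional observability: a resolvent estimate on `(0,1)`, uniform in the spectral
parameter, with control on `(α,β)`. The right-hand side is the derivative of `F`. -/
theorem exists_one_dim_observability {α β : ℝ} (hα : 0 ≤ α) (hαβ : α < β) (hβ : β ≤ 1) :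
    ∃ C > (0:ℝ), ∀ (ζ : ℝ) (u w F : ℝ → ℂ), Continuous u → Continuous w → Continuous F →
      (∀ x ∈ Ioo (0:ℝ) 1, HasDerivAt u (w x + F x) x) →
      (∀ x ∈ Ioo (0:ℝ) 1, HasDerivAt w (ζ * u x) x) → u 0 = 0 → u 1 = 0 →
      ∫ x in (0:ℝ)..1, ‖u x‖ ^ 2 ≤
        C * ((∫ x in (0:ℝ)..1, ‖F x‖ ^ 2) + ∫ x in α..β, ‖u x‖ ^ 2) := by
  obtain ⟨κ, hκ, hsin⟩ := exists_pos_le_integral_sin_sq hαβ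
  refine ⟨14 + 4 / κ, by positivity, fun ζ u w F hu hw hF hu' hw' h0 h1 => ?_⟩
  have hI : 0 ≤ ∫ x in (0:ℝ)..1, ‖F x‖ ^ 2 :=
    intervalIntegral.integral_nonneg zero_le_one fun _ _ => by positivity
  have hJ : 0 ≤ ∫ x in α..β, ‖u x‖ ^ 2 :=
    intervalIntegral.integral_nonneg hαβ.le fun _ _ => by positivity
  rcases le_total (-(1 / 4)) ζ with hζ | hζ
  · have := integral_sq_le_of_elliptic hζ hu hw hF hu' hw' h0 h1
    have h4 : 0 ≤ 4 / κ := by positivity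
    nlinarith [mul_nonneg h4 hI, mul_nonneg h4 hJ]
  set l := √(-ζ) with hl
  have hl2 : l ^ 2 = -ζ := Real.sq_sqrt (by linarith)
  have hl' : 1 / 2 ≤ l := Real.le_sqrt_of_sq_le (by linarith)
  have hl0 : l ≠ 0 := by positivity
  have hζl : ζ = -l ^ 2 := by linarith
  set d := w 0 / l
  set φ := ∫ t in (0:ℝ)..1, ‖F t‖
  have hφ : φ ^ 2 ≤ ∫ x in (0:ℝ)..1, ‖F x‖ ^ 2 := sq_integral_le_integral_sq_s6 hF.norm
  have key : ∀ x ∈ Icc (0:ℝ) 1, ‖u x - d * (Real.sin (l * x) : ℂ)‖ ^ 2 ≤ φ ^ 2 := by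
    intro x hx
    have := norm_sub_sin_le hl0 hu hw hF hu' (by rwa [hζl] at hw') h0 hx
    gcongr
  have upper : ∫ x in (0:ℝ)..1, ‖u x‖ ^ 2 ≤ 2 * ‖d‖ ^ 2 + 2 * φ ^ 2 := by
    have := integral_mono_of_continuous (f := fun x => ‖u x‖ ^ 2)
      (g := fun _ => 2 * ‖d‖ ^ 2 + 2 * φ ^ 2) zero_le_one (by fun_prop) (by fun_prop) (fun x hx => by
        have e1 := key x hx
        have e2 : ‖u x‖ ≤ ‖u x - d * (Real.sin (l * x) : ℂ)‖ + ‖d‖ := by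
          have e3 : ‖d * (Real.sin (l * x) : ℂ)‖ ≤ ‖d‖ := by
            rw [norm_mul, Complex.norm_real]
            exact mul_le_of_le_one_right (norm_nonneg _) (Real.abs_sin_le_one _)
          have e4 := norm_add_le (u x - d * (Real.sin (l * x) : ℂ)) (d * (Real.sin (l * x) : ℂ))
          rw [sub_add_cancel] at e4
          linarith
        nlinarith [norm_nonneg (u x), sq_nonneg (‖u x - d * (Real.sin (l * x) : ℂ)‖ - ‖d‖)])
    simpa using this
  have lower : κ * ‖d‖ ^ 2 ≤ 2 * (∫ x in α..β, ‖u x‖ ^ 2) + 2 * φ ^ 2 := by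
    have e0 : ∫ x in α..β, ‖d‖ ^ 2 * Real.sin (l * x) ^ 2 ≤
        ∫ x in α..β, (2 * ‖u x‖ ^ 2 + 2 * φ ^ 2) := by
      refine integral_mono_of_continuous hαβ.le (by fun_prop) (by fun_prop) ?_
      intro x hx
      have e1 := key x ⟨hα.trans hx.1, hx.2.trans hβ⟩
      have e4 := norm_sub_le (u x) (u x - d * (Real.sin (l * x) : ℂ))
      rw [sub_sub_cancel, norm_mul, Complex.norm_real, Real.norm_eq_abs] at e4
      rw [← sq_abs (Real.sin _), ← mul_pow]
      have : 0 ≤ ‖d‖ * |Real.sin (l * x)| := by positivity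
      nlinarith [sq_nonneg (‖u x‖ - ‖u x - d * (Real.sin (l * x) : ℂ)‖)]
    rw [intervalIntegral.integral_add (Continuous.intervalIntegrable (by fun_prop) _ _)
      (Continuous.intervalIntegrable (by fun_prop) _ _), intervalIntegral.integral_const_mul,
      intervalIntegral.integral_const_mul, intervalIntegral.integral_const, smul_eq_mul] at e0
    have e5 := mul_le_mul_of_nonneg_right (hsin l hl') (sq_nonneg ‖d‖)
    have e6 : (β - α) * (2 * φ ^ 2) ≤ 1 * (2 * φ ^ 2) := by
      gcongr
      linarith
    linarith
  have hd : ‖d‖ ^ 2 ≤ (2 * (∫ x in α..β, ‖u x‖ ^ 2) + 2 * φ ^ 2) / κ := by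
    rw [le_div_iff₀ hκ]
    linarith
  have hfin : 2 * ((2 * (∫ x in α..β, ‖u x‖ ^ 2) + 2 * φ ^ 2) / κ) ≤
      4 / κ * ((∫ x in (0:ℝ)..1, ‖F x‖ ^ 2) + ∫ x in α..β, ‖u x‖ ^ 2) := by
    rw [show ∀ A : ℝ, 4 / κ * A = 4 * A / κ from fun A => by ring, ← mul_div_assoc]
    exact div_le_div_of_nonneg_right (by linarith) hκ.le
  linarith

/-- The `k`-th Dirichlet frequency of the interval `(0,a)`. -/
noncomputable def dirichletFreq (a : ℝ) (k : ℕ) : ℝ := (k + 1) * Real.pi / a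

/-- The `k`-th sine coefficient of a function on `(0,a)`. -/
noncomputable def sineCoeff (a : ℝ) (k : ℕ) (h : ℝ → ℂ) : ℂ :=
  ∫ y in (0:ℝ)..a, h y * (Real.sin (dirichletFreq a k * y) : ℂ)

theorem integral_cos_int_mul_pi_div {a : ℝ} (ha : 0 < a) {m : ℤ} (hm : m ≠ 0) :
    ∫ y in (0:ℝ)..a, Real.cos (m * Real.pi / a * y) = 0 := by
  have hm' : (m : ℝ) ≠ 0 := by exact_mod_cast hm
  have hc : (m : ℝ) * Real.pi / a ≠ 0 := by positivity
  rw [intervalIntegral.integral_comp_mul_left (fun y => Real.cos y) hc, integral_cos,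
    div_mul_cancel₀ _ ha.ne', Real.sin_int_mul_pi]
  simp

theorem integral_sin_mul_sin {a : ℝ} (ha : 0 < a) (j k : ℕ) :
    ∫ y in (0:ℝ)..a, Real.sin (dirichletFreq a j * y) * Real.sin (dirichletFreq a k * y) =
      if j = k then a / 2 else 0 := by
  have h : ∀ y : ℝ, Real.sin (dirichletFreq a j * y) * Real.sin (dirichletFreq a k * y) =
      1 / 2 * Real.cos (((j - k : ℤ) : ℝ) * Real.pi / a * y) -
        1 / 2 * Real.cos (((j + k + 2 : ℤ) : ℝ) * Real.pi / a * y) := by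
    intro y
    have e1 : ((j - k : ℤ) : ℝ) * Real.pi / a * y =
        dirichletFreq a j * y - dirichletFreq a k * y := by
      simp only [dirichletFreq]; push_cast; ring
    have e2 : ((j + k + 2 : ℤ) : ℝ) * Real.pi / a * y =
        dirichletFreq a j * y + dirichletFreq a k * y := by
      simp only [dirichletFreq]; push_cast; ring
    rw [e1, e2, Real.cos_sub, Real.cos_add]
    ring
  simp_rw [h]
  rw [intervalIntegral.integral_sub (Continuous.intervalIntegrable (by fun_prop) _ _)
    (Continuous.intervalIntegrable (by fun_prop) _ _), intervalIntegral.integral_const_mul,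
    intervalIntegral.integral_const_mul,
    integral_cos_int_mul_pi_div ha (m := (j + k + 2 : ℤ)) (by positivity)]
  split_ifs with hjk
  · subst hjk
    simp
    ring
  · rw [integral_cos_int_mul_pi_div ha (by omega)]
    simp

/-- Parseval's identity for sine series. -/
theorem hasSum_sq_sineCoeff {a : ℝ} (ha : 0 < a) {h : ℝ → ℂ} (hh : Continuous h) :
    HasSum (fun k => ‖sineCoeff a k h‖ ^ 2) (a / 2 * ∫ y in (0:ℝ)..a, ‖h y‖ ^ 2) := by
  classical
  set o : ℝ → ℂ := fun y => if y < 0 then -h (-y) else h y with ho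
  have hoM : Measurable o :=
    Measurable.ite measurableSet_Iio (hh.measurable.comp measurable_neg).neg hh.measurable
  obtain ⟨M, hM⟩ := (isCompact_Icc (a := -a) (b := a)).exists_bound_of_continuousOn
    hh.continuousOn
  have hob : ∀ y ∈ Icc (-a) a, ‖o y‖ ≤ M := by
    intro y hy
    simp only [ho]
    split_ifs
    · rw [norm_neg]; exact hM _ ⟨by linarith [hy.2], by linarith [hy.1]⟩
    · exact hM _ hy
  have hL : MemLp o 2 (volume.restrict (Ioc (-a) a)) :=
    MemLp.of_bound hoM.aestronglyMeasurable M
      (ae_restrict_of_forall_mem measurableSet_Ioc fun y hy => hob y ⟨hy.1.le, hy.2⟩)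
  have haa : -a < a := by linarith
  have split : ∀ {E : Type} [NormedAddCommGroup E] [NormedSpace ℝ E] (G : ℝ → ℂ → E),
      Continuous (fun y => G y (h y)) → Continuous (fun y => G y (-h (-y))) →
      ∫ y in (-a)..a, G y (o y) =
        (∫ y in (0:ℝ)..a, G (-y) (-h y)) + ∫ y in (0:ℝ)..a, G y (h y) := by
    intro E _ _ G h1 h2
    have c1 : ∀ᵐ y : ℝ, y ∈ Ι (-a) 0 → G y (-h (-y)) = G y (o y) := by
      have : ∀ᵐ y : ℝ, y ≠ 0 := by simp [ae_iff]
      filter_upwards [this] with y hy0 hy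
      rw [uIoc_of_le (by linarith)] at hy
      simp [ho, lt_of_le_of_ne hy.2 hy0]
    have c2 : ∀ᵐ y : ℝ, y ∈ Ι 0 a → G y (h y) = G y (o y) := by
      refine Eventually.of_forall fun y hy => ?_
      rw [uIoc_of_le ha.le] at hy
      simp [ho, not_lt.2 hy.1.le]
    have i1 : IntervalIntegrable (fun y => G y (o y)) volume (-a) 0 :=
      (h2.intervalIntegrable _ _).congr_ae ((ae_restrict_iff' measurableSet_uIoc).2 c1)
    have i2 : IntervalIntegrable (fun y => G y (o y)) volume 0 a :=
      (h1.intervalIntegrable _ _).congr_ae ((ae_restrict_iff' measurableSet_uIoc).2 c2)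
    rw [← intervalIntegral.integral_add_adjacent_intervals i1 i2,
      ← intervalIntegral.integral_congr_ae c1, ← intervalIntegral.integral_congr_ae c2]
    congr 1
    have := intervalIntegral.integral_comp_neg (a := 0) (b := a) (fun y => G y (-h (-y)))
    simpa using this.symm
  have norm_o : ∫ y in (-a)..a, ‖o y‖ ^ 2 = 2 * ∫ y in (0:ℝ)..a, ‖h y‖ ^ 2 := by
    rw [split (fun _ z => ‖z‖ ^ 2) (by fun_prop) (by fun_prop)]
    simp only [norm_neg]
    ring
  have coeff : ∀ n : ℤ, ‖fourierCoeffOn haa o n‖ ^ 2 =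
      ‖∫ y in (0:ℝ)..a, h y * (Real.sin (n * Real.pi / a * y) : ℂ)‖ ^ 2 / a ^ 2 := by
    intro n
    have haC : (a : ℂ) ≠ 0 := by exact_mod_cast ha.ne'
    rw [fourierCoeffOn_eq_integral]
    simp only [fourier_coe_apply, smul_eq_mul]
    have e := split (fun y z => Complex.exp (2 * Real.pi * Complex.I * ((-n : ℤ) : ℂ) * y /
      ((a - -a : ℝ) : ℂ)) * z) (by fun_prop) (by fun_prop)
    rw [e, ← intervalIntegral.integral_add (Continuous.intervalIntegrable (by fun_prop) _ _)
      (Continuous.intervalIntegrable (by fun_prop) _ _)]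
    have e2 : ∀ y : ℝ, Complex.exp (2 * Real.pi * Complex.I * ((-n : ℤ) : ℂ) * ((-y : ℝ) : ℂ) /
          ((a - -a : ℝ) : ℂ)) * -h y +
        Complex.exp (2 * Real.pi * Complex.I * ((-n : ℤ) : ℂ) * y / ((a - -a : ℝ) : ℂ)) * h y =
        (-2 * Complex.I) * (h y * (Real.sin (n * Real.pi / a * y) : ℂ)) := by
      intro y
      have s1 : 2 * Real.pi * Complex.I * ((-n : ℤ) : ℂ) * ((-y : ℝ) : ℂ) / ((a - -a : ℝ) : ℂ) =
          ((n * Real.pi / a * y : ℝ) : ℂ) * Complex.I := by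
        push_cast; field_simp; ring
      have s2 : 2 * Real.pi * Complex.I * ((-n : ℤ) : ℂ) * y / ((a - -a : ℝ) : ℂ) =
          -((n * Real.pi / a * y : ℝ) : ℂ) * Complex.I := by
        push_cast; field_simp; ring
      rw [s1, s2, Complex.ofReal_sin, Complex.sin]
      linear_combination (h y) * (Complex.exp (-((n * Real.pi / a * y : ℝ) : ℂ) * Complex.I) -
        Complex.exp (((n * Real.pi / a * y : ℝ) : ℂ) * Complex.I)) * Complex.I_sq
    simp_rw [e2]
    rw [intervalIntegral.integral_const_mul, norm_smul, norm_mul, norm_mul, norm_neg]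
    simp only [Complex.norm_I, Complex.norm_ofNat]
    rw [Real.norm_of_nonneg (by rw [sub_neg_eq_add]; positivity)]
    field_simp
    ring
  have H := (hasSum_sq_fourierCoeffOn (hab := haa) hL).nat_add_neg
  simp only [coeff, norm_o] at H
  have H2 := (hasSum_nat_add_iff' 1).2 H
  simp only [Finset.range_one, Finset.sum_singleton] at H2
  have H3 := H2.mul_left (a ^ 2 / 2)
  convert! H3 using 1
  · ext k
    have s1 : ∫ y in (0:ℝ)..a, h y * (Real.sin (((-((k + 1 : ℕ) : ℤ) : ℤ) : ℝ) * Real.pi / a * y) : ℂ)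
        = -sineCoeff a k h := by
      rw [sineCoeff, ← intervalIntegral.integral_neg]
      congr 1; ext y
      have : ((-((k + 1 : ℕ) : ℤ) : ℤ) : ℝ) * Real.pi / a * y = -(dirichletFreq a k * y) := by
        simp only [dirichletFreq]; push_cast; ring
      rw [this, Real.sin_neg]; push_cast; ring
    have s2 : ∫ y in (0:ℝ)..a, h y * (Real.sin (((((k + 1 : ℕ) : ℤ) : ℤ) : ℝ) * Real.pi / a * y) : ℂ)
        = sineCoeff a k h := by
      rw [sineCoeff]
      congr 1; ext y
      simp only [dirichletFreq]; push_cast; ring_nf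
    rw [s1, s2, norm_neg]
    field_simp
    norm_num
  · simp
    field_simp
    ring

/-- A function that is `C²` on a closed rectangle agrees there with a continuous function on the
plane whose partial derivatives up to order two in the open rectangle are the restrictions of
continuous functions on the plane. -/
theorem exists_continuous_partial_derivatives {a : ℝ} (ha : 0 < a) {u : ℝ × ℝ → ℂ}
    (hu : ContDiffOn ℝ 2 u (Icc 0 1 ×ˢ Icc 0 a)) :
    ∃ U Ux Uxx Uy Uyy : ℝ × ℝ → ℂ, Continuous U ∧ Continuous Ux ∧ Continuous Uxx ∧
      Continuous Uy ∧ Continuous Uyy ∧ (∀ p ∈ Icc (0:ℝ) 1 ×ˢ Icc 0 a, U p = u p) ∧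
      (∀ x ∈ Ioo (0:ℝ) 1, ∀ y ∈ Ioo 0 a, HasDerivAt (fun t => U (t, y)) (Ux (x, y)) x ∧
        HasDerivAt (fun t => Ux (t, y)) (Uxx (x, y)) x ∧
        HasDerivAt (fun t => U (x, t)) (Uy (x, y)) y ∧
        HasDerivAt (fun t => Uy (x, t)) (Uyy (x, y)) y) ∧
      ∀ p ∈ Ioo (0:ℝ) 1 ×ˢ Ioo 0 a, lap2 u p = Uxx p + Uyy p := by
  set S : Set (ℝ × ℝ) := Icc 0 1 ×ˢ Icc 0 a with hS
  set c : ℝ × ℝ → ℝ × ℝ := fun p => (max 0 (min 1 p.1), max 0 (min a p.2)) with hc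
  have hcS : ∀ p, c p ∈ S := fun p =>
    ⟨⟨le_max_left _ _, max_le zero_le_one (min_le_left _ _)⟩,
      ⟨le_max_left _ _, max_le ha.le (min_le_left _ _)⟩⟩
  have hcid : ∀ p ∈ S, c p = p := by
    rintro ⟨x, y⟩ ⟨⟨h1, h2⟩, ⟨h3, h4⟩⟩
    simp only at h1 h2 h3 h4
    simp [hc, h1, h2, h3, h4]
  have hcc : Continuous c := by fun_prop
  have clamp : ∀ {v : ℝ × ℝ → ℂ}, ContinuousOn v S → Continuous (v ∘ c) := fun hv =>
    hv.comp_continuous hcc hcS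
  have hUD : UniqueDiffOn ℝ S := (uniqueDiffOn_Icc one_pos).prod (uniqueDiffOn_Icc ha)
  have hO : ∀ {p : ℝ × ℝ}, p ∈ Ioo (0:ℝ) 1 ×ˢ Ioo 0 a → S ∈ 𝓝 p := fun hp =>
    mem_of_superset ((isOpen_Ioo.prod isOpen_Ioo).mem_nhds hp)
      (prod_mono Ioo_subset_Icc_self Ioo_subset_Icc_self)
  have hasF : ∀ {v : ℝ × ℝ → ℂ}, ContDiffOn ℝ 1 v S → ∀ {p}, p ∈ Ioo (0:ℝ) 1 ×ˢ Ioo 0 a →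
      HasFDerivAt v (fderivWithin ℝ v S p) p := fun hv p hp =>
    ((hv.differentiableOn one_ne_zero p (mem_of_mem_nhds (hO hp))).hasFDerivWithinAt).hasFDerivAt
      (hO hp)
  have clampEq : ∀ (v : ℝ × ℝ → ℂ) {p}, p ∈ Ioo (0:ℝ) 1 ×ˢ Ioo 0 a → v ∘ c =ᶠ[𝓝 p] v :=
    fun v p hp => by
      filter_upwards [hO hp] with q hq
      simp [hcid q hq]
  have hasFc : ∀ {v : ℝ × ℝ → ℂ}, ContDiffOn ℝ 1 v S → ∀ {p}, p ∈ Ioo (0:ℝ) 1 ×ˢ Ioo 0 a →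
      HasFDerivAt (v ∘ c) (fderivWithin ℝ v S (c p)) p := fun {v} hv p hp => by
    rw [hcid p (mem_of_mem_nhds (hO hp))]
    exact (hasF hv hp).congr_of_eventuallyEq (clampEq v hp)
  have hasX : ∀ {v : ℝ × ℝ → ℂ}, ContDiffOn ℝ 1 v S → ∀ x ∈ Ioo (0:ℝ) 1, ∀ y ∈ Ioo 0 a,
      HasDerivAt (fun t => (v ∘ c) (t, y)) (fderivWithin ℝ v S (c (x, y)) (1, 0)) x :=
    fun {v} hv x hx y hy => HasFDerivAt.comp_hasDerivAt (l := v ∘ c) x (hasFc hv (p := (x, y)) ⟨hx, hy⟩)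
      ((hasDerivAt_id x).prodMk (hasDerivAt_const x y))
  have hasY : ∀ {v : ℝ × ℝ → ℂ}, ContDiffOn ℝ 1 v S → ∀ x ∈ Ioo (0:ℝ) 1, ∀ y ∈ Ioo 0 a,
      HasDerivAt (fun t => (v ∘ c) (x, t)) (fderivWithin ℝ v S (c (x, y)) (0, 1)) y :=
    fun {v} hv x hx y hy => HasFDerivAt.comp_hasDerivAt (l := v ∘ c) y (hasFc hv (p := (x, y)) ⟨hx, hy⟩)
      ((hasDerivAt_const y x).prodMk (hasDerivAt_id y))
  have hu1 : ContDiffOn ℝ 1 u S := hu.of_le (by norm_num)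
  have hD : ∀ e, ContDiffOn ℝ 1 (fun p => fderivWithin ℝ u S p e) S := fun e =>
    (hu.fderivWithin hUD (m := 1) (by norm_num)).clm_apply contDiffOn_const
  have hDD : ∀ {v : ℝ × ℝ → ℂ}, ContDiffOn ℝ 1 v S → ∀ e,
      ContinuousOn (fun p => fderivWithin ℝ v S p e) S := fun hv e =>
    (hv.continuousOn_fderivWithin hUD le_rfl).clm_apply continuousOn_const
  refine ⟨u ∘ c, (fun p => fderivWithin ℝ u S p (1, 0)) ∘ c,
    (fun p => fderivWithin ℝ (fun q => fderivWithin ℝ u S q (1, 0)) S p (1, 0)) ∘ c,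
    (fun p => fderivWithin ℝ u S p (0, 1)) ∘ c,
    (fun p => fderivWithin ℝ (fun q => fderivWithin ℝ u S q (0, 1)) S p (0, 1)) ∘ c,
    clamp hu.continuousOn, clamp (hD _).continuousOn, clamp (hDD (hD _) _),
    clamp (hD _).continuousOn, clamp (hDD (hD _) _), fun p hp => by simp [hcid p hp],
    fun x hx y hy => ⟨hasX hu1 x hx y hy, hasX (hD _) x hx y hy, hasY hu1 x hx y hy,
      hasY (hD _) x hx y hy⟩, fun p hp => ?_⟩
  have second : ∀ e, fderiv ℝ (fun q => fderiv ℝ u q e) p =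
      fderivWithin ℝ (fun q => fderivWithin ℝ u S q e) S p := by
    intro e
    rw [← (hasF (hD e) hp).fderiv]
    apply Filter.EventuallyEq.fderiv_eq
    filter_upwards [(isOpen_Ioo.prod isOpen_Ioo).mem_nhds hp] with q hq
    rw [(hasF hu1 hq).fderiv]
  simp only [lap2, second, Function.comp_apply, hcid p (mem_of_mem_nhds (hO hp))]

theorem continuous_sineCoeff (a : ℝ) (k : ℕ) {H : ℝ × ℝ → ℂ} (hH : Continuous H) :
    Continuous fun x => sineCoeff a k fun y => H (x, y) :=
  intervalIntegral.continuous_parametric_intervalIntegral_of_continuous' (by fun_prop) _ _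

theorem hasDerivAt_sineCoeff {a : ℝ} (ha : 0 < a) (k : ℕ) {H Hx : ℝ × ℝ → ℂ} (hH : Continuous H)
    (hHx : Continuous Hx)
    (hd : ∀ x ∈ Ioo (0:ℝ) 1, ∀ y ∈ Ioo 0 a, HasDerivAt (fun t => H (t, y)) (Hx (x, y)) x)
    {x : ℝ} (hx : x ∈ Ioo (0:ℝ) 1) :
    HasDerivAt (fun x => sineCoeff a k fun y => H (x, y)) (sineCoeff a k fun y => Hx (x, y)) x := by
  have hc := continuous_sineCoeff a k hHx
  have ftc : ∀ t ∈ Ioo (0:ℝ) 1, (sineCoeff a k fun y => H (t, y)) =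
      (sineCoeff a k fun y => H (0, y)) + ∫ s in (0:ℝ)..t, sineCoeff a k fun y => Hx (s, y) := by
    intro t ht
    have swap : ∫ s in (0:ℝ)..t, (sineCoeff a k fun y => Hx (s, y)) =
        ∫ y in (0:ℝ)..a, ∫ s in (0:ℝ)..t, Hx (s, y) * (Real.sin (dirichletFreq a k * y) : ℂ) := by
      simp only [sineCoeff]
      apply intervalIntegral_intervalIntegral_swap
      refine (ContinuousOn.integrableOn_compact (isCompact_uIcc.prod isCompact_uIcc)
        (Continuous.continuousOn ?_)).mono_set
        (prod_mono uIoc_subset_uIcc uIoc_subset_uIcc)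
      fun_prop
    rw [swap, sineCoeff, sineCoeff, ← sub_eq_iff_eq_add', ← intervalIntegral.integral_sub
      (Continuous.intervalIntegrable (by fun_prop) _ _)
      (Continuous.intervalIntegrable (by fun_prop) _ _)]
    apply intervalIntegral.integral_congr_Ioo_of_le ha.le
    intro y hy
    have := intervalIntegral.integral_eq_sub_of_hasDerivAt_of_le ht.1.le (f := fun s => H (s, y))
      (f' := fun s => Hx (s, y)) (by fun_prop)
      (fun s hs => hd s ⟨hs.1, hs.2.trans ht.2⟩ y hy)
      (Continuous.intervalIntegrable (by fun_prop) _ _)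
    simp only [intervalIntegral.integral_mul_const, this]
    ring
  refine HasDerivAt.congr_of_eventuallyEq ?_
    (eventually_of_mem (isOpen_Ioo.mem_nhds hx) ftc)
  exact (intervalIntegral.integral_hasDerivAt_right (hc.intervalIntegrable _ _)
    (hc.stronglyMeasurableAtFilter _ _) hc.continuousAt).const_add _

/-- Sine coefficients diagonalize the Dirichlet Laplacian on `(0,a)`. -/
theorem sineCoeff_second_derivative {a : ℝ} (ha : 0 < a) (k : ℕ) {h h' h'' : ℝ → ℂ}
    (hh : Continuous h) (hh' : Continuous h') (hh'' : Continuous h'')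
    (hd : ∀ y ∈ Ioo 0 a, HasDerivAt h (h' y) y) (hd' : ∀ y ∈ Ioo 0 a, HasDerivAt h' (h'' y) y)
    (h0 : h 0 = 0) (h1 : h a = 0) :
    sineCoeff a k h'' = -((dirichletFreq a k ^ 2 : ℝ) : ℂ) * sineCoeff a k h := by
  set μ := dirichletFreq a k with hμ
  have hsin : Real.sin (μ * a) = 0 := by
    have : μ * a = ((k + 1 : ℤ) : ℝ) * Real.pi := by
      rw [hμ, dirichletFreq]
      push_cast
      field_simp
    rw [this, Real.sin_int_mul_pi]
  have := intervalIntegral.integral_eq_sub_of_hasDerivAt_of_le ha.le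
    (f := fun y => h' y * (Real.sin (μ * y) : ℂ) - μ * (h y * (Real.cos (μ * y) : ℂ)))
    (f' := fun y => h'' y * (Real.sin (μ * y) : ℂ) +
      ((μ ^ 2 : ℝ) : ℂ) * (h y * (Real.sin (μ * y) : ℂ))) (by fun_prop) (fun y hy => by
      have a0 : HasDerivAt (fun y => μ * y) μ y := by
        simpa using (hasDerivAt_id y).const_mul μ
      refine (((hd' y hy).mul a0.sin.ofReal_comp).sub
        (((hd y hy).mul a0.cos.ofReal_comp).const_mul (μ : ℂ))).congr_deriv ?_
      push_cast
      ring) (Continuous.intervalIntegrable (by fun_prop) _ _)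
  rw [intervalIntegral.integral_add (Continuous.intervalIntegrable (by fun_prop) _ _)
    (Continuous.intervalIntegrable (by fun_prop) _ _), intervalIntegral.integral_const_mul] at this
  simp only [h0, h1, hsin] at this
  simp only [sineCoeff, ← hμ]
  push_cast
  simp at this
  linear_combination this

theorem setIntegral_Ioo_prod_Ioo {E : Type*} [NormedAddCommGroup E] [NormedSpace ℝ E]
    {H : ℝ × ℝ → E} (hH : Continuous H) {p q r s : ℝ} (hpq : p ≤ q) (hrs : r ≤ s) :
    ∫ z in Ioo p q ×ˢ Ioo r s, H z = ∫ x in p..q, ∫ y in r..s, H (x, y) := by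
  rw [Measure.volume_eq_prod, setIntegral_prod, intervalIntegral.integral_of_le hpq,
    integral_Ioc_eq_integral_Ioo]
  · simp only [intervalIntegral.integral_of_le hrs, integral_Ioc_eq_integral_Ioo]
  · rw [← Measure.volume_eq_prod]
    exact (hH.continuousOn.integrableOn_compact (isCompact_Icc.prod isCompact_Icc)).mono_set
      (prod_mono Ioo_subset_Icc_self Ioo_subset_Icc_self)

theorem Continuous.integrableOn_Ioo_prod_Ioo {E : Type*} [NormedAddCommGroup E]
    {H : ℝ × ℝ → E} (hH : Continuous H) {p q r s : ℝ} :
    IntegrableOn H (Ioo p q ×ˢ Ioo r s) :=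
  (hH.continuousOn.integrableOn_compact (isCompact_Icc.prod isCompact_Icc)).mono_set
    (prod_mono Ioo_subset_Icc_self Ioo_subset_Icc_self)

/-- The duality bound defining the `H^{-1}_x L²_y` norm, in homogeneous form. -/
theorem norm_integral_mul_conj_le {a : ℝ} (ha : 0 < a) {f g : ℝ × ℝ → ℂ} {B : ℝ} (hB : 0 ≤ B)
    (hf : ∀ p ∈ Ioo (0:ℝ) 1 ×ˢ Ioo 0 a, ‖f p‖ ≤ B) (hg : ContDiff ℝ (⊤ : ℕ∞) g)
    (hK : ∃ K : Set ℝ, IsCompact K ∧ K ⊆ Ioo 0 1 ∧ ∀ x ∉ K, ∀ y : ℝ, g (x, y) = 0)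
    {M : ℝ} (hM : 0 < M) (hE : (∫ p in Ioo (0:ℝ) 1 ×ˢ Ioo 0 a,
      (‖g p‖ ^ 2 + ‖fderiv ℝ g p (1, 0)‖ ^ 2)) ≤ M ^ 2) :
    ‖∫ p in Ioo (0:ℝ) 1 ×ˢ Ioo 0 a, f p * (starRingEnd ℂ) (g p)‖ ≤ M * Hm1xL2yNorm a f := by
  have hbdd : BddAbove {r : ℝ | ∃ g : ℝ × ℝ → ℂ, ContDiff ℝ (⊤ : ℕ∞) g ∧
      (∃ K : Set ℝ, IsCompact K ∧ K ⊆ Set.Ioo 0 1 ∧ ∀ x ∉ K, ∀ y : ℝ, g (x, y) = 0) ∧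
      (∫ p in Set.Ioo (0:ℝ) 1 ×ˢ Set.Ioo 0 a, (‖g p‖ ^ 2 + ‖fderiv ℝ g p (1, 0)‖ ^ 2)) ≤ 1 ∧
      r = ‖∫ p in Set.Ioo (0:ℝ) 1 ×ˢ Set.Ioo 0 a, f p * (starRingEnd ℂ) (g p)‖} := by
    refine ⟨B * (a + 1), ?_⟩
    rintro _ ⟨g, hg, -, hE, rfl⟩
    have hgc := hg.continuous
    have hdc : Continuous fun p => fderiv ℝ g p (1, 0) :=
      (hg.continuous_fderiv (by simp)).clm_apply continuous_const
    have hEc : Continuous fun p => ‖g p‖ ^ 2 + ‖fderiv ℝ g p (1, 0)‖ ^ 2 := by fun_prop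
    refine (norm_integral_le_of_norm_le (g := fun p => B * (1 + (‖g p‖ ^ 2 +
      ‖fderiv ℝ g p (1, 0)‖ ^ 2))) (Continuous.integrableOn_Ioo_prod_Ioo (by fun_prop))
      (ae_restrict_of_forall_mem (measurableSet_Ioo.prod measurableSet_Ioo) ?_)).trans ?_
    · intro p hp
      rw [norm_mul, RCLike.norm_conj]
      refine mul_le_mul (hf p hp) ?_ (norm_nonneg _) hB
      nlinarith [sq_nonneg (‖g p‖ - 1), sq_nonneg ‖fderiv ℝ g p (1, 0)‖]
    · rw [integral_const_mul, integral_add (continuous_const.integrableOn_Ioo_prod_Ioo)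
        hEc.integrableOn_Ioo_prod_Ioo, setIntegral_Ioo_prod_Ioo continuous_const zero_le_one ha.le]
      simp only [intervalIntegral.integral_const, smul_eq_mul]
      gcongr
      linarith
  have hMC : (M : ℂ) ≠ 0 := by exact_mod_cast hM.ne'
  have hgd : Differentiable ℝ g := hg.differentiable (by simp)
  have hle : ‖∫ p in Ioo (0:ℝ) 1 ×ˢ Ioo 0 a, f p * (starRingEnd ℂ) ((M : ℂ)⁻¹ * g p)‖ ≤
      Hm1xL2yNorm a f := by
    refine le_csSup hbdd ⟨fun p => (M : ℂ)⁻¹ * g p, contDiff_const.mul hg, ?_, ?_, rfl⟩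
    · obtain ⟨K, h1, h2, h3⟩ := hK
      exact ⟨K, h1, h2, fun x hx y => by simp [h3 x hx y]⟩
    · have : ∀ p, ‖(M : ℂ)⁻¹ * g p‖ ^ 2 + ‖fderiv ℝ (fun p => (M : ℂ)⁻¹ * g p) p (1, 0)‖ ^ 2 =
          (M ^ 2)⁻¹ * (‖g p‖ ^ 2 + ‖fderiv ℝ g p (1, 0)‖ ^ 2) := by
        intro p
        rw [fderiv_const_mul (hgd p), smul_apply, smul_eq_mul, norm_mul,
          norm_mul, norm_inv, Complex.norm_real, Real.norm_of_nonneg hM.le]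
        ring
      simp_rw [this]
      rw [integral_const_mul, inv_mul_le_iff₀ (by positivity), mul_one]
      exact hE
  have heq : ∫ p in Ioo (0:ℝ) 1 ×ˢ Ioo 0 a, f p * (starRingEnd ℂ) ((M : ℂ)⁻¹ * g p) =
      (M : ℂ)⁻¹ * ∫ p in Ioo (0:ℝ) 1 ×ˢ Ioo 0 a, f p * (starRingEnd ℂ) (g p) := by
    rw [← integral_const_mul]
    congr 1
    ext p
    rw [map_mul, map_inv₀, Complex.conj_ofReal]
    ring
  rw [heq, norm_mul, norm_inv, Complex.norm_real, Real.norm_of_nonneg hM.le,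
    inv_mul_le_iff₀ hM] at hle
  exact hle

/-- A smooth step from `0` to `1` inside the unit interval. -/
theorem exists_smooth_step : ∃ R ρ : ℝ → ℝ, ContDiff ℝ (⊤ : ℕ∞) ρ ∧
    (∀ x, HasDerivAt R (ρ x) x) ∧ (∀ x ≤ 1 / 4, R x = 0) ∧ ∀ x, 3 / 4 ≤ x → R x = 1 := by
  have h : ContDiff ℝ (⊤ : ℕ∞) fun x : ℝ => Real.smoothTransition (2 * x - 1 / 2) :=
    Real.smoothTransition.contDiff.comp (by fun_prop)
  exact ⟨_, _, (contDiff_infty_iff_deriv.1 h).2,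
    fun x => ((contDiff_infty_iff_deriv.1 h).1 x).hasDerivAt,
    fun x hx => Real.smoothTransition.zero_of_nonpos (by linarith),
    fun x hx => Real.smoothTransition.one_of_one_le (by linarith)⟩

/-- A compactly supported primitive of a test function, after correcting its mean. -/
theorem exists_compactly_supported_primitive {R ρ : ℝ → ℝ}
    (hρ : ContDiff ℝ (⊤ : ℕ∞) ρ) (hRρ : ∀ x, HasDerivAt R (ρ x) x) (hR0 : ∀ x ≤ 1 / 4, R x = 0)
    (hR1 : ∀ x, 3 / 4 ≤ x → R x = 1) {φ : ℝ → ℂ} (hφ : ContDiff ℝ (⊤ : ℕ∞) φ) {δ : ℝ}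
    (hδ : 0 < δ) (hδ' : δ ≤ 1 / 4) (hs : ∀ x ∉ Icc δ (1 - δ), φ x = 0) :
    ∃ G : ℝ → ℂ, ContDiff ℝ (⊤ : ℕ∞) G ∧ (∀ x ∉ Icc δ (1 - δ), G x = 0) ∧
      ∀ x, HasDerivAt G (φ x - (∫ t in (0:ℝ)..1, φ t) * (ρ x : ℂ)) x := by
  set m := ∫ t in (0:ℝ)..1, φ t with hm
  have hd : ∀ x, HasDerivAt (fun x => (∫ t in (0:ℝ)..x, φ t) - m * (R x : ℂ))
      (φ x - m * (ρ x : ℂ)) x := fun x =>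
    (intervalIntegral.integral_hasDerivAt_right (hφ.continuous.intervalIntegrable _ _)
      (hφ.continuous.stronglyMeasurableAtFilter _ _) hφ.continuous.continuousAt).sub
      ((hRρ x).ofReal_comp.const_mul m)
  refine ⟨_, ?_, ?_, hd⟩
  · refine contDiff_infty_iff_deriv.2 ⟨fun x => (hd x).differentiableAt, ?_⟩
    rw [funext fun x => (hd x).deriv]
    exact hφ.sub (contDiff_const.mul (Complex.ofRealCLM.contDiff.comp hρ))
  · intro x hx
    have zero : ∀ p q : ℝ, (∀ t ∈ [[p, q]], t ∉ Icc δ (1 - δ)) → ∫ t in p..q, φ t = 0 := by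
      intro p q h
      rw [intervalIntegral.integral_congr (g := fun _ => 0) fun t ht => hs t (h t ht),
        intervalIntegral.integral_zero]
    rcases lt_or_ge x δ with h | h
    · rw [hR0 x (by linarith), zero 0 x fun t ht ht' =>
        absurd ht'.1 (not_le.2 (ht.2.trans_lt (max_lt hδ h)))]
      simp
    · have h' : 1 - δ < x := not_le.1 fun h' => hx ⟨h, h'⟩
      rw [hR1 x (by linarith), ← intervalIntegral.integral_add_adjacent_intervals (b := 1)
        (hφ.continuous.intervalIntegrable _ _) (hφ.continuous.intervalIntegrable _ _),
        zero 1 x fun t ht ht' =>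
          absurd ht'.2 (not_le.2 ((lt_min (by linarith) h').trans_le ht.1))]
      simp [hm]

theorem integral_sq_sum_sin_real {a : ℝ} (ha : 0 < a) (N : ℕ) (c : ℕ → ℝ) :
    ∫ y in (0:ℝ)..a, (∑ k ∈ Finset.range N, c k * Real.sin (dirichletFreq a k * y)) ^ 2 =
      a / 2 * ∑ k ∈ Finset.range N, c k ^ 2 := by
  simp_rw [sq, Finset.sum_mul_sum]
  rw [intervalIntegral.integral_finsetSum fun _ _ =>
    Continuous.intervalIntegrable (by fun_prop) _ _, Finset.mul_sum]
  refine Finset.sum_congr rfl fun j hj => ?_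
  rw [intervalIntegral.integral_finsetSum fun _ _ =>
    Continuous.intervalIntegrable (by fun_prop) _ _]
  have : ∀ k, ∫ y in (0:ℝ)..a, c j * Real.sin (dirichletFreq a j * y) *
      (c k * Real.sin (dirichletFreq a k * y)) = c j * c k * if j = k then a / 2 else 0 := by
    intro k
    rw [← integral_sin_mul_sin ha, ← intervalIntegral.integral_const_mul]
    congr 1
    ext y
    ring
  simp only [this, mul_ite, mul_zero, Finset.sum_ite_eq, hj, if_true]
  ring

/-- Parseval's identity for finite sine sums. -/
theorem integral_norm_sq_sum_sin {a : ℝ} (ha : 0 < a) (N : ℕ) (c : ℕ → ℂ) :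
    ∫ y in (0:ℝ)..a, ‖∑ k ∈ Finset.range N, c k * (Real.sin (dirichletFreq a k * y) : ℂ)‖ ^ 2 =
      a / 2 * ∑ k ∈ Finset.range N, ‖c k‖ ^ 2 := by
  simp_rw [Complex.sq_norm, Complex.normSq_apply, Complex.re_sum, Complex.im_sum,
    Complex.re_mul_ofReal, Complex.im_mul_ofReal, ← sq]
  rw [intervalIntegral.integral_add (Continuous.intervalIntegrable (by fun_prop) _ _)
    (Continuous.intervalIntegrable (by fun_prop) _ _), integral_sq_sum_sin_real ha,
    integral_sq_sum_sin_real ha, Finset.sum_add_distrib, mul_add]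

/-- Every continuous function on the unit interval is an `L²` limit of test functions. -/
theorem exists_tendsto_test_functions {F : ℝ → ℂ} (hF : Continuous F) :
    ∃ φ : ℕ → ℝ → ℂ, (∀ n, ContDiff ℝ (⊤ : ℕ∞) (φ n)) ∧
      (∀ n : ℕ, ∀ x ∉ Icc (1 / (n + 4) : ℝ) (1 - 1 / (n + 4)), φ n x = 0) ∧
      Tendsto (fun n => ∫ x in (0:ℝ)..1, F x * (starRingEnd ℂ) (φ n x)) atTop
        (𝓝 ((∫ x in (0:ℝ)..1, ‖F x‖ ^ 2 : ℝ) : ℂ)) ∧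
      Tendsto (fun n => ∫ x in (0:ℝ)..1, ‖φ n x‖ ^ 2) atTop (𝓝 (∫ x in (0:ℝ)..1, ‖F x‖ ^ 2)) := by
  have approx : ∀ n : ℕ, ∃ P : ℝ → ℂ, ContDiff ℝ (⊤ : ℕ∞) P ∧
      ∀ x ∈ Icc (0:ℝ) 1, ‖P x - F x‖ ≤ 2 * (1 / ((n : ℝ) + 1)) := by
    intro n
    obtain ⟨p, hp⟩ := exists_polynomial_near_of_continuousOn 0 1 (fun x => (F x).re)
      (by fun_prop) (1 / ((n : ℝ) + 1)) (by positivity)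
    obtain ⟨q, hq⟩ := exists_polynomial_near_of_continuousOn 0 1 (fun x => (F x).im)
      (by fun_prop) (1 / ((n : ℝ) + 1)) (by positivity)
    have smooth : ∀ r : Polynomial ℝ, ContDiff ℝ (⊤ : ℕ∞) fun x => ((r.eval x : ℝ) : ℂ) :=
      fun r => Complex.ofRealCLM.contDiff.comp (by simpa using r.contDiff_aeval (𝕜 := ℝ) _)
    refine ⟨fun x => ((p.eval x : ℝ) : ℂ) + ((q.eval x : ℝ) : ℂ) * Complex.I,
      (smooth p).add ((smooth q).mul contDiff_const), fun x hx => ?_⟩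
    refine (Complex.norm_le_abs_re_add_abs_im _).trans ?_
    have h1 := hp x hx
    have h2 := hq x hx
    simp
    rw [two_mul]
    simp only [one_div] at h1 h2
    exact add_le_add h1.le h2.le
  choose P hPs hP using approx
  set χ : ℕ → ℝ → ℝ := fun n x => Real.smoothTransition ((n + 4) * x - 1) *
    Real.smoothTransition ((n + 4) * (1 - x) - 1) with hχ
  have hχs : ∀ n, ContDiff ℝ (⊤ : ℕ∞) (χ n) := fun n =>
    (Real.smoothTransition.contDiff.comp (by fun_prop)).mul
      (Real.smoothTransition.contDiff.comp (by fun_prop))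
  have hχb : ∀ n x, |χ n x| ≤ 1 := by
    intro n x
    rw [abs_of_nonneg (mul_nonneg (Real.smoothTransition.nonneg _)
      (Real.smoothTransition.nonneg _))]
    exact mul_le_one₀ (Real.smoothTransition.le_one _) (Real.smoothTransition.nonneg _)
      (Real.smoothTransition.le_one _)
  have hφs : ∀ n, ContDiff ℝ (⊤ : ℕ∞) fun x => (χ n x : ℂ) * P n x := fun n =>
    (Complex.ofRealCLM.contDiff.comp (hχs n)).mul (hPs n)
  have hφb : ∀ n, ∀ x ∈ Icc (0:ℝ) 1, ‖(χ n x : ℂ) * P n x‖ ≤ ‖F x‖ + 2 := by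
    intro n x hx
    rw [norm_mul, Complex.norm_real]
    refine (mul_le_of_le_one_left (norm_nonneg _) (hχb n x)).trans ?_
    have h1 := hP n x hx
    have h2 : 1 / ((n : ℝ) + 1) ≤ 1 := by
      rw [div_le_one (by positivity)]
      linarith [n.cast_nonneg (α := ℝ)]
    have h3 := norm_add_le (P n x - F x) (F x)
    rw [sub_add_cancel] at h3
    linarith
  have hlim : ∀ x ∈ Ioo (0:ℝ) 1, Tendsto (fun n => (χ n x : ℂ) * P n x) atTop (𝓝 (F x)) := by
    intro x hx
    have hPlim : Tendsto (fun n => P n x) atTop (𝓝 (F x)) := by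
      rw [tendsto_iff_norm_sub_tendsto_zero]
      refine squeeze_zero (fun _ => norm_nonneg _) (fun n => hP n x ⟨hx.1.le, hx.2.le⟩) ?_
      simpa using (tendsto_one_div_add_atTop_nhds_zero_nat (𝕜 := ℝ)).const_mul 2
    have large : ∀ c : ℝ, 0 < c → ∀ᶠ n : ℕ in atTop, 1 ≤ ((n : ℝ) + 4) * c - 1 := by
      intro c hc
      filter_upwards [eventually_ge_atTop ⌈2 / c⌉₊] with n hn
      have : 2 / c ≤ n := (Nat.le_ceil _).trans (by exact_mod_cast hn)
      rw [div_le_iff₀ hc] at this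
      linarith
    refine hPlim.congr' ?_
    filter_upwards [large x hx.1, large (1 - x) (by linarith [hx.2])] with n h1 h2
    simp [hχ, Real.smoothTransition.one_of_one_le h1, Real.smoothTransition.one_of_one_le h2]
  have hae : ∀ᵐ x : ℝ, x ∈ Ι (0:ℝ) 1 → x ∈ Ioo (0:ℝ) 1 := by
    have : ∀ᵐ x : ℝ, x ≠ 1 := by simp [ae_iff]
    filter_upwards [this] with x hx1 hx
    rw [uIoc_of_le zero_le_one] at hx
    exact ⟨hx.1, lt_of_le_of_ne hx.2 hx1⟩
  refine ⟨fun n x => (χ n x : ℂ) * P n x, hφs, ?_, ?_, ?_⟩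
  · intro n x hx
    have hn : (0:ℝ) < n + 4 := by positivity
    rcases lt_or_ge x (1 / (n + 4)) with h | h
    · rw [lt_div_iff₀ hn] at h
      simp [hχ, Real.smoothTransition.zero_of_nonpos (x := (n + 4) * x - 1) (by linarith)]
    · have h' : 1 - 1 / ((n : ℝ) + 4) < x := not_le.1 fun h' => hx ⟨h, h'⟩
      have h2 : 1 - x < 1 / ((n : ℝ) + 4) := by linarith
      rw [lt_div_iff₀ hn] at h2
      simp [hχ, Real.smoothTransition.zero_of_nonpos (x := (n + 4) * (1 - x) - 1) (by linarith)]
  · rw [← intervalIntegral.integral_ofReal]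
    refine intervalIntegral.tendsto_integral_filter_of_dominated_convergence
      (fun x => ‖F x‖ * (‖F x‖ + 2))
      (Eventually.of_forall fun n => Continuous.aestronglyMeasurable ?_)
      (Eventually.of_forall fun n => ?_) (Continuous.intervalIntegrable (by fun_prop) _ _) ?_
    · have := (hφs n).continuous
      fun_prop
    · filter_upwards [hae] with x hx hx'
      rw [norm_mul, RCLike.norm_conj]
      exact mul_le_mul_of_nonneg_left (hφb n x (Ioo_subset_Icc_self (hx hx'))) (norm_nonneg _)
    · filter_upwards [hae] with x hx hx'
      have h := ((Complex.continuous_conj.tendsto _).comp (hlim x (hx hx'))).const_mul (F x)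
      rw [Complex.mul_conj'] at h
      exact_mod_cast h
  · refine intervalIntegral.tendsto_integral_filter_of_dominated_convergence
      (fun x => (‖F x‖ + 2) ^ 2)
      (Eventually.of_forall fun n => Continuous.aestronglyMeasurable ?_)
      (Eventually.of_forall fun n => ?_) (Continuous.intervalIntegrable (by fun_prop) _ _) ?_
    · have := (hφs n).continuous
      fun_prop
    · filter_upwards [hae] with x hx hx'
      rw [Real.norm_of_nonneg (by positivity)]
      exact pow_le_pow_left₀ (norm_nonneg _) (hφb n x (Ioo_subset_Icc_self (hx hx'))) 2
    · filter_upwards [hae] with x hx hx'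
      exact (hlim x (hx hx')).norm.pow 2

theorem integral_deriv_mul_conj {F F' G G' : ℝ → ℂ} (hF : Continuous F) (hF' : Continuous F')
    (hG : Continuous G) (hG' : Continuous G') (hFd : ∀ x ∈ Ioo (0:ℝ) 1, HasDerivAt F (F' x) x)
    (hGd : ∀ x ∈ Ioo (0:ℝ) 1, HasDerivAt G (G' x) x) (h0 : G 0 = 0) (h1 : G 1 = 0) :
    ∫ x in (0:ℝ)..1, F' x * (starRingEnd ℂ) (G x) =
      -∫ x in (0:ℝ)..1, F x * (starRingEnd ℂ) (G' x) := by
  have h := intervalIntegral.integral_eq_sub_of_hasDerivAt_of_le (zero_le_one' ℝ)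
    (f := fun x => F x * (starRingEnd ℂ) (G x)) (by fun_prop)
    (fun x hx => (hFd x hx).mul ((hGd x hx).star))
    (Continuous.intervalIntegrable (by simp only [← starRingEnd_apply]; fun_prop) _ _)
  simp only [← starRingEnd_apply] at h
  rw [intervalIntegral.integral_add (Continuous.intervalIntegrable (by fun_prop) _ _)
    (Continuous.intervalIntegrable (by fun_prop) _ _), h0, h1] at h
  simp only [map_zero, mul_zero, sub_zero] at h
  exact eq_neg_of_add_eq_zero_left h

theorem integral_sq_sub_mean_le {φ : ℝ → ℂ} (hφ : Continuous φ) {ρ : ℝ → ℝ} (hρ : Continuous ρ) :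
    ∫ x in (0:ℝ)..1, ‖φ x - (∫ t in (0:ℝ)..1, φ t) * (ρ x : ℂ)‖ ^ 2 ≤
      2 * (1 + ∫ x in (0:ℝ)..1, ρ x ^ 2) * ∫ x in (0:ℝ)..1, ‖φ x‖ ^ 2 := by
  set m := ∫ t in (0:ℝ)..1, φ t
  have hm : ‖m‖ ^ 2 ≤ ∫ x in (0:ℝ)..1, ‖φ x‖ ^ 2 :=
    (pow_le_pow_left₀ (norm_nonneg _)
      (intervalIntegral.norm_integral_le_integral_norm zero_le_one) 2).trans
      (sq_integral_le_integral_sq_s6 hφ.norm)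
  have hρ0 : 0 ≤ ∫ x in (0:ℝ)..1, ρ x ^ 2 :=
    intervalIntegral.integral_nonneg zero_le_one fun _ _ => sq_nonneg _
  calc ∫ x in (0:ℝ)..1, ‖φ x - m * (ρ x : ℂ)‖ ^ 2
      ≤ ∫ x in (0:ℝ)..1, (2 * ‖φ x‖ ^ 2 + 2 * ‖m‖ ^ 2 * ρ x ^ 2) := by
        refine integral_mono_of_continuous zero_le_one (by fun_prop) (by fun_prop) fun x _ => ?_
        have h1 := norm_sub_le (φ x) (m * (ρ x : ℂ))
        have h2 : ‖m * (ρ x : ℂ)‖ ^ 2 = ‖m‖ ^ 2 * ρ x ^ 2 := by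
          rw [norm_mul, Complex.norm_real, mul_pow, Real.norm_eq_abs, sq_abs]
        nlinarith [norm_nonneg (φ x - m * (ρ x : ℂ)), sq_nonneg (‖φ x‖ - ‖m * (ρ x : ℂ)‖)]
    _ = 2 * (∫ x in (0:ℝ)..1, ‖φ x‖ ^ 2) + 2 * ‖m‖ ^ 2 * ∫ x in (0:ℝ)..1, ρ x ^ 2 := by
        rw [intervalIntegral.integral_add (Continuous.intervalIntegrable (by fun_prop) _ _)
          (Continuous.intervalIntegrable (by fun_prop) _ _),
          intervalIntegral.integral_const_mul, intervalIntegral.integral_const_mul]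
    _ ≤ _ := by nlinarith [mul_le_mul_of_nonneg_right hm hρ0]

/-- The energy of a separated finite sine sum whose coefficients vanish at `0`. -/
theorem energy_sum_sin_le {a : ℝ} (ha : 0 < a) (N : ℕ) {G ψ : ℕ → ℝ → ℂ}
    (hG : ∀ k, ContDiff ℝ (⊤ : ℕ∞) (G k)) (hψ : ∀ k, Continuous (ψ k))
    (hGd : ∀ k x, HasDerivAt (G k) (ψ k x) x) (h0 : ∀ k, G k 0 = 0) :
    ∫ p in Ioo (0:ℝ) 1 ×ˢ Ioo 0 a,
      (‖∑ k ∈ Finset.range N, G k p.1 * (Real.sin (dirichletFreq a k * p.2) : ℂ)‖ ^ 2 +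
        ‖fderiv ℝ (fun p : ℝ × ℝ => ∑ k ∈ Finset.range N,
          G k p.1 * (Real.sin (dirichletFreq a k * p.2) : ℂ)) p (1, 0)‖ ^ 2) ≤
      a * ∑ k ∈ Finset.range N, ∫ x in (0:ℝ)..1, ‖ψ k x‖ ^ 2 := by
  have hGc := fun k => (hG k).continuous
  have hfd : ∀ p : ℝ × ℝ, fderiv ℝ (fun p : ℝ × ℝ => ∑ k ∈ Finset.range N,
      G k p.1 * (Real.sin (dirichletFreq a k * p.2) : ℂ)) p (1, 0) =
      ∑ k ∈ Finset.range N, ψ k p.1 * (Real.sin (dirichletFreq a k * p.2) : ℂ) := by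
    intro p
    have hdiff : DifferentiableAt ℝ (fun p : ℝ × ℝ => ∑ k ∈ Finset.range N,
        G k p.1 * (Real.sin (dirichletFreq a k * p.2) : ℂ)) p := by
      have hsin : ∀ k, DifferentiableAt ℝ
          (fun p : ℝ × ℝ => Real.sin (dirichletFreq a k * p.2)) p := by fun_prop
      exact DifferentiableAt.fun_sum fun k _ =>
        ((hGd k p.1).differentiableAt.comp p differentiableAt_fst).mul
          (Complex.ofRealCLM.differentiableAt.comp p (hsin k))
    have h1 : HasDerivAt (fun t : ℝ => (t, p.2)) ((1:ℝ), (0:ℝ)) p.1 :=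
      (hasDerivAt_id _).prodMk (hasDerivAt_const _ _)
    have h2 := hdiff.hasFDerivAt.comp_hasDerivAt p.1 h1
    refine h2.unique ?_
    exact HasDerivAt.fun_sum fun k _ =>
      (hGd k p.1).mul_const (Real.sin (dirichletFreq a k * p.2) : ℂ)
  simp_rw [hfd]
  rw [setIntegral_Ioo_prod_Ioo (by fun_prop) zero_le_one ha.le]
  have inner : ∀ x : ℝ, (∫ y in (0:ℝ)..a,
      (‖∑ k ∈ Finset.range N, G k x * (Real.sin (dirichletFreq a k * y) : ℂ)‖ ^ 2 +
        ‖∑ k ∈ Finset.range N, ψ k x * (Real.sin (dirichletFreq a k * y) : ℂ)‖ ^ 2)) =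
      a / 2 * ∑ k ∈ Finset.range N, (‖G k x‖ ^ 2 + ‖ψ k x‖ ^ 2) := by
    intro x
    rw [intervalIntegral.integral_add (Continuous.intervalIntegrable (by fun_prop) _ _)
      (Continuous.intervalIntegrable (by fun_prop) _ _), integral_norm_sq_sum_sin ha,
      integral_norm_sq_sum_sin ha, Finset.sum_add_distrib, mul_add]
  simp_rw [inner]
  rw [intervalIntegral.integral_const_mul, intervalIntegral.integral_finsetSum fun _ _ =>
    Continuous.intervalIntegrable (by fun_prop) _ _, div_mul_eq_mul_div, mul_div_assoc]
  refine mul_le_mul_of_nonneg_left ?_ ha.le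
  rw [div_le_iff₀ two_pos, Finset.sum_mul]
  refine Finset.sum_le_sum fun k _ => ?_
  rw [intervalIntegral.integral_add (Continuous.intervalIntegrable (by fun_prop) _ _)
    (Continuous.intervalIntegrable (by fun_prop) _ _)]
  linarith [integral_sq_le_integral_deriv_sq (hGc k) (hψ k) (fun x _ => hGd k x) (h0 k)]

theorem norm_sum_integral_mul_conj_le {a : ℝ} (ha : 0 < a) {R ρ : ℝ → ℝ}
    (hρ : ContDiff ℝ (⊤ : ℕ∞) ρ) (hRρ : ∀ x, HasDerivAt R (ρ x) x) (hR0 : ∀ x ≤ 1 / 4, R x = 0)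
    (hR1 : ∀ x, 3 / 4 ≤ x → R x = 1) {H f : ℝ × ℝ → ℂ} (hH : Continuous H)
    (hfH : ∀ p ∈ Ioo (0:ℝ) 1 ×ˢ Ioo 0 a, f p = H p) {F : ℕ → ℝ → ℂ} (hF : ∀ k, Continuous (F k))
    (hFd : ∀ k, ∀ x ∈ Ioo (0:ℝ) 1, HasDerivAt (F k) (sineCoeff a k fun y => H (x, y)) x)
    (hFρ : ∀ k, ∫ x in (0:ℝ)..1, F k x * (ρ x : ℂ) = 0) (N : ℕ) {φ : ℕ → ℝ → ℂ}
    (hφ : ∀ k, ContDiff ℝ (⊤ : ℕ∞) (φ k)) {δ : ℝ} (hδ : 0 < δ) (hδ' : δ ≤ 1 / 4)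
    (hs : ∀ k, ∀ x ∉ Icc δ (1 - δ), φ k x = 0) {M : ℝ} (hM : 0 < M)
    (hE : 2 * a * (1 + ∫ x in (0:ℝ)..1, ρ x ^ 2) *
      ∑ k ∈ Finset.range N, ∫ x in (0:ℝ)..1, ‖φ k x‖ ^ 2 ≤ M ^ 2) :
    ‖∑ k ∈ Finset.range N, ∫ x in (0:ℝ)..1, F k x * (starRingEnd ℂ) (φ k x)‖ ≤
      M * Hm1xL2yNorm a f := by
  choose G hG hGs hGd using fun k =>
    exists_compactly_supported_primitive hρ hRρ hR0 hR1 (hφ k) hδ hδ' (hs k)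
  have hρc := hρ.continuous
  have hφc := fun k => (hφ k).continuous
  have hGc := fun k => (hG k).continuous
  have hG0 : ∀ k, G k 0 = 0 := fun k => hGs k 0 fun h => absurd h.1 (not_le.2 hδ)
  have hG1 : ∀ k, G k 1 = 0 := fun k => hGs k 1 fun h => absurd h.2 (by linarith)
  set g : ℝ × ℝ → ℂ := fun p =>
    ∑ k ∈ Finset.range N, G k p.1 * (Real.sin (dirichletFreq a k * p.2) : ℂ) with hg
  have hgs : ContDiff ℝ (⊤ : ℕ∞) g := by
    have hsin : ∀ k, ContDiff ℝ (⊤ : ℕ∞)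
        fun p : ℝ × ℝ => Real.sin (dirichletFreq a k * p.2) := by fun_prop
    exact ContDiff.sum fun k _ => ((hG k).comp contDiff_fst).mul
      (Complex.ofRealCLM.contDiff.comp (hsin k))
  obtain ⟨B, hB⟩ := (isCompact_Icc.prod isCompact_Icc).exists_bound_of_continuousOn
    (s := Icc (0:ℝ) 1 ×ˢ Icc 0 a) hH.continuousOn
  have hfB : ∀ p ∈ Ioo (0:ℝ) 1 ×ˢ Ioo 0 a, ‖f p‖ ≤ |B| := fun p hp => by
    rw [hfH p hp]
    exact (hB p ⟨Ioo_subset_Icc_self hp.1, Ioo_subset_Icc_self hp.2⟩).trans (le_abs_self B)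
  have key := norm_integral_mul_conj_le ha (abs_nonneg B) hfB hgs
    ⟨Icc δ (1 - δ), isCompact_Icc, fun x hx => ⟨by linarith [hx.1], by linarith [hx.2]⟩,
      fun x hx y => by simp [hg, hGs _ x hx]⟩ hM ?_
  · have hpair : ∫ p in Ioo (0:ℝ) 1 ×ˢ Ioo 0 a, f p * (starRingEnd ℂ) (g p) =
        -∑ k ∈ Finset.range N, ∫ x in (0:ℝ)..1, F k x * (starRingEnd ℂ) (φ k x) := by
      rw [setIntegral_congr_fun (g := fun p => H p * (starRingEnd ℂ) (g p))
        (measurableSet_Ioo.prod measurableSet_Ioo) fun p hp => by simp only [hfH p hp],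
        setIntegral_Ioo_prod_Ioo (H := fun p => H p * (starRingEnd ℂ) (g p))
          (hH.mul (Complex.continuous_conj.comp hgs.continuous))
          zero_le_one ha.le]
      have inner : ∀ x : ℝ, ∫ y in (0:ℝ)..a, H (x, y) * (starRingEnd ℂ) (g (x, y)) =
          ∑ k ∈ Finset.range N,
            (sineCoeff a k fun y => H (x, y)) * (starRingEnd ℂ) (G k x) := by
        intro x
        simp only [hg, map_sum, map_mul, Complex.conj_ofReal, Finset.mul_sum, sineCoeff]
        rw [intervalIntegral.integral_finsetSum fun _ _ =>
          Continuous.intervalIntegrable (by fun_prop) _ _]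
        refine Finset.sum_congr rfl fun k _ => ?_
        rw [← intervalIntegral.integral_mul_const]
        congr 1
        ext y
        ring
      simp_rw [inner]
      have hSc := fun k => continuous_sineCoeff a k hH
      rw [intervalIntegral.integral_finsetSum fun _ _ =>
        Continuous.intervalIntegrable (by fun_prop) _ _, ← Finset.sum_neg_distrib]
      refine Finset.sum_congr rfl fun k _ => ?_
      rw [integral_deriv_mul_conj (hF k) (hSc k) (hGc k) (by fun_prop) (hFd k)
        (fun x _ => hGd k x) (hG0 k) (hG1 k)]
      have split : ∀ (m : ℂ) (x : ℝ), F k x * (starRingEnd ℂ) (φ k x - m * (ρ x : ℂ)) =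
          F k x * (starRingEnd ℂ) (φ k x) - (starRingEnd ℂ) m * (F k x * (ρ x : ℂ)) := by
        intro m x
        rw [map_sub, map_mul, Complex.conj_ofReal]
        ring
      simp_rw [split]
      rw [intervalIntegral.integral_sub (Continuous.intervalIntegrable (by fun_prop) _ _)
        (Continuous.intervalIntegrable (by fun_prop) _ _), intervalIntegral.integral_const_mul,
        hFρ, mul_zero, sub_zero]
    rwa [hpair, norm_neg] at key
  · refine (energy_sum_sin_le ha N hG (by fun_prop) hGd hG0).trans (le_trans ?_ hE)
    rw [Finset.mul_sum, Finset.mul_sum]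
    refine Finset.sum_le_sum fun k _ => ?_
    have := mul_le_mul_of_nonneg_left (integral_sq_sub_mean_le (hφc k) hρc) ha.le
    linarith

/-- Normalized primitives of the sine modes of `f` are controlled in `L²` by the `H^{-1}_x L²_y`
norm of `f`. -/
theorem sum_integral_sq_le_sq_Hm1xL2yNorm {a : ℝ} (ha : 0 < a) {R ρ : ℝ → ℝ}
    (hρ : ContDiff ℝ (⊤ : ℕ∞) ρ) (hRρ : ∀ x, HasDerivAt R (ρ x) x) (hR0 : ∀ x ≤ 1 / 4, R x = 0)
    (hR1 : ∀ x, 3 / 4 ≤ x → R x = 1) {H f : ℝ × ℝ → ℂ} (hH : Continuous H)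
    (hfH : ∀ p ∈ Ioo (0:ℝ) 1 ×ˢ Ioo 0 a, f p = H p) {F : ℕ → ℝ → ℂ} (hF : ∀ k, Continuous (F k))
    (hFd : ∀ k, ∀ x ∈ Ioo (0:ℝ) 1, HasDerivAt (F k) (sineCoeff a k fun y => H (x, y)) x)
    (hFρ : ∀ k, ∫ x in (0:ℝ)..1, F k x * (ρ x : ℂ) = 0) (N : ℕ) :
    ∑ k ∈ Finset.range N, ∫ x in (0:ℝ)..1, ‖F k x‖ ^ 2 ≤
      4 * a * (1 + ∫ x in (0:ℝ)..1, ρ x ^ 2) * Hm1xL2yNorm a f ^ 2 := by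
  set S := ∑ k ∈ Finset.range N, ∫ x in (0:ℝ)..1, ‖F k x‖ ^ 2 with hS
  set L := 2 * a * (1 + ∫ x in (0:ℝ)..1, ρ x ^ 2) with hL
  have hρ0 : 0 ≤ ∫ x in (0:ℝ)..1, ρ x ^ 2 :=
    intervalIntegral.integral_nonneg zero_le_one fun _ _ => sq_nonneg _
  have hL0 : 0 < L := by positivity
  have hS0 : 0 ≤ S := Finset.sum_nonneg fun k _ =>
    intervalIntegral.integral_nonneg zero_le_one fun _ _ => sq_nonneg _
  have goal : S ≤ 2 * L * Hm1xL2yNorm a f ^ 2 := by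
    rcases hS0.eq_or_lt with h | hpos
    · rw [← h]
      positivity
    choose φ hφ hφs hlim hlim' using fun k => exists_tendsto_test_functions (hF k)
    have hM : 0 < √(2 * L * S) := Real.sqrt_pos.2 (by positivity)
    have hM2 : √(2 * L * S) ^ 2 = 2 * L * S := Real.sq_sqrt (by positivity)
    have henergy : ∀ᶠ n in atTop, L * ∑ k ∈ Finset.range N, ∫ x in (0:ℝ)..1, ‖φ k n x‖ ^ 2 ≤
        √(2 * L * S) ^ 2 := by
      refine ((tendsto_finsetSum _ fun k _ => hlim' k).const_mul L).eventually_le_const ?_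
      rw [hM2, ← hS]
      nlinarith [mul_pos hL0 hpos]
    have hle : S ≤ √(2 * L * S) * Hm1xL2yNorm a f := by
      have htend := (tendsto_finsetSum (Finset.range N) fun k _ => hlim k).norm
      rw [← Complex.ofReal_sum, Complex.norm_real, ← hS, Real.norm_of_nonneg hS0] at htend
      refine le_of_tendsto htend ?_
      filter_upwards [henergy] with n hn
      refine norm_sum_integral_mul_conj_le ha hρ hRρ hR0 hR1 hH hfH hF hFd hFρ N
        (fun k => hφ k n) (δ := 1 / (n + 4)) (by positivity) ?_ (fun k => hφs k n) hM hn
      exact one_div_le_one_div_of_le four_pos (by linarith [n.cast_nonneg (α := ℝ)])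
    have hsq := pow_le_pow_left₀ hS0 hle 2
    rw [mul_pow, hM2, sq S] at hsq
    exact le_of_mul_le_mul_right (by linarith) hpos
  rw [hL] at goal
  linarith

theorem hasSum_integral_sq_sineCoeff {a : ℝ} (ha : 0 < a) {H : ℝ × ℝ → ℂ} (hH : Continuous H)
    (p q : ℝ) : HasSum (fun k => ∫ x in p..q, ‖sineCoeff a k fun y => H (x, y)‖ ^ 2)
      (a / 2 * ∫ x in p..q, ∫ y in (0:ℝ)..a, ‖H (x, y)‖ ^ 2) := by
  have hsum : ∀ x, HasSum (fun k => ‖sineCoeff a k fun y => H (x, y)‖ ^ 2)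
      (a / 2 * ∫ y in (0:ℝ)..a, ‖H (x, y)‖ ^ 2) := fun x =>
    hasSum_sq_sineCoeff ha (by fun_prop)
  have hc : Continuous fun x => ∫ y in (0:ℝ)..a, ‖H (x, y)‖ ^ 2 :=
    intervalIntegral.continuous_parametric_intervalIntegral_of_continuous' (by fun_prop) _ _
  rw [← intervalIntegral.integral_const_mul]
  refine intervalIntegral.hasSum_integral_of_dominated_convergence
    (fun k x => ‖sineCoeff a k fun y => H (x, y)‖ ^ 2)
    (fun k => ((continuous_sineCoeff a k hH).norm.pow 2).aestronglyMeasurable)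
    (fun k => Eventually.of_forall fun x _ => ?_)
    (Eventually.of_forall fun x _ => (hsum x).summable) ?_
    (Eventually.of_forall fun x _ => hsum x)
  · rw [Real.norm_of_nonneg (sq_nonneg _)]
  · simp_rw [fun x => (hsum x).tsum_eq]
    exact (hc.const_mul _).intervalIntegrable _ _

/-- A primitive of `s` normalized by a weighted mean. -/
theorem exists_primitive_integral_sub_mul_eq_zero {p s : ℝ → ℂ} (hp : Continuous p)
    (hs : Continuous s) {ρ : ℝ → ℝ} (hρ : Continuous ρ) (hρ1 : ∫ x in (0:ℝ)..1, ρ x = 1) :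
    ∃ w : ℝ → ℂ, (∀ x, HasDerivAt w (s x) x) ∧
      ∫ x in (0:ℝ)..1, (p x - w x) * (ρ x : ℂ) = 0 := by
  set S : ℝ → ℂ := fun x => ∫ t in (0:ℝ)..x, s t with hS
  have hSd : ∀ x, HasDerivAt S (s x) x := fun x =>
    intervalIntegral.integral_hasDerivAt_right (hs.intervalIntegrable _ _)
      (hs.stronglyMeasurableAtFilter _ _) hs.continuousAt
  have hSc : Continuous S := continuous_iff_continuousAt.2 fun x => (hSd x).continuousAt
  set c := ∫ x in (0:ℝ)..1, (p x - S x) * (ρ x : ℂ) with hc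
  refine ⟨fun x => S x + c, fun x => (hSd x).add_const c, ?_⟩
  have split : ∀ x, (p x - (S x + c)) * (ρ x : ℂ) = (p x - S x) * (ρ x : ℂ) - c * (ρ x : ℂ) :=
    fun x => by ring
  simp_rw [split]
  rw [intervalIntegral.integral_sub (Continuous.intervalIntegrable (by fun_prop) _ _)
    (Continuous.intervalIntegrable (by fun_prop) _ _), intervalIntegral.integral_const_mul,
    intervalIntegral.integral_ofReal, hρ1, ← hc]
  simp

/-- **Proposition 6.1 of Burq–Zworski:** resolvent observability on a rectangle with
Dirichlet boundary conditions, uniform in the real spectral parameter `z`, where the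
control region is the vertical strip `ω = (α,β) × (0,a)`. -/
theorem rectangle_resolvent_observability
    (a : ℝ) (ha : 0 < a) (α β : ℝ) (hα : 0 ≤ α) (hαβ : α < β) (hβ : β ≤ 1) :
    ∃ C > (0:ℝ), ∀ (z : ℝ) (u : ℝ × ℝ → ℂ),
      ContDiffOn ℝ 2 u (Set.Icc 0 1 ×ˢ Set.Icc 0 a) →
      (∀ p ∈ frontier (Set.Ioo (0:ℝ) 1 ×ˢ Set.Ioo 0 a), u p = 0) →
      ∫ p in Set.Ioo (0:ℝ) 1 ×ˢ Set.Ioo 0 a, ‖u p‖ ^ 2 ≤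
        C * (Hm1xL2yNorm a (fun p => lap2 u p - (z : ℂ) * u p) ^ 2
            + ∫ p in Set.Ioo α β ×ˢ Set.Ioo 0 a, ‖u p‖ ^ 2) := by
  obtain ⟨C, hC, obs⟩ := exists_one_dim_observability hα hαβ hβ
  obtain ⟨R, ρ, hρ, hRρ, hR0, hR1⟩ := exists_smooth_step
  have hρc := hρ.continuous
  have hρ1 : ∫ x in (0:ℝ)..1, ρ x = 1 := by
    rw [intervalIntegral.integral_eq_sub_of_hasDerivAt (fun x _ => hRρ x)
      (hρc.intervalIntegrable _ _), hR0 0 (by norm_num), hR1 1 (by norm_num), sub_zero]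
  set D := 4 * a * (1 + ∫ x in (0:ℝ)..1, ρ x ^ 2) with hD
  have hD0 : 0 ≤ D := by
    have : 0 ≤ ∫ x in (0:ℝ)..1, ρ x ^ 2 :=
      intervalIntegral.integral_nonneg zero_le_one fun _ _ => sq_nonneg _
    positivity
  refine ⟨C * (2 / a * D + 1), by positivity, fun z u hu hbd => ?_⟩
  obtain ⟨U, Ux, Uxx, Uy, Uyy, hU, hUx, hUxx, hUy, hUyy, hUu, hd, hlap⟩ :=
    exists_continuous_partial_derivatives ha hu
  have hUbd : ∀ p ∈ Icc (0:ℝ) 1 ×ˢ Icc 0 a,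
      p.1 = 0 ∨ p.1 = 1 ∨ p.2 = 0 ∨ p.2 = a → U p = 0 := by
    intro p hp h
    rw [hUu p hp]
    refine hbd p ?_
    rw [frontier_prod_eq, frontier_Ioo ha, frontier_Ioo zero_lt_one, closure_Ioo ha.ne,
      closure_Ioo zero_ne_one]
    rcases h with h | h | h | h
    · exact Or.inr ⟨Or.inl h, hp.2⟩
    · exact Or.inr ⟨Or.inr h, hp.2⟩
    · exact Or.inl ⟨hp.1, Or.inl h⟩
    · exact Or.inl ⟨hp.1, Or.inr h⟩
  have hrect : ∀ p q : ℝ, 0 ≤ p → p ≤ q → q ≤ 1 → ∫ z in Ioo p q ×ˢ Ioo 0 a, ‖u z‖ ^ 2 =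
      ∫ x in p..q, ∫ y in (0:ℝ)..a, ‖U (x, y)‖ ^ 2 := by
    intro p q hp hpq hq
    rw [← setIntegral_Ioo_prod_Ioo (H := fun z => ‖U z‖ ^ 2) (by fun_prop) hpq ha.le]
    refine setIntegral_congr_fun (measurableSet_Ioo.prod measurableSet_Ioo) fun z hz => ?_
    simp only [hUu z ⟨⟨hp.trans hz.1.1.le, hz.1.2.le.trans hq⟩, hz.2.1.le, hz.2.2.le⟩]
  set H : ℝ × ℝ → ℂ := fun p => Uxx p + Uyy p - (z : ℂ) * U p with hH
  have hHc : Continuous H := by fun_prop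
  have hfH : ∀ p ∈ Ioo (0:ℝ) 1 ×ˢ Ioo 0 a, lap2 u p - (z : ℂ) * u p = H p := fun p hp => by
    rw [hlap p hp, ← hUu p ⟨Ioo_subset_Icc_self hp.1, Ioo_subset_Icc_self hp.2⟩]
  set v : ℕ → ℝ → ℂ := fun k x => sineCoeff a k fun y => U (x, y) with hv
  set ζ : ℕ → ℝ := fun k => z + dirichletFreq a k ^ 2 with hζ
  have hvc : ∀ k, Continuous (v k) := fun k => continuous_sineCoeff a k hU
  have hpc := fun k => continuous_sineCoeff a k hUx
  choose w hw hwρ using fun k => exists_primitive_integral_sub_mul_eq_zero (hpc k)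
    ((hvc k).const_mul (ζ k : ℂ)) hρc hρ1
  have hwc : ∀ k, Continuous (w k) := fun k =>
    continuous_iff_continuousAt.2 fun x => (hw k x).continuousAt
  set F : ℕ → ℝ → ℂ := fun k x => (sineCoeff a k fun y => Ux (x, y)) - w k x with hF
  have hFc : ∀ k, Continuous (F k) := fun k => (hpc k).sub (hwc k)
  have hFd : ∀ k, ∀ x ∈ Ioo (0:ℝ) 1, HasDerivAt (F k) (sineCoeff a k fun y => H (x, y)) x := by
    intro k x hx
    have h1 := (hasDerivAt_sineCoeff ha k hUx hUxx (fun x hx y hy => (hd x hx y hy).2.1) hx).sub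
      (hw k x)
    have h2 := sineCoeff_second_derivative ha k (h := fun y => U (x, y))
      (h' := fun y => Uy (x, y)) (h'' := fun y => Uyy (x, y)) (by fun_prop) (by fun_prop)
      (by fun_prop) (fun y hy => (hd x hx y hy).2.2.1) (fun y hy => (hd x hx y hy).2.2.2)
      (hUbd _ ⟨Ioo_subset_Icc_self hx, left_mem_Icc.2 ha.le⟩ (by simp))
      (hUbd _ ⟨Ioo_subset_Icc_self hx, right_mem_Icc.2 ha.le⟩ (by simp))
    have h3 : (sineCoeff a k fun y => H (x, y)) = (sineCoeff a k fun y => Uxx (x, y)) +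
        (sineCoeff a k fun y => Uyy (x, y)) - z * v k x := by
      simp only [sineCoeff, hv]
      rw [← intervalIntegral.integral_const_mul, ← intervalIntegral.integral_add
        (Continuous.intervalIntegrable (by fun_prop) _ _)
        (Continuous.intervalIntegrable (by fun_prop) _ _), ← intervalIntegral.integral_sub
        (Continuous.intervalIntegrable (by fun_prop) _ _)
        (Continuous.intervalIntegrable (by fun_prop) _ _)]
      congr 1
      ext y
      simp only [hH]
      ring
    have h4 : (sineCoeff a k fun y => H (x, y)) =
        (sineCoeff a k fun y => Uxx (x, y)) - (ζ k : ℂ) * v k x := by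
      rw [h3, h2]
      simp only [hζ, hv]
      push_cast
      ring
    rw [h4]
    exact h1
  have hv0 : ∀ k, ∀ x, x = 0 ∨ x = 1 → v k x = 0 := by
    intro k x hx
    simp only [hv, sineCoeff]
    rw [intervalIntegral.integral_congr (g := fun _ => 0), intervalIntegral.integral_zero]
    intro y hy
    rw [uIcc_of_le ha.le] at hy
    have hx' : x ∈ Icc (0:ℝ) 1 := by
      rcases hx with rfl | rfl <;> simp
    simp [hUbd (x, y) ⟨hx', hy⟩ (by tauto)]
  have hmode : ∀ k, ∫ x in (0:ℝ)..1, ‖v k x‖ ^ 2 ≤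
      C * ((∫ x in (0:ℝ)..1, ‖F k x‖ ^ 2) + ∫ x in α..β, ‖v k x‖ ^ 2) := fun k =>
    obs (ζ k) (v k) (w k) (F k) (hvc k) (hwc k) (hFc k)
      (fun x hx => by
        simpa [hF] using
          hasDerivAt_sineCoeff ha k hU hUx (fun x hx y hy => (hd x hx y hy).1) hx)
      (fun x _ => hw k x) (hv0 k 0 (Or.inl rfl)) (hv0 k 1 (Or.inr rfl))
  set h := Hm1xL2yNorm a fun p => lap2 u p - (z : ℂ) * u p
  rw [hrect 0 1 le_rfl zero_le_one le_rfl, hrect α β hα hαβ.le hβ]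
  set Y := ∫ x in α..β, ∫ y in (0:ℝ)..a, ‖U (x, y)‖ ^ 2
  have hY : 0 ≤ Y := intervalIntegral.integral_nonneg hαβ.le fun _ _ =>
    intervalIntegral.integral_nonneg ha.le fun _ _ => sq_nonneg _
  have hlim := (hasSum_integral_sq_sineCoeff ha hU 0 1).tendsto_sum_nat
  have hle := le_of_tendsto' hlim (b := C * (D * h ^ 2 + a / 2 * Y)) fun N => by
    refine (Finset.sum_le_sum fun k _ => hmode k).trans ?_
    rw [← Finset.mul_sum, Finset.sum_add_distrib]
    refine mul_le_mul_of_nonneg_left (add_le_add ?_ ?_) hC.le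
    · exact sum_integral_sq_le_sq_Hm1xL2yNorm ha hρ hRρ hR0 hR1 hHc hfH hFc hFd hwρ N
    · exact sum_le_hasSum _ (fun k _ => intervalIntegral.integral_nonneg hαβ.le
        fun _ _ => sq_nonneg _) (hasSum_integral_sq_sineCoeff ha hU α β)
  calc ∫ x in (0:ℝ)..1, ∫ y in (0:ℝ)..a, ‖U (x, y)‖ ^ 2
      = 2 / a * (a / 2 * ∫ x in (0:ℝ)..1, ∫ y in (0:ℝ)..a, ‖U (x, y)‖ ^ 2) := by
        field_simp
    _ ≤ 2 / a * (C * (D * h ^ 2 + a / 2 * Y)) :=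
        mul_le_mul_of_nonneg_left hle (by positivity)
    _ = C * (2 / a * D * h ^ 2 + Y) := by field_simp
    _ ≤ C * (2 / a * D + 1) * (h ^ 2 + Y) := by
        have : 0 ≤ C * (h ^ 2 + 2 / a * D * Y) := by positivity
        linarith
end

section
/- Let a > 0 and let Ω ⊂ ℝ² be the Bunimovich stadium with parameter a. Fix ε ∈ (0, 1/2) and let ω = {(x,y) ∈ Ω : x < ε or x > 1 − ε}. There exists a constant C > 0 such that for every z ∈ ℝ and every function v : ℝ² → ℂ that is twice continuously differentiable on the closure of Ω, vanishes on the boundary of Ω, and satisfies Δv − z v = f on Ω (where Δ = ∂²/∂x² + ∂²/∂y²), one has ∫_Ω |v|² ≤ C (∫_Ω |f|² + ∫_ω |v|²). -/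
open MeasureTheory

/-- The Bunimovich stadium with parameter `a > 0`: the open rectangle `(0,1) × (0,a)`
together with the two open discs of radius `a/2` centered at `(0, a/2)` and `(1, a/2)`. -/
def stadium (a : ℝ) : Set (ℝ × ℝ) :=
  (Set.Ioo 0 1 ×ˢ Set.Ioo 0 a) ∪
    {p | p.1 ^ 2 + (p.2 - a / 2) ^ 2 < (a / 2) ^ 2} ∪
    {p | (p.1 - 1) ^ 2 + (p.2 - a / 2) ^ 2 < (a / 2) ^ 2}

theorem continuous_integrableOn_box {a : ℝ} {F : ℝ × ℝ → ℝ} (hF : Continuous F) :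
    IntegrableOn F (Set.Ioo (0 : ℝ) 1 ×ˢ Set.Ioo 0 a) :=
  (hF.continuousOn.integrableOn_compact (isCompact_Icc.prod isCompact_Icc)).mono_set
    (Set.prod_mono Set.Ioo_subset_Icc_self Set.Ioo_subset_Icc_self)

theorem setIntegral_box_eq {a : ℝ} (ha : 0 < a) {F : ℝ × ℝ → ℝ} (hF : Continuous F) :
    ∫ p in Set.Ioo (0 : ℝ) 1 ×ˢ Set.Ioo 0 a, F p =
      ∫ x in Set.Ioo (0 : ℝ) 1, ∫ y in (0 : ℝ)..a, F (x, y) := by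
  rw [Measure.volume_eq_prod, setIntegral_prod _ (continuous_integrableOn_box hF)]
  simp_rw [intervalIntegral.integral_of_le ha.le, integral_Ioc_eq_integral_Ioo]

theorem setIntegral_box_eq_swap {a : ℝ} {F : ℝ × ℝ → ℝ} (hF : Continuous F) :
    ∫ p in Set.Ioo (0 : ℝ) 1 ×ˢ Set.Ioo 0 a, F p =
      ∫ y in Set.Ioo (0 : ℝ) a, ∫ x in (0 : ℝ)..1, F (x, y) := by
  rw [Measure.volume_eq_prod, ← setIntegral_prod_swap, setIntegral_prod]
  · simp_rw [intervalIntegral.integral_of_le zero_le_one, integral_Ioc_eq_integral_Ioo]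
    rfl
  · exact ((hF.comp continuous_swap).continuousOn.integrableOn_compact
      (isCompact_Icc.prod isCompact_Icc)).mono_set
      (Set.prod_mono Set.Ioo_subset_Icc_self Set.Ioo_subset_Icc_self)

/-- Divergence theorem on a rectangle for a field whose normal component vanishes on the sides. -/
theorem setIntegral_box_divergence_eq_zero {a : ℝ} (ha : 0 < a) {P Px Q Qy : ℝ × ℝ → ℝ}
    (hP : Continuous P) (hPx : Continuous Px) (hQ : Continuous Q) (hQy : Continuous Qy)
    (hdP : ∀ x ∈ Set.Ioo (0 : ℝ) 1, ∀ y ∈ Set.Ioo 0 a,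
      HasDerivAt (fun x' => P (x', y)) (Px (x, y)) x)
    (hdQ : ∀ x ∈ Set.Ioo (0 : ℝ) 1, ∀ y ∈ Set.Ioo 0 a,
      HasDerivAt (fun y' => Q (x, y')) (Qy (x, y)) y)
    (hP0 : ∀ y ∈ Set.Ioo 0 a, P (0, y) = 0) (hP1 : ∀ y ∈ Set.Ioo 0 a, P (1, y) = 0)
    (hQ0 : ∀ x ∈ Set.Ioo (0 : ℝ) 1, Q (x, 0) = 0)
    (hQa : ∀ x ∈ Set.Ioo (0 : ℝ) 1, Q (x, a) = 0) :
    ∫ p in Set.Ioo (0 : ℝ) 1 ×ˢ Set.Ioo 0 a, (Px p + Qy p) = 0 := by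
  rw [integral_add (continuous_integrableOn_box hPx) (continuous_integrableOn_box hQy),
    setIntegral_box_eq_swap hPx, setIntegral_box_eq ha hQy,
    setIntegral_eq_zero_of_forall_eq_zero, setIntegral_eq_zero_of_forall_eq_zero, add_zero]
  · intro x hx
    rw [intervalIntegral.integral_eq_sub_of_hasDerivAt_of_le ha.le
      (f := fun y => Q (x, y)) (by fun_prop) (hdQ x hx)
      (Continuous.intervalIntegrable (by fun_prop) _ _), hQ0 x hx, hQa x hx, sub_zero]
  · intro y hy
    rw [intervalIntegral.integral_eq_sub_of_hasDerivAt_of_le zero_le_one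
      (f := fun x => P (x, y)) (by fun_prop) (fun x hx => hdP x hx y hy)
      (Continuous.intervalIntegrable (by fun_prop) _ _), hP0 y hy, hP1 y hy, sub_zero]

theorem sq_integral_le_integral_sq_s7 {k : ℝ → ℝ} (hk : Continuous k) {x : ℝ}
    (hx : x ∈ Set.Icc (0 : ℝ) 1) :
    (∫ s in (0 : ℝ)..x, k s) ^ 2 ≤ ∫ s in (0 : ℝ)..1, k s ^ 2 := by
  set m := ∫ s in (0 : ℝ)..x, k s with hm
  have h1 : 0 ≤ ∫ s in (0 : ℝ)..x, (k s - m) ^ 2 :=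
    intervalIntegral.integral_nonneg hx.1 fun _ _ => sq_nonneg _
  have h2 : ∫ s in (0 : ℝ)..x, (k s - m) ^ 2 =
      (∫ s in (0 : ℝ)..x, k s ^ 2) - 2 * m * m + x * m ^ 2 := by
    have : ∀ s, (k s - m) ^ 2 = k s ^ 2 - 2 * m * k s + m ^ 2 := fun s => by ring
    simp_rw [this]
    rw [intervalIntegral.integral_add, intervalIntegral.integral_sub,
      intervalIntegral.integral_const_mul, intervalIntegral.integral_const, ← hm]
    · simp
    all_goals exact Continuous.intervalIntegrable (by fun_prop) _ _
  have h3 : ∫ s in (0 : ℝ)..x, k s ^ 2 ≤ ∫ s in (0 : ℝ)..1, k s ^ 2 :=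
    intervalIntegral.integral_mono_interval le_rfl hx.1 hx.2
      (Filter.Eventually.of_forall fun _ => sq_nonneg _)
      (Continuous.intervalIntegrable (by fun_prop) _ _)
  nlinarith [hx.2, sq_nonneg m]

theorem setIntegral_box_sq_primitive_le {a : ℝ} {k : ℝ × ℝ → ℝ} (hk : Continuous k) :
    ∫ p in Set.Ioo (0 : ℝ) 1 ×ˢ Set.Ioo 0 a, (∫ s in (0 : ℝ)..p.1, k (s, p.2)) ^ 2 ≤
      ∫ p in Set.Ioo (0 : ℝ) 1 ×ˢ Set.Ioo 0 a, k p ^ 2 := by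
  have hK : Continuous fun p : ℝ × ℝ => ∫ s in (0 : ℝ)..p.1, k (s, p.2) :=
    intervalIntegral.continuous_parametric_intervalIntegral_of_continuous
      (by simp only [Function.uncurry_def]; fun_prop) continuous_fst
  have hJ : Continuous fun y : ℝ => ∫ x in (0 : ℝ)..1, k (x, y) ^ 2 :=
    intervalIntegral.continuous_parametric_intervalIntegral_of_continuous
      (by simp only [Function.uncurry_def]; fun_prop) continuous_const
  have hL : Continuous fun y : ℝ => ∫ x in (0 : ℝ)..1, (∫ s in (0 : ℝ)..x, k (s, y)) ^ 2 :=
    intervalIntegral.continuous_parametric_intervalIntegral_of_continuous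
      (f := fun y x => (∫ s in (0 : ℝ)..x, k (s, y)) ^ 2)
      ((continuous_pow 2).comp (hK.comp continuous_swap))
      continuous_const
  rw [setIntegral_box_eq_swap (F := fun p => (∫ s in (0 : ℝ)..p.1, k (s, p.2)) ^ 2) (hK.pow 2),
    setIntegral_box_eq_swap (F := fun p => k p ^ 2) (hk.pow 2)]
  refine setIntegral_mono_on
    ((hL.continuousOn.integrableOn_compact isCompact_Icc).mono_set Set.Ioo_subset_Icc_self)
    ((hJ.continuousOn.integrableOn_compact isCompact_Icc).mono_set Set.Ioo_subset_Icc_self)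
    measurableSet_Ioo fun y _ => ?_
  have hky : Continuous fun s => k (s, y) := by fun_prop
  calc ∫ x in (0 : ℝ)..1, (∫ s in (0 : ℝ)..x, k (s, y)) ^ 2
      ≤ ∫ x in (0 : ℝ)..1, ∫ s in (0 : ℝ)..1, k (s, y) ^ 2 := by
        refine intervalIntegral.integral_mono_on zero_le_one
          (Continuous.intervalIntegrable ?_ _ _)
          (Continuous.intervalIntegrable continuous_const _ _)
          fun x hx => sq_integral_le_integral_sq_s7 hky hx
        have h2 : Continuous fun x : ℝ => (x, y) := by fun_prop
        exact (hK.comp h2).pow 2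
    _ = ∫ x in (0 : ℝ)..1, k (x, y) ^ 2 := by simp

/-- Multiplier estimate, uniform in `z`, for `H = Uxx + Uyy - z U` on a rectangle: `U` satisfies
Dirichlet conditions on the horizontal sides, vanishes to first order on the left side and has
vanishing normal derivative on the right side. The multiplier is `(x - 1) Ux + U / 2`. -/
theorem multiplier_estimate {a : ℝ} (ha : 0 < a) (z : ℝ) {U Ux Uy Uxx Uxy Uyy : ℝ × ℝ → ℝ}
    (hU : Continuous U) (hUx : Continuous Ux) (hUy : Continuous Uy)
    (hUxx : Continuous Uxx) (hUxy : Continuous Uxy) (hUyy : Continuous Uyy)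
    (d1 : ∀ x ∈ Set.Ioo (0 : ℝ) 1, ∀ y ∈ Set.Ioo 0 a,
      HasDerivAt (fun t => U (t, y)) (Ux (x, y)) x)
    (d2 : ∀ x ∈ Set.Ioo (0 : ℝ) 1, ∀ y ∈ Set.Ioo 0 a,
      HasDerivAt (fun t => U (x, t)) (Uy (x, y)) y)
    (d11 : ∀ x ∈ Set.Ioo (0 : ℝ) 1, ∀ y ∈ Set.Ioo 0 a,
      HasDerivAt (fun t => Ux (t, y)) (Uxx (x, y)) x)
    (d12 : ∀ x ∈ Set.Ioo (0 : ℝ) 1, ∀ y ∈ Set.Ioo 0 a,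
      HasDerivAt (fun t => Ux (x, t)) (Uxy (x, y)) y)
    (d21 : ∀ x ∈ Set.Ioo (0 : ℝ) 1, ∀ y ∈ Set.Ioo 0 a,
      HasDerivAt (fun t => Uy (t, y)) (Uxy (x, y)) x)
    (d22 : ∀ x ∈ Set.Ioo (0 : ℝ) 1, ∀ y ∈ Set.Ioo 0 a,
      HasDerivAt (fun t => Uy (x, t)) (Uyy (x, y)) y)
    (hU0 : ∀ y ∈ Set.Ioo 0 a, U (0, y) = 0) (hUx0 : ∀ y ∈ Set.Ioo 0 a, Ux (0, y) = 0)
    (hUy0 : ∀ y ∈ Set.Ioo 0 a, Uy (0, y) = 0) (hUx1 : ∀ y ∈ Set.Ioo 0 a, Ux (1, y) = 0)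
    (hUb : ∀ x ∈ Set.Ioo (0 : ℝ) 1, U (x, 0) = 0) (hUt : ∀ x ∈ Set.Ioo (0 : ℝ) 1, U (x, a) = 0)
    (hUxb : ∀ x ∈ Set.Ioo (0 : ℝ) 1, Ux (x, 0) = 0)
    (hUxt : ∀ x ∈ Set.Ioo (0 : ℝ) 1, Ux (x, a) = 0)
    (hle : ∫ p in Set.Ioo (0 : ℝ) 1 ×ˢ Set.Ioo 0 a, U p ^ 2 ≤
      ∫ p in Set.Ioo (0 : ℝ) 1 ×ˢ Set.Ioo 0 a, Ux p ^ 2) :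
    ∫ p in Set.Ioo (0 : ℝ) 1 ×ˢ Set.Ioo 0 a, Ux p ^ 2 ≤
      5 / 2 * ∫ p in Set.Ioo (0 : ℝ) 1 ×ˢ Set.Ioo 0 a, (Uxx p + Uyy p - z * U p) ^ 2 := by
  have hdiv := setIntegral_box_divergence_eq_zero ha
    (P := fun p => 1 / 2 * ((p.1 - 1) * (Ux p * Ux p - Uy p * Uy p - z * (U p * U p)))
      + 1 / 2 * (U p * Ux p))
    (Px := fun p => 1 / 2 * (1 * (Ux p * Ux p - Uy p * Uy p - z * (U p * U p)) + (p.1 - 1) *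
      ((Uxx p * Ux p + Ux p * Uxx p) - (Uxy p * Uy p + Uy p * Uxy p)
        - z * (Ux p * U p + U p * Ux p))) + 1 / 2 * (Ux p * Ux p + U p * Uxx p))
    (Q := fun p => (p.1 - 1) * (Uy p * Ux p) + 1 / 2 * (Uy p * U p))
    (Qy := fun p => (p.1 - 1) * (Uyy p * Ux p + Uy p * Uxy p)
      + 1 / 2 * (Uyy p * U p + Uy p * Uy p))
    (by fun_prop) (by fun_prop) (by fun_prop) (by fun_prop)
    (fun x hx y hy => ((((hasDerivAt_id x).sub_const 1).mul
        ((((d11 x hx y hy).mul (d11 x hx y hy)).sub ((d21 x hx y hy).mul (d21 x hx y hy))).sub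
          (((d1 x hx y hy).mul (d1 x hx y hy)).const_mul z))).const_mul (1 / 2)).add
        (((d1 x hx y hy).mul (d11 x hx y hy)).const_mul (1 / 2)))
    (fun x hx y hy => (((d22 x hx y hy).mul (d12 x hx y hy)).const_mul (x - 1)).add
        (((d22 x hx y hy).mul (d2 x hx y hy)).const_mul (1 / 2)))
    (fun y hy => by simp [hU0 y hy, hUx0 y hy, hUy0 y hy])
    (fun y hy => by simp [hUx1 y hy])
    (fun x hx => by simp [hUb x hx, hUxb x hx])
    (fun x hx => by simp [hUt x hx, hUxt x hx])
  have hmono : ∫ p in Set.Ioo (0 : ℝ) 1 ×ˢ Set.Ioo 0 a, Ux p ^ 2 ≤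
      ∫ p in Set.Ioo (0 : ℝ) 1 ×ˢ Set.Ioo 0 a,
        ((1 / 4 * Ux p ^ 2 + 1 / 4 * U p ^ 2 + 5 / 4 * (Uxx p + Uyy p - z * U p) ^ 2) +
        ((1 / 2 * (1 * (Ux p * Ux p - Uy p * Uy p - z * (U p * U p)) + (p.1 - 1) *
      ((Uxx p * Ux p + Ux p * Uxx p) - (Uxy p * Uy p + Uy p * Uxy p)
        - z * (Ux p * U p + U p * Ux p))) + 1 / 2 * (Ux p * Ux p + U p * Uxx p)) +
        ((p.1 - 1) * (Uyy p * Ux p + Uy p * Uxy p)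
      + 1 / 2 * (Uyy p * U p + Uy p * Uy p)))) := by
    refine setIntegral_mono_on (continuous_integrableOn_box (by fun_prop))
      (continuous_integrableOn_box (by fun_prop))
      (measurableSet_Ioo.prod measurableSet_Ioo) fun p hp => ?_
    have h0 : 0 < p.1 := hp.1.1
    have h1 : p.1 < 1 := hp.1.2
    set H := Uxx p + Uyy p - z * U p with hH
    have key : 0 ≤ 1 / 4 * Ux p ^ 2 + 1 / 4 * U p ^ 2 + 5 / 4 * H ^ 2
        + ((p.1 - 1) * Ux p + 1 / 2 * U p) * H := by
      have hc : (p.1 - 1) ^ 2 ≤ 1 := by nlinarith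
      have := sq_nonneg (1 / 2 * Ux p + (p.1 - 1) * H)
      have := sq_nonneg (U p + H)
      nlinarith [mul_le_mul_of_nonneg_right hc (sq_nonneg H)]
    rw [hH] at key ⊢
    nlinarith [key]
  rw [integral_add (continuous_integrableOn_box (by fun_prop))
    (continuous_integrableOn_box (by fun_prop)), hdiv,
    integral_add (continuous_integrableOn_box (by fun_prop))
    (continuous_integrableOn_box (by fun_prop)),
    integral_add (continuous_integrableOn_box (by fun_prop))
    (continuous_integrableOn_box (by fun_prop)), integral_const_mul, integral_const_mul,
    integral_const_mul] at hmono
  linarith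

theorem hasDerivAt_primitive_of_hasDerivAt {a : ℝ} {k ky : ℝ × ℝ → ℝ} (hk : Continuous k)
    (hky : Continuous ky)
    (hd : ∀ x ∈ Set.Ioo (0 : ℝ) 1, ∀ y ∈ Set.Ioo 0 a,
      HasDerivAt (fun t => k (x, t)) (ky (x, y)) y) :
    ∀ x ∈ Set.Ioo (0 : ℝ) 1, ∀ y ∈ Set.Ioo 0 a,
      HasDerivAt (fun t => ∫ s in (0 : ℝ)..x, k (s, t)) (∫ s in (0 : ℝ)..x, ky (s, y)) y := by
  intro x hx y hy
  obtain ⟨M, hM⟩ := ((isCompact_Icc (a := (0 : ℝ)) (b := 1)).prod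
    (isCompact_Icc (a := 0) (b := a))).exists_bound_of_continuousOn hky.continuousOn
  refine (intervalIntegral.hasDerivAt_integral_of_dominated_loc_of_deriv_le
    (F := fun t s => k (s, t)) (F' := fun t s => ky (s, t)) (bound := fun _ => M)
    (Ioo_mem_nhds hy.1 hy.2) (Filter.Eventually.of_forall fun t => ?_) ?_ ?_ ?_ ?_ ?_).2
  · exact Continuous.aestronglyMeasurable (by fun_prop)
  · exact Continuous.intervalIntegrable (by fun_prop) _ _
  · exact Continuous.aestronglyMeasurable (by fun_prop)
  · refine Filter.Eventually.of_forall fun s hs t ht => ?_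
    rw [Set.uIoc_of_le hx.1.le] at hs
    exact hM (s, t) ⟨⟨hs.1.le, hs.2.trans hx.2.le⟩, Set.Ioo_subset_Icc_self ht⟩
  · exact Continuous.intervalIntegrable (by fun_prop) _ _
  · refine Filter.Eventually.of_forall fun s hs t ht => ?_
    rw [Set.uIoc_of_le hx.1.le] at hs
    exact hd s ⟨hs.1, hs.2.trans_lt hx.2⟩ t ht

/-- Interior estimate for `v` on a rectangle, uniform in `z`, obtained by applying the multiplier
estimate to the horizontal primitive of `χ v`. -/
theorem cutoff_estimate {a : ℝ} (ha : 0 < a) (z : ℝ) {χ χ₁ χ₂ : ℝ → ℝ}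
    (hχ₂ : Continuous χ₂) (hdχ : ∀ x, HasDerivAt χ (χ₁ x) x)
    (hdχ₁ : ∀ x, HasDerivAt χ₁ (χ₂ x) x) (hχ0 : χ 0 = 0) (hχ1 : χ 1 = 0) (hχ₁0 : χ₁ 0 = 0)
    {v vx vy vxx vyy : ℝ × ℝ → ℝ}
    (hv : Continuous v) (hvx : Continuous vx) (hvy : Continuous vy)
    (hvxx : Continuous vxx) (hvyy : Continuous vyy)
    (d1 : ∀ x ∈ Set.Ioo (0 : ℝ) 1, ∀ y ∈ Set.Ioo 0 a,
      HasDerivAt (fun t => v (t, y)) (vx (x, y)) x)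
    (d2 : ∀ x ∈ Set.Ioo (0 : ℝ) 1, ∀ y ∈ Set.Ioo 0 a,
      HasDerivAt (fun t => v (x, t)) (vy (x, y)) y)
    (d11 : ∀ x ∈ Set.Ioo (0 : ℝ) 1, ∀ y ∈ Set.Ioo 0 a,
      HasDerivAt (fun t => vx (t, y)) (vxx (x, y)) x)
    (d22 : ∀ x ∈ Set.Ioo (0 : ℝ) 1, ∀ y ∈ Set.Ioo 0 a,
      HasDerivAt (fun t => vy (x, t)) (vyy (x, y)) y)
    (hvb : ∀ x ∈ Set.Ioo (0 : ℝ) 1, v (x, 0) = 0) (hvt : ∀ x ∈ Set.Ioo (0 : ℝ) 1, v (x, a) = 0) :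
    ∫ p in Set.Ioo (0 : ℝ) 1 ×ˢ Set.Ioo 0 a, (χ p.1 * v p) ^ 2 ≤
      20 * ∫ p in Set.Ioo (0 : ℝ) 1 ×ˢ Set.Ioo 0 a,
        ((χ p.1 * (vxx p + vyy p - z * v p)) ^ 2 + (χ₁ p.1 * v p) ^ 2 + (χ₂ p.1 * v p) ^ 2) := by
  have hχ : Continuous χ := continuous_iff_continuousAt.2 fun x => (hdχ x).continuousAt
  have hχ₁ : Continuous χ₁ := continuous_iff_continuousAt.2 fun x => (hdχ₁ x).continuousAt
  have hprim : ∀ k : ℝ × ℝ → ℝ, Continuous k →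
      Continuous fun p : ℝ × ℝ => ∫ s in (0 : ℝ)..p.1, k (s, p.2) := fun k hk =>
    intervalIntegral.continuous_parametric_intervalIntegral_of_continuous
      (by simp only [Function.uncurry_def]; fun_prop) continuous_fst
  have hprimd : ∀ k : ℝ × ℝ → ℝ, Continuous k → ∀ x y : ℝ,
      HasDerivAt (fun t : ℝ => ∫ s in (0 : ℝ)..t, k (s, y)) (k (x, y)) x := fun k hk x y =>
    (Continuous.integral_hasStrictDerivAt (f := fun s => k (s, y)) (by fun_prop) 0 x).hasDerivAt
  have hint : ∀ {k : ℝ → ℝ} {x : ℝ}, Continuous k → IntervalIntegrable k volume 0 x :=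
    fun hk => hk.intervalIntegrable _ _
  have hcv : Continuous fun p : ℝ × ℝ => χ p.1 * v p := by fun_prop
  have hcvy : Continuous fun p : ℝ × ℝ => χ p.1 * vy p := by fun_prop
  have hcvyy : Continuous fun p : ℝ × ℝ => χ p.1 * vyy p := by fun_prop
  have hk : Continuous fun p : ℝ × ℝ =>
    χ p.1 * (vxx p + vyy p - z * v p) - χ₂ p.1 * v p := by fun_prop
  have hK := hprim _ hk
  have hmain := multiplier_estimate ha z
    (U := fun p => ∫ s in (0 : ℝ)..p.1, χ s * v (s, p.2))
    (Ux := fun p => χ p.1 * v p)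
    (Uy := fun p => ∫ s in (0 : ℝ)..p.1, χ s * vy (s, p.2))
    (Uxx := fun p => χ₁ p.1 * v p + χ p.1 * vx p)
    (Uxy := fun p => χ p.1 * vy p)
    (Uyy := fun p => ∫ s in (0 : ℝ)..p.1, χ s * vyy (s, p.2))
    (hprim _ hcv) hcv (hprim _ hcvy) (by fun_prop) hcvy (hprim _ hcvyy)
    (fun x _ y _ => hprimd _ hcv x y)
    (hasDerivAt_primitive_of_hasDerivAt hcv hcvy fun x hx y hy => (d2 x hx y hy).const_mul (χ x))
    (fun x hx y hy => (hdχ x).mul (d1 x hx y hy))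
    (fun x hx y hy => (d2 x hx y hy).const_mul (χ x))
    (fun x _ y _ => hprimd _ hcvy x y)
    (hasDerivAt_primitive_of_hasDerivAt hcvy hcvyy fun x hx y hy => (d22 x hx y hy).const_mul (χ x))
    (by simp) (by simp [hχ0]) (by simp) (by simp [hχ1])
    (fun x hx => by
      refine (intervalIntegral.integral_congr_ae
        (Filter.Eventually.of_forall fun s hs => ?_)).trans
        (intervalIntegral.integral_zero (a := 0) (b := x))
      rw [Set.uIoc_of_le hx.1.le] at hs
      simp [hvb s ⟨hs.1, hs.2.trans_lt hx.2⟩])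
    (fun x hx => by
      refine (intervalIntegral.integral_congr_ae
        (Filter.Eventually.of_forall fun s hs => ?_)).trans
        (intervalIntegral.integral_zero (a := 0) (b := x))
      rw [Set.uIoc_of_le hx.1.le] at hs
      simp [hvt s ⟨hs.1, hs.2.trans_lt hx.2⟩])
    (fun x hx => by simp [hvb x hx]) (fun x hx => by simp [hvt x hx])
    (setIntegral_box_sq_primitive_le hcv)
  have hH : ∫ p in Set.Ioo (0 : ℝ) 1 ×ˢ Set.Ioo 0 a,
      ((χ₁ p.1 * v p + χ p.1 * vx p) + (∫ s in (0 : ℝ)..p.1, χ s * vyy (s, p.2))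
        - z * ∫ s in (0 : ℝ)..p.1, χ s * v (s, p.2)) ^ 2 ≤
      ∫ p in Set.Ioo (0 : ℝ) 1 ×ˢ Set.Ioo 0 a,
        (2 * (∫ s in (0 : ℝ)..p.1, (χ s * (vxx (s, p.2) + vyy (s, p.2) - z * v (s, p.2))
          - χ₂ s * v (s, p.2))) ^ 2 + 8 * (χ₁ p.1 * v p) ^ 2) := by
    have := hprim _ hcv
    have := hprim _ hcvyy
    refine setIntegral_mono_on (continuous_integrableOn_box (by fun_prop))
      (continuous_integrableOn_box (by fun_prop))
      (measurableSet_Ioo.prod measurableSet_Ioo) fun p hp => ?_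
    obtain ⟨x, y⟩ := p
    obtain ⟨hx, hy⟩ : x ∈ Set.Ioo (0 : ℝ) 1 ∧ y ∈ Set.Ioo 0 a := hp
    have e1 : ∫ s in (0 : ℝ)..x, (χ s * vxx (s, y) - χ₂ s * v (s, y)) =
        χ x * vx (x, y) - χ₁ x * v (x, y) := by
      rw [intervalIntegral.integral_eq_sub_of_hasDerivAt_of_le hx.1.le
        (f := fun s => χ s * vx (s, y) - χ₁ s * v (s, y)) (by fun_prop)
        (fun s hs => ?_) (hint (by fun_prop))]
      · simp [hχ0, hχ₁0]
      · have hs' : s ∈ Set.Ioo (0 : ℝ) 1 := ⟨hs.1, hs.2.trans hx.2⟩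
        refine (((hdχ s).mul (d11 s hs' y hy)).sub
          ((hdχ₁ s).mul (d1 s hs' y hy))).congr_deriv ?_
        ring
    have e2 : ∫ s in (0 : ℝ)..x, (χ s * (vxx (s, y) + vyy (s, y) - z * v (s, y))
          - χ₂ s * v (s, y)) = (χ x * vx (x, y) - χ₁ x * v (x, y)) +
          (∫ s in (0 : ℝ)..x, χ s * vyy (s, y)) - z * ∫ s in (0 : ℝ)..x, χ s * v (s, y) := by
      rw [← e1, ← intervalIntegral.integral_const_mul, ← intervalIntegral.integral_add
        (hint (by fun_prop)) (hint (by fun_prop)), ← intervalIntegral.integral_sub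
        (hint (by fun_prop)) (hint (by fun_prop))]
      exact intervalIntegral.integral_congr fun s _ => by ring
    simp only [e2]
    generalize (∫ s in (0 : ℝ)..x, χ s * vyy (s, y)) = A
    generalize (∫ s in (0 : ℝ)..x, χ s * v (s, y)) = B
    nlinarith [sq_nonneg (χ x * vx (x, y) - χ₁ x * v (x, y) + A - z * B - 2 * (χ₁ x * v (x, y)))]
  have hKle := setIntegral_box_sq_primitive_le (a := a) hk
  have hk2 : ∫ p in Set.Ioo (0 : ℝ) 1 ×ˢ Set.Ioo 0 a,
        (χ p.1 * (vxx p + vyy p - z * v p) - χ₂ p.1 * v p) ^ 2 ≤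
      ∫ p in Set.Ioo (0 : ℝ) 1 ×ˢ Set.Ioo 0 a,
        (2 * (χ p.1 * (vxx p + vyy p - z * v p)) ^ 2 + 2 * (χ₂ p.1 * v p) ^ 2) := by
    refine setIntegral_mono_on (continuous_integrableOn_box (by fun_prop))
      (continuous_integrableOn_box (by fun_prop))
      (measurableSet_Ioo.prod measurableSet_Ioo) fun p _ => ?_
    nlinarith [sq_nonneg (χ p.1 * (vxx p + vyy p - z * v p) + χ₂ p.1 * v p)]
  have i1 : 0 ≤ ∫ p in Set.Ioo (0 : ℝ) 1 ×ˢ Set.Ioo 0 a,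
      (χ p.1 * (vxx p + vyy p - z * v p)) ^ 2 := integral_nonneg fun _ => sq_nonneg _
  have i2 : 0 ≤ ∫ p in Set.Ioo (0 : ℝ) 1 ×ˢ Set.Ioo 0 a, (χ₂ p.1 * v p) ^ 2 :=
    integral_nonneg fun _ => sq_nonneg _
  rw [integral_add (continuous_integrableOn_box (by fun_prop))
    (continuous_integrableOn_box (by fun_prop)), integral_const_mul, integral_const_mul] at hH hk2
  rw [integral_add (continuous_integrableOn_box (by fun_prop))
    (continuous_integrableOn_box (by fun_prop)), integral_add
    (continuous_integrableOn_box (by fun_prop)) (continuous_integrableOn_box (by fun_prop))]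
  linarith

/-- The nearest-point retraction onto the closed rectangle `[0,1] × [0,a]`. -/
def boxRetract (a : ℝ) (p : ℝ × ℝ) : ℝ × ℝ := (max 0 (min 1 p.1), max 0 (min a p.2))

theorem boxRetract_mem {a : ℝ} (ha : 0 < a) (p : ℝ × ℝ) :
    boxRetract a p ∈ Set.Icc (0 : ℝ) 1 ×ˢ Set.Icc 0 a :=
  ⟨⟨le_max_left _ _, max_le zero_le_one (min_le_left _ _)⟩,
    ⟨le_max_left _ _, max_le ha.le (min_le_left _ _)⟩⟩

theorem boxRetract_of_mem {a x y : ℝ} (hx : x ∈ Set.Icc (0 : ℝ) 1) (hy : y ∈ Set.Icc 0 a) :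
    boxRetract a (x, y) = (x, y) := by
  simp [boxRetract, hx.1, hx.2, hy.1, hy.2]

theorem continuous_comp_boxRetract {a : ℝ} (ha : 0 < a) {u : ℝ × ℝ → ℝ}
    (hu : ContinuousOn u (Set.Icc (0 : ℝ) 1 ×ˢ Set.Icc 0 a)) :
    Continuous fun p => u (boxRetract a p) :=
  hu.comp_continuous (by unfold boxRetract; fun_prop) (boxRetract_mem ha)

theorem hasDerivAt_fst_comp_boxRetract {a x y : ℝ} {u u' : ℝ × ℝ → ℝ}
    (hx : x ∈ Set.Ioo (0 : ℝ) 1) (hy : y ∈ Set.Ioo 0 a)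
    (h : HasDerivAt (fun t => u (t, y)) (u' (x, y)) x) :
    HasDerivAt (fun t => u (boxRetract a (t, y))) (u' (boxRetract a (x, y))) x := by
  rw [boxRetract_of_mem (Set.Ioo_subset_Icc_self hx) (Set.Ioo_subset_Icc_self hy)]
  refine h.congr_of_eventuallyEq ?_
  filter_upwards [Ioo_mem_nhds hx.1 hx.2] with t ht
  rw [boxRetract_of_mem (Set.Ioo_subset_Icc_self ht) (Set.Ioo_subset_Icc_self hy)]

theorem hasDerivAt_snd_comp_boxRetract {a x y : ℝ} {u u' : ℝ × ℝ → ℝ}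
    (hx : x ∈ Set.Ioo (0 : ℝ) 1) (hy : y ∈ Set.Ioo 0 a)
    (h : HasDerivAt (fun t => u (x, t)) (u' (x, y)) y) :
    HasDerivAt (fun t => u (boxRetract a (x, t))) (u' (boxRetract a (x, y))) y := by
  rw [boxRetract_of_mem (Set.Ioo_subset_Icc_self hx) (Set.Ioo_subset_Icc_self hy)]
  refine h.congr_of_eventuallyEq ?_
  filter_upwards [Ioo_mem_nhds hy.1 hy.2] with t ht
  rw [boxRetract_of_mem (Set.Ioo_subset_Icc_self hx) (Set.Ioo_subset_Icc_self ht)]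

theorem cutoff_estimate_of_continuousOn {a : ℝ} (ha : 0 < a) (z : ℝ) {χ χ₁ χ₂ : ℝ → ℝ}
    (hχ₂ : Continuous χ₂) (hdχ : ∀ x, HasDerivAt χ (χ₁ x) x)
    (hdχ₁ : ∀ x, HasDerivAt χ₁ (χ₂ x) x) (hχ0 : χ 0 = 0) (hχ1 : χ 1 = 0) (hχ₁0 : χ₁ 0 = 0)
    {v vx vy vxx vyy : ℝ × ℝ → ℝ}
    (hv : ContinuousOn v (Set.Icc (0 : ℝ) 1 ×ˢ Set.Icc 0 a))
    (hvx : ContinuousOn vx (Set.Icc (0 : ℝ) 1 ×ˢ Set.Icc 0 a))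
    (hvy : ContinuousOn vy (Set.Icc (0 : ℝ) 1 ×ˢ Set.Icc 0 a))
    (hvxx : ContinuousOn vxx (Set.Icc (0 : ℝ) 1 ×ˢ Set.Icc 0 a))
    (hvyy : ContinuousOn vyy (Set.Icc (0 : ℝ) 1 ×ˢ Set.Icc 0 a))
    (d1 : ∀ x ∈ Set.Ioo (0 : ℝ) 1, ∀ y ∈ Set.Ioo 0 a,
      HasDerivAt (fun t => v (t, y)) (vx (x, y)) x)
    (d2 : ∀ x ∈ Set.Ioo (0 : ℝ) 1, ∀ y ∈ Set.Ioo 0 a,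
      HasDerivAt (fun t => v (x, t)) (vy (x, y)) y)
    (d11 : ∀ x ∈ Set.Ioo (0 : ℝ) 1, ∀ y ∈ Set.Ioo 0 a,
      HasDerivAt (fun t => vx (t, y)) (vxx (x, y)) x)
    (d22 : ∀ x ∈ Set.Ioo (0 : ℝ) 1, ∀ y ∈ Set.Ioo 0 a,
      HasDerivAt (fun t => vy (x, t)) (vyy (x, y)) y)
    (hvb : ∀ x ∈ Set.Ioo (0 : ℝ) 1, v (x, 0) = 0) (hvt : ∀ x ∈ Set.Ioo (0 : ℝ) 1, v (x, a) = 0) :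
    ∫ p in Set.Ioo (0 : ℝ) 1 ×ˢ Set.Ioo 0 a, (χ p.1 * v p) ^ 2 ≤
      20 * ∫ p in Set.Ioo (0 : ℝ) 1 ×ˢ Set.Ioo 0 a,
        ((χ p.1 * (vxx p + vyy p - z * v p)) ^ 2 + (χ₁ p.1 * v p) ^ 2 + (χ₂ p.1 * v p) ^ 2) := by
  have key := cutoff_estimate ha z hχ₂ hdχ hdχ₁ hχ0 hχ1 hχ₁0
    (continuous_comp_boxRetract ha hv) (continuous_comp_boxRetract ha hvx)
    (continuous_comp_boxRetract ha hvy) (continuous_comp_boxRetract ha hvxx)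
    (continuous_comp_boxRetract ha hvyy)
    (fun x hx y hy => hasDerivAt_fst_comp_boxRetract hx hy (d1 x hx y hy))
    (fun x hx y hy => hasDerivAt_snd_comp_boxRetract hx hy (d2 x hx y hy))
    (fun x hx y hy => hasDerivAt_fst_comp_boxRetract hx hy (d11 x hx y hy))
    (fun x hx y hy => hasDerivAt_snd_comp_boxRetract hx hy (d22 x hx y hy))
    (fun x hx => by
      rw [boxRetract_of_mem (Set.Ioo_subset_Icc_self hx) ⟨le_rfl, ha.le⟩, hvb x hx])
    (fun x hx => by
      rw [boxRetract_of_mem (Set.Ioo_subset_Icc_self hx) ⟨ha.le, le_rfl⟩, hvt x hx])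
  have hret : ∀ p ∈ Set.Ioo (0 : ℝ) 1 ×ˢ Set.Ioo 0 a, boxRetract a p = p := fun p hp =>
    boxRetract_of_mem (Set.Ioo_subset_Icc_self hp.1) (Set.Ioo_subset_Icc_self hp.2)
  have hm : MeasurableSet (Set.Ioo (0 : ℝ) 1 ×ˢ Set.Ioo 0 a) :=
    measurableSet_Ioo.prod measurableSet_Ioo
  have e1 : ∫ p in Set.Ioo (0 : ℝ) 1 ×ˢ Set.Ioo 0 a, (χ p.1 * v (boxRetract a p)) ^ 2 =
      ∫ p in Set.Ioo (0 : ℝ) 1 ×ˢ Set.Ioo 0 a, (χ p.1 * v p) ^ 2 :=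
    setIntegral_congr_fun hm fun p hp => by simp only [hret p hp]
  have e2 : ∫ p in Set.Ioo (0 : ℝ) 1 ×ˢ Set.Ioo 0 a,
        ((χ p.1 * (vxx (boxRetract a p) + vyy (boxRetract a p) - z * v (boxRetract a p))) ^ 2
          + (χ₁ p.1 * v (boxRetract a p)) ^ 2 + (χ₂ p.1 * v (boxRetract a p)) ^ 2) =
      ∫ p in Set.Ioo (0 : ℝ) 1 ×ˢ Set.Ioo 0 a,
        ((χ p.1 * (vxx p + vyy p - z * v p)) ^ 2 + (χ₁ p.1 * v p) ^ 2 + (χ₂ p.1 * v p) ^ 2) :=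
    setIntegral_congr_fun hm fun p hp => by simp only [hret p hp]
  rwa [e1, e2] at key

theorem cutoff_estimate_complex {a : ℝ} (ha : 0 < a) (z : ℝ) {χ χ₁ χ₂ : ℝ → ℝ}
    (hχ₂ : Continuous χ₂) (hdχ : ∀ x, HasDerivAt χ (χ₁ x) x)
    (hdχ₁ : ∀ x, HasDerivAt χ₁ (χ₂ x) x) (hχ0 : χ 0 = 0) (hχ1 : χ 1 = 0) (hχ₁0 : χ₁ 0 = 0)
    {v vx vy vxx vyy : ℝ × ℝ → ℂ}
    (hv : ContinuousOn v (Set.Icc (0 : ℝ) 1 ×ˢ Set.Icc 0 a))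
    (hvx : ContinuousOn vx (Set.Icc (0 : ℝ) 1 ×ˢ Set.Icc 0 a))
    (hvy : ContinuousOn vy (Set.Icc (0 : ℝ) 1 ×ˢ Set.Icc 0 a))
    (hvxx : ContinuousOn vxx (Set.Icc (0 : ℝ) 1 ×ˢ Set.Icc 0 a))
    (hvyy : ContinuousOn vyy (Set.Icc (0 : ℝ) 1 ×ˢ Set.Icc 0 a))
    (d1 : ∀ x ∈ Set.Ioo (0 : ℝ) 1, ∀ y ∈ Set.Ioo 0 a,
      HasDerivAt (fun t => v (t, y)) (vx (x, y)) x)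
    (d2 : ∀ x ∈ Set.Ioo (0 : ℝ) 1, ∀ y ∈ Set.Ioo 0 a,
      HasDerivAt (fun t => v (x, t)) (vy (x, y)) y)
    (d11 : ∀ x ∈ Set.Ioo (0 : ℝ) 1, ∀ y ∈ Set.Ioo 0 a,
      HasDerivAt (fun t => vx (t, y)) (vxx (x, y)) x)
    (d22 : ∀ x ∈ Set.Ioo (0 : ℝ) 1, ∀ y ∈ Set.Ioo 0 a,
      HasDerivAt (fun t => vy (x, t)) (vyy (x, y)) y)
    (hvb : ∀ x ∈ Set.Ioo (0 : ℝ) 1, v (x, 0) = 0) (hvt : ∀ x ∈ Set.Ioo (0 : ℝ) 1, v (x, a) = 0) :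
    ∫ p in Set.Ioo (0 : ℝ) 1 ×ˢ Set.Ioo 0 a, (χ p.1 * ‖v p‖) ^ 2 ≤
      20 * ∫ p in Set.Ioo (0 : ℝ) 1 ×ˢ Set.Ioo 0 a,
        ((χ p.1 * ‖vxx p + vyy p - z * v p‖) ^ 2 + (χ₁ p.1 * ‖v p‖) ^ 2
          + (χ₂ p.1 * ‖v p‖) ^ 2) := by
  have hχ : Continuous χ := continuous_iff_continuousAt.2 fun x => (hdχ x).continuousAt
  have hχ₁ : Continuous χ₁ := continuous_iff_continuousAt.2 fun x => (hdχ₁ x).continuousAt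
  have part : ∀ ℓ : ℂ →L[ℝ] ℝ,
      ∫ p in Set.Ioo (0 : ℝ) 1 ×ˢ Set.Ioo 0 a, (χ p.1 * ℓ (v p)) ^ 2 ≤
      20 * ∫ p in Set.Ioo (0 : ℝ) 1 ×ˢ Set.Ioo 0 a,
        ((χ p.1 * (ℓ (vxx p) + ℓ (vyy p) - z * ℓ (v p))) ^ 2 + (χ₁ p.1 * ℓ (v p)) ^ 2
          + (χ₂ p.1 * ℓ (v p)) ^ 2) := fun ℓ =>
    cutoff_estimate_of_continuousOn ha z hχ₂ hdχ hdχ₁ hχ0 hχ1 hχ₁0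
      (v := fun p => ℓ (v p)) (vx := fun p => ℓ (vx p)) (vy := fun p => ℓ (vy p))
      (vxx := fun p => ℓ (vxx p)) (vyy := fun p => ℓ (vyy p))
      (ℓ.continuous.comp_continuousOn hv) (ℓ.continuous.comp_continuousOn hvx)
      (ℓ.continuous.comp_continuousOn hvy) (ℓ.continuous.comp_continuousOn hvxx)
      (ℓ.continuous.comp_continuousOn hvyy)
      (fun x hx y hy => ℓ.hasFDerivAt.comp_hasDerivAt x (d1 x hx y hy))
      (fun x hx y hy => ℓ.hasFDerivAt.comp_hasDerivAt y (d2 x hx y hy))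
      (fun x hx y hy => ℓ.hasFDerivAt.comp_hasDerivAt x (d11 x hx y hy))
      (fun x hx y hy => ℓ.hasFDerivAt.comp_hasDerivAt y (d22 x hx y hy))
      (fun x hx => by simp [hvb x hx]) (fun x hx => by simp [hvt x hx])
  have hint : ∀ {F : ℝ × ℝ → ℝ}, ContinuousOn F (Set.Icc (0 : ℝ) 1 ×ˢ Set.Icc 0 a) →
      IntegrableOn F (Set.Ioo (0 : ℝ) 1 ×ˢ Set.Ioo 0 a) := fun hF =>
    (hF.integrableOn_compact (isCompact_Icc.prod isCompact_Icc)).mono_set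
      (Set.prod_mono Set.Ioo_subset_Icc_self Set.Ioo_subset_Icc_self)
  have hre := part Complex.reCLM
  have him := part Complex.imCLM
  have hsum := add_le_add hre him
  simp only [Complex.reCLM_apply, Complex.imCLM_apply] at hsum
  rw [← mul_add, ← integral_add (hint (by fun_prop)) (hint (by fun_prop)),
    ← integral_add (hint (by fun_prop)) (hint (by fun_prop))] at hsum
  have e1 : ∀ p, (χ p.1 * ‖v p‖) ^ 2 = (χ p.1 * (v p).re) ^ 2 + (χ p.1 * (v p).im) ^ 2 :=
    fun p => by
      rw [mul_pow, Complex.sq_norm, Complex.normSq_apply]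
      ring
  have e2 : ∀ p, (χ p.1 * ‖vxx p + vyy p - z * v p‖) ^ 2 + (χ₁ p.1 * ‖v p‖) ^ 2
      + (χ₂ p.1 * ‖v p‖) ^ 2 =
      (χ p.1 * ((vxx p).re + (vyy p).re - z * (v p).re)) ^ 2 + (χ₁ p.1 * (v p).re) ^ 2
        + (χ₂ p.1 * (v p).re) ^ 2 +
      ((χ p.1 * ((vxx p).im + (vyy p).im - z * (v p).im)) ^ 2 + (χ₁ p.1 * (v p).im) ^ 2
        + (χ₂ p.1 * (v p).im) ^ 2) := fun p => by
    simp only [mul_pow, Complex.sq_norm, Complex.normSq_apply, Complex.sub_re, Complex.sub_im,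
      Complex.add_re, Complex.add_im, Complex.re_ofReal_mul, Complex.im_ofReal_mul]
    ring
  simpa only [e1, e2] using hsum

theorem hasDerivAt_fst_of_hasFDerivAt {u : ℝ × ℝ → ℂ} {L : ℝ × ℝ →L[ℝ] ℂ} {x y : ℝ}
    (h : HasFDerivAt u L (x, y)) : HasDerivAt (fun t => u (t, y)) (L (1, 0)) x :=
  HasFDerivAt.comp_hasDerivAt (f := fun t => (t, y)) x h
    ((hasDerivAt_id x).prodMk (hasDerivAt_const x y))

theorem hasDerivAt_snd_of_hasFDerivAt {u : ℝ × ℝ → ℂ} {L : ℝ × ℝ →L[ℝ] ℂ} {x y : ℝ}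
    (h : HasFDerivAt u L (x, y)) : HasDerivAt (fun t => u (x, t)) (L (0, 1)) y :=
  HasFDerivAt.comp_hasDerivAt (f := fun t => (x, t)) y h
    ((hasDerivAt_const y x).prodMk (hasDerivAt_id y))

theorem hasFDerivAt_fderivWithin_of_isOpen {u : ℝ × ℝ → ℂ} {S K : Set (ℝ × ℝ)} (hS : IsOpen S)
    (hSK : S ⊆ K) (hu : ContDiffOn ℝ 1 u K) {p : ℝ × ℝ} (hp : p ∈ S) :
    HasFDerivAt u (fderivWithin ℝ u K p) p :=
  ((hu.differentiableOn one_ne_zero) p (hSK hp)).hasFDerivWithinAt.hasFDerivAt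
    (Filter.mem_of_superset (hS.mem_nhds hp) hSK)

/-- The second-order partial derivatives of a function that is `C²` on a set `K` with unique
differentials extend continuously from any open subset of `K` to `K`. -/
theorem exists_partial_derivs {v : ℝ × ℝ → ℂ} {S K : Set (ℝ × ℝ)} (hS : IsOpen S) (hSK : S ⊆ K)
    (hK : UniqueDiffOn ℝ K) (hv : ContDiffOn ℝ 2 v K) :
    ∃ vx vy vxx vyy : ℝ × ℝ → ℂ, ContinuousOn vx K ∧ ContinuousOn vy K ∧ ContinuousOn vxx K ∧
      ContinuousOn vyy K ∧ ∀ x y, (x, y) ∈ S →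
        HasDerivAt (fun t => v (t, y)) (vx (x, y)) x ∧
        HasDerivAt (fun t => v (x, t)) (vy (x, y)) y ∧
        HasDerivAt (fun t => vx (t, y)) (vxx (x, y)) x ∧
        HasDerivAt (fun t => vy (x, t)) (vyy (x, y)) y ∧
        lap2 v (x, y) = vxx (x, y) + vyy (x, y) := by
  have hD : ContDiffOn ℝ 1 (fderivWithin ℝ v K) K := hv.fderivWithin hK (by norm_num)
  have hDe : ∀ e : ℝ × ℝ, ContDiffOn ℝ 1 (fun p => fderivWithin ℝ v K p e) K := fun e =>
    hD.clm_apply contDiffOn_const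
  have hDDe : ∀ e : ℝ × ℝ,
      ContinuousOn (fun p => fderivWithin ℝ (fun q => fderivWithin ℝ v K q e) K p e) K := fun e =>
    ((hDe e).continuousOn_fderivWithin hK le_rfl).clm_apply continuousOn_const
  have heq : ∀ p ∈ S, fderivWithin ℝ v K p = fderiv ℝ v p := fun p hp =>
    ((hasFDerivAt_fderivWithin_of_isOpen hS hSK (hv.of_le (by norm_num)) hp).fderiv).symm
  have heq2 : ∀ e : ℝ × ℝ, ∀ p ∈ S, fderivWithin ℝ (fun q => fderivWithin ℝ v K q e) K p =
      fderiv ℝ (fun q => fderiv ℝ v q e) p := by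
    intro e p hp
    rw [← (hasFDerivAt_fderivWithin_of_isOpen hS hSK (hDe e) hp).fderiv]
    refine Filter.EventuallyEq.fderiv_eq ?_
    filter_upwards [hS.mem_nhds hp] with q hq
    rw [heq q hq]
  refine ⟨_, _, _, _, (hDe (1, 0)).continuousOn, (hDe (0, 1)).continuousOn, hDDe (1, 0),
    hDDe (0, 1), fun x y hp => ⟨?_, ?_, ?_, ?_, ?_⟩⟩
  · exact hasDerivAt_fst_of_hasFDerivAt
      (hasFDerivAt_fderivWithin_of_isOpen hS hSK (hv.of_le (by norm_num)) hp)
  · exact hasDerivAt_snd_of_hasFDerivAt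
      (hasFDerivAt_fderivWithin_of_isOpen hS hSK (hv.of_le (by norm_num)) hp)
  · exact hasDerivAt_fst_of_hasFDerivAt
      (hasFDerivAt_fderivWithin_of_isOpen hS hSK (hDe (1, 0)) hp)
  · exact hasDerivAt_snd_of_hasFDerivAt
      (hasFDerivAt_fderivWithin_of_isOpen hS hSK (hDe (0, 1)) hp)
  · rw [lap2, heq2 _ _ hp, heq2 _ _ hp]

theorem isOpen_stadium (a : ℝ) : IsOpen (stadium a) :=
  ((isOpen_Ioo.prod isOpen_Ioo).union (isOpen_lt (by fun_prop) (by fun_prop))).union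
    (isOpen_lt (by fun_prop) (by fun_prop))

theorem isCompact_closure_stadium {a : ℝ} (ha : 0 < a) : IsCompact (closure (stadium a)) := by
  refine ((isCompact_Icc (a := -a) (b := 1 + a)).prod
    (isCompact_Icc (a := 0) (b := a))).closure_of_subset ?_
  rintro ⟨x, y⟩ ((h | h) | h)
  · obtain ⟨hx, hy⟩ : x ∈ Set.Ioo (0 : ℝ) 1 ∧ y ∈ Set.Ioo 0 a := h
    exact ⟨⟨by linarith [hx.1], by linarith [hx.2]⟩, Set.Ioo_subset_Icc_self hy⟩
  · have h : x ^ 2 + (y - a / 2) ^ 2 < (a / 2) ^ 2 := h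
    exact ⟨⟨by simp only; nlinarith, by simp only; nlinarith⟩,
      ⟨by simp only; nlinarith, by simp only; nlinarith⟩⟩
  · have h : (x - 1) ^ 2 + (y - a / 2) ^ 2 < (a / 2) ^ 2 := h
    exact ⟨⟨by simp only; nlinarith, by simp only; nlinarith⟩,
      ⟨by simp only; nlinarith, by simp only; nlinarith⟩⟩

theorem convex_disc (c d r : ℝ) :
    Convex ℝ {p : ℝ × ℝ | (p.1 - c) ^ 2 + (p.2 - d) ^ 2 < r} := by
  rintro ⟨x, y⟩ (h : (x - c) ^ 2 + (y - d) ^ 2 < r) ⟨x', y'⟩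
    (h' : (x' - c) ^ 2 + (y' - d) ^ 2 < r) s t hs ht hst
  change (s * x + t * x' - c) ^ 2 + (s * y + t * y' - d) ^ 2 < r
  obtain rfl : t = 1 - s := by linarith
  have e : (s * x + (1 - s) * x' - c) ^ 2 + (s * y + (1 - s) * y' - d) ^ 2 =
      s * ((x - c) ^ 2 + (y - d) ^ 2) + (1 - s) * ((x' - c) ^ 2 + (y' - d) ^ 2)
      - s * (1 - s) * ((x - x') ^ 2 + (y - y') ^ 2) := by ring
  have hpos : 0 ≤ s * (1 - s) * ((x - x') ^ 2 + (y - y') ^ 2) := by positivity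
  rcases hs.eq_or_lt with rfl | hs'
  · nlinarith
  · nlinarith [mul_le_mul_of_nonneg_left h'.le ht, mul_lt_mul_of_pos_left h hs']

theorem uniqueDiffOn_closure_stadium {a : ℝ} (ha : 0 < a) :
    UniqueDiffOn ℝ (closure (stadium a)) := by
  have hsub : ∀ C : Set (ℝ × ℝ), Convex ℝ C → IsOpen C → C.Nonempty → C ⊆ stadium a →
      ∀ p ∈ closure C, UniqueDiffWithinAt ℝ (closure (stadium a)) p :=
    fun C hC ho hne hCS p hp => (uniqueDiffWithinAt_convex hC (by rwa [ho.interior_eq]) hp).mono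
      (hCS.trans subset_closure)
  have hd0 : {p : ℝ × ℝ | p.1 ^ 2 + (p.2 - a / 2) ^ 2 < (a / 2) ^ 2} =
      {p : ℝ × ℝ | (p.1 - 0) ^ 2 + (p.2 - a / 2) ^ 2 < (a / 2) ^ 2} := by simp
  intro p hp
  rw [stadium, closure_union, closure_union] at hp
  rcases hp with (hp | hp) | hp
  · exact hsub _ ((convex_Ioo 0 1).prod (convex_Ioo 0 a)) (isOpen_Ioo.prod isOpen_Ioo)
      ⟨(1 / 2, a / 2), by norm_num, by constructor <;> simp <;> linarith⟩
      (fun q hq => Or.inl (Or.inl hq)) p hp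
  · refine hsub _ ?_ (isOpen_lt (by fun_prop) (by fun_prop)) ⟨(0, a / 2), ?_⟩
      (fun q hq => Or.inl (Or.inr hq)) p hp
    · rw [hd0]
      exact convex_disc _ _ _
    · simpa using pow_pos (half_pos ha) 2
  · refine hsub _ (convex_disc _ _ _) (isOpen_lt (by fun_prop) (by fun_prop)) ⟨(1, a / 2), ?_⟩
      (fun q hq => Or.inr hq) p hp
    simpa using pow_pos (half_pos ha) 2

theorem box_subset_stadium (a : ℝ) : Set.Ioo (0 : ℝ) 1 ×ˢ Set.Ioo 0 a ⊆ stadium a :=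
  fun _ h => Or.inl (Or.inl h)

theorem closedBox_subset_closure_stadium {a : ℝ} (ha : 0 < a) :
    Set.Icc (0 : ℝ) 1 ×ˢ Set.Icc 0 a ⊆ closure (stadium a) := by
  rw [← closure_Ioo zero_ne_one, ← closure_Ioo ha.ne, ← closure_prod_eq]
  exact closure_mono (box_subset_stadium a)

theorem snd_mem_of_mem_stadium {a : ℝ} (ha : 0 < a) {p : ℝ × ℝ} (hp : p ∈ stadium a) :
    p.2 ∈ Set.Ioo 0 a := by
  rcases hp with (h | h) | h
  · exact h.2
  · have h : p.1 ^ 2 + (p.2 - a / 2) ^ 2 < (a / 2) ^ 2 := h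
    constructor <;> nlinarith
  · have h : (p.1 - 1) ^ 2 + (p.2 - a / 2) ^ 2 < (a / 2) ^ 2 := h
    constructor <;> nlinarith

theorem mem_frontier_stadium {a x y : ℝ} (ha : 0 < a) (hx : x ∈ Set.Icc (0 : ℝ) 1)
    (hy : y = 0 ∨ y = a) : (x, y) ∈ frontier (stadium a) := by
  rw [(isOpen_stadium a).frontier_eq]
  refine ⟨closedBox_subset_closure_stadium ha ⟨hx, ?_⟩, fun h => ?_⟩
  · rcases hy with rfl | rfl
    · exact ⟨le_rfl, ha.le⟩
    · exact ⟨ha.le, le_rfl⟩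
  · have := snd_mem_of_mem_stadium ha h
    rcases hy with rfl | rfl
    · exact lt_irrefl _ this.1
    · exact lt_irrefl _ this.2

/-- A smooth cutoff `χ` on `[0,1]` with its first two derivatives. -/
theorem exists_cutoff {ε : ℝ} (hε0 : 0 < ε) (hε : ε < 1 / 2) :
    ∃ (χ χ₁ χ₂ : ℝ → ℝ) (M : ℝ), Continuous χ ∧ Continuous χ₁ ∧ Continuous χ₂ ∧
      (∀ x, HasDerivAt χ (χ₁ x) x) ∧ (∀ x, HasDerivAt χ₁ (χ₂ x) x) ∧
      χ 0 = 0 ∧ χ 1 = 0 ∧ χ₁ 0 = 0 ∧ (∀ x, χ x ^ 2 ≤ 1) ∧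
      (∀ x ∈ Set.Icc (0 : ℝ) 1, χ₁ x ^ 2 + χ₂ x ^ 2 ≤ M) ∧
      ∀ x ∈ Set.Icc ε (1 - ε), χ x = 1 ∧ χ₁ x = 0 ∧ χ₂ x = 0 := by
  let b : ContDiffBump (1 / 2 : ℝ) :=
    ⟨1 / 2 - 3 / 4 * ε, 1 / 2 - ε / 2, by linarith, by linarith⟩
  have hb : ContDiff ℝ 2 b := b.contDiff
  have hb1 : ContDiff ℝ 1 (deriv b) := by
    have : ContDiff ℝ (1 + 1) b := by norm_num; exact hb
    exact (contDiff_succ_iff_deriv.1 this).2.2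
  have hc2 : Continuous (deriv (deriv b)) := hb1.continuous_deriv le_rfl
  obtain ⟨M, hM⟩ := (isCompact_Icc (a := (0 : ℝ)) (b := 1)).exists_bound_of_continuousOn
    (f := fun x => deriv b x ^ 2 + deriv (deriv b) x ^ 2)
    ((hb1.continuous.pow 2).add (hc2.pow 2)).continuousOn
  have hzero : ∀ x : ℝ, 1 / 2 - ε / 2 ≤ |x - 1 / 2| → b x = 0 := fun x hx =>
    b.zero_of_le_dist (by rw [Real.dist_eq]; exact hx)
  have hone : Set.EqOn b (fun _ => 1) (Metric.ball (1 / 2) (1 / 2 - 3 / 4 * ε)) := fun x hx =>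
    b.one_of_mem_closedBall (Metric.ball_subset_closedBall hx)
  have hone1 : Set.EqOn (deriv b) (fun _ => 0) (Metric.ball (1 / 2) (1 / 2 - 3 / 4 * ε)) := by
    intro x hx
    rw [(hone.eventuallyEq_of_mem (Metric.isOpen_ball.mem_nhds hx)).deriv_eq]
    simp
  refine ⟨b, deriv b, deriv (deriv b), M, hb.continuous, hb1.continuous, hc2,
    fun x => (hb.differentiable two_ne_zero x).hasDerivAt,
    fun x => (hb1.differentiable one_ne_zero x).hasDerivAt,
    hzero 0 (by norm_num; linarith), hzero 1 (by norm_num; linarith), ?_, ?_, ?_, ?_⟩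
  · have : (b : ℝ → ℝ) =ᶠ[nhds 0] fun _ => 0 := by
      filter_upwards [Iio_mem_nhds (show (0 : ℝ) < ε / 2 by linarith)] with x hx
      have hx : x < ε / 2 := hx
      exact hzero x (by rw [abs_of_neg (by linarith)]; linarith)
    rw [this.deriv_eq]
    simp
  · intro x
    nlinarith [b.nonneg' x, b.le_one (x := x)]
  · exact fun x hx => (le_abs_self _).trans (hM x hx)
  · intro x hx
    have hxb : x ∈ Metric.ball (1 / 2 : ℝ) (1 / 2 - 3 / 4 * ε) := by
      rw [Metric.mem_ball, Real.dist_eq, abs_lt]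
      constructor <;> linarith [hx.1, hx.2]
    refine ⟨hone hxb, hone1 hxb, ?_⟩
    rw [(hone1.eventuallyEq_of_mem (Metric.isOpen_ball.mem_nhds hxb)).deriv_eq]
    simp

/-- **Theorem 3′ of Burq–Zworski (estimate (6.11)):** resolvent observability on the
Bunimovich stadium, uniform in the real spectral parameter `z`, where the control region
`ω = {(x,y) ∈ Ω : x < ε or x > 1 - ε}` consists of the two wings together with thin
vertical strips of the rectangle. -/
theorem stadium_resolvent_observability
    (a : ℝ) (ha : 0 < a) (ε : ℝ) (hε0 : 0 < ε) (hε : ε < 1 / 2) :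
    ∃ C > (0:ℝ), ∀ (z : ℝ) (v f : ℝ × ℝ → ℂ),
      ContDiffOn ℝ 2 v (closure (stadium a)) →
      (∀ p ∈ frontier (stadium a), v p = 0) →
      (∀ p ∈ stadium a, lap2 v p - (z : ℂ) * v p = f p) →
      ∫ p in stadium a, ‖v p‖ ^ 2 ≤
        C * ((∫ p in stadium a, ‖f p‖ ^ 2)
            + ∫ p in {p ∈ stadium a | p.1 < ε ∨ 1 - ε < p.1}, ‖v p‖ ^ 2) := by
  obtain ⟨χ, χ₁, χ₂, M, hχ, hχ₁, hχ₂, hdχ, hdχ₁, hχ0, hχ1, hχ₁0, hχle, hχM, hχmid⟩ :=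
    exists_cutoff hε0 hε
  have hM : 0 ≤ M :=
    (add_nonneg (sq_nonneg _) (sq_nonneg _)).trans (hχM 0 ⟨le_rfl, zero_le_one⟩)
  refine ⟨21 + 20 * M, by positivity, fun z v f hv hv0 hf => ?_⟩
  have hSo := isOpen_stadium a
  have hBm : MeasurableSet (Set.Ioo (0 : ℝ) 1 ×ˢ Set.Ioo 0 a) :=
    measurableSet_Ioo.prod measurableSet_Ioo
  have hBK := closedBox_subset_closure_stadium ha
  have hBS := box_subset_stadium a
  obtain ⟨vx, vy, vxx, vyy, hvx, hvy, hvxx, hvyy, hd⟩ := exists_partial_derivs hSo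
    subset_closure (uniqueDiffOn_closure_stadium ha) hv
  have hvc := hv.continuousOn
  set g : ℝ × ℝ → ℂ := fun p => vxx p + vyy p - z * v p with hg
  have hgc : ContinuousOn g (closure (stadium a)) := by fun_prop
  set ω := {p ∈ stadium a | p.1 < ε ∨ 1 - ε < p.1} with hω
  have hωo : IsOpen ω := hSo.inter
    ((isOpen_lt continuous_fst continuous_const).union (isOpen_lt continuous_const continuous_fst))
  have hωS : ω ⊆ stadium a := fun p hp => hp.1
  have hint : ∀ {F : ℝ × ℝ → ℝ}, ContinuousOn F (closure (stadium a)) →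
      IntegrableOn F (stadium a) := fun hF =>
    (hF.integrableOn_compact (isCompact_closure_stadium ha)).mono_set subset_closure
  have hmid : ∀ p ∈ stadium a, p ∉ ω → p.1 ∈ Set.Icc ε (1 - ε) := fun p hp hpω => by
    by_contra hcon
    refine hpω ⟨hp, ?_⟩
    rw [Set.mem_Icc, not_and_or, not_le, not_le] at hcon
    exact hcon
  have hfg : ∫ p in stadium a, ‖f p‖ ^ 2 = ∫ p in stadium a, ‖g p‖ ^ 2 :=
    setIntegral_congr_fun hSo.measurableSet fun p hp => by
      simp only [hg, ← hf p hp, (hd p.1 p.2 hp).2.2.2.2]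
  have hmem : ∀ x ∈ Set.Ioo (0 : ℝ) 1, ∀ y ∈ Set.Ioo 0 a, (x, y) ∈ stadium a :=
    fun x hx y hy => hBS ⟨hx, hy⟩
  have hbox := cutoff_estimate_complex ha z hχ₂ hdχ hdχ₁ hχ0 hχ1 hχ₁0 (hvc.mono hBK)
    (hvx.mono hBK) (hvy.mono hBK) (hvxx.mono hBK) (hvyy.mono hBK)
    (fun x hx y hy => (hd x y (hmem x hx y hy)).1)
    (fun x hx y hy => (hd x y (hmem x hx y hy)).2.1)
    (fun x hx y hy => (hd x y (hmem x hx y hy)).2.2.1)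
    (fun x hx y hy => (hd x y (hmem x hx y hy)).2.2.2.1)
    (fun x hx => hv0 _ (mem_frontier_stadium ha (Set.Ioo_subset_Icc_self hx) (Or.inl rfl)))
    (fun x hx => hv0 _ (mem_frontier_stadium ha (Set.Ioo_subset_Icc_self hx) (Or.inr rfl)))
  have hrhs : ∫ p in Set.Ioo (0 : ℝ) 1 ×ˢ Set.Ioo 0 a,
      ((χ p.1 * ‖g p‖) ^ 2 + (χ₁ p.1 * ‖v p‖) ^ 2 + (χ₂ p.1 * ‖v p‖) ^ 2) ≤
      (∫ p in stadium a, ‖g p‖ ^ 2) + M * ∫ p in ω, ‖v p‖ ^ 2 := by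
    have hωint : IntegrableOn (ω.indicator fun p => M * ‖v p‖ ^ 2) (stadium a) :=
      (hint (by fun_prop)).indicator hωo.measurableSet
    calc _ ≤ ∫ p in Set.Ioo (0 : ℝ) 1 ×ˢ Set.Ioo 0 a,
          (‖g p‖ ^ 2 + ω.indicator (fun p => M * ‖v p‖ ^ 2) p) := by
          refine setIntegral_mono_on ((hint (by fun_prop)).mono_set hBS)
            (((hint (by fun_prop)).add hωint).mono_set hBS) hBm fun p hp => ?_
          have h1 : (χ p.1 * ‖g p‖) ^ 2 ≤ ‖g p‖ ^ 2 := by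
            rw [mul_pow]
            exact mul_le_of_le_one_left (sq_nonneg _) (hχle _)
          have h2 : (χ₁ p.1 * ‖v p‖) ^ 2 + (χ₂ p.1 * ‖v p‖) ^ 2 ≤
              ω.indicator (fun p => M * ‖v p‖ ^ 2) p := by
            by_cases hpω : p ∈ ω
            · rw [Set.indicator_of_mem hpω, mul_pow, mul_pow, ← add_mul]
              exact mul_le_mul_of_nonneg_right (hχM _ (Set.Ioo_subset_Icc_self hp.1))
                (sq_nonneg _)
            · obtain ⟨-, e1, e2⟩ := hχmid _ (hmid p (hBS hp) hpω)
              simp [Set.indicator_of_notMem hpω, e1, e2]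
          linarith
      _ ≤ ∫ p in stadium a, (‖g p‖ ^ 2 + ω.indicator (fun p => M * ‖v p‖ ^ 2) p) :=
          setIntegral_mono_set ((hint (by fun_prop)).add hωint)
            (Filter.Eventually.of_forall fun p => add_nonneg (sq_nonneg _)
              (Set.indicator_nonneg (fun _ _ => by positivity) p)) hBS.eventuallyLE
      _ = _ := by
          rw [integral_add (hint (by fun_prop)) hωint, setIntegral_indicator hωo.measurableSet,
            Set.inter_eq_right.2 hωS, integral_const_mul]
  have hsplit : ∫ p in stadium a, ‖v p‖ ^ 2 ≤ (∫ p in ω, ‖v p‖ ^ 2) +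
      ∫ p in Set.Ioo (0 : ℝ) 1 ×ˢ Set.Ioo 0 a, (χ p.1 * ‖v p‖) ^ 2 := by
    rw [← integral_inter_add_sdiff hωo.measurableSet (hint (F := fun p => ‖v p‖ ^ 2)
      (by fun_prop)), Set.inter_eq_right.2 hωS]
    gcongr
    calc ∫ p in stadium a \ ω, ‖v p‖ ^ 2 = ∫ p in stadium a \ ω, (χ p.1 * ‖v p‖) ^ 2 :=
          setIntegral_congr_fun (hSo.measurableSet.diff hωo.measurableSet) fun p hp => by
            simp only [(hχmid _ (hmid p hp.1 hp.2)).1, one_mul]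
      _ ≤ _ := by
          refine setIntegral_mono_set ((hint (by fun_prop)).mono_set hBS)
            (Filter.Eventually.of_forall fun p => sq_nonneg _) (LE.le.eventuallyLE ?_)
          intro p hp
          have h := hmid p hp.1 hp.2
          exact ⟨⟨by linarith [h.1], by linarith [h.2]⟩, snd_mem_of_mem_stadium ha hp.1⟩
  have hg0 : 0 ≤ ∫ p in stadium a, ‖g p‖ ^ 2 := integral_nonneg fun _ => sq_nonneg _
  have hw0 : 0 ≤ ∫ p in ω, ‖v p‖ ^ 2 := integral_nonneg fun _ => sq_nonneg _
  rw [hfg]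
  nlinarith [mul_nonneg hM hg0]
end
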